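/- In the uniqueness regime of the two-dimensional Ising model (i.e. h ≠ 0, or h = 0 and β < β_c), the Schonmann projection ν_{β,h}^+ is a regular g-measure: there is a continuous g-function P with values in (0,1) such that ν_{β,h}^+ is a g-measure consistent with P; moreover the variations of P are summable, ∑_{k≥1} var_k(P) < ∞, and ν_{β,h}^+ is the unique g-measure consistent with P. -/

import Mathlib

open MeasureTheory Filter Topology ProbabilityTheory

noncomputable section

/-- Spin value of a Boolean spin: `true ↦ +1`, `false ↦ -1`. -/
def sval (b : Bool) : ℝ := if b then 1 else -1

/-- Two-dimensional spin configurations. -/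
abbrev Cfg2 := ℤ × ℤ → Bool

/-- Two-sided sequences over an alphabet `A`. -/
abbrev ZSeq (A : Type*) := ℤ → A

/-- Pasts: index `k` corresponds to the coordinate `-(k+1)`. -/
abbrev Past (A : Type*) := ℕ → A

/-- The four nearest neighbours of a site of `ℤ²`. -/
def nbrs (x : ℤ × ℤ) : Finset (ℤ × ℤ) :=
  {(x.1 + 1, x.2), (x.1 - 1, x.2), (x.1, x.2 + 1), (x.1, x.2 - 1)}

/-- Boltzmann weight
`exp(β[Σ_{{x,y}⊆Λ, x∼y} ω_x ω_y + Σ_{x∈Λ, y∉Λ, x∼y} ω_x σ_y] − h Σ_{x∈Λ} ω_x)`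
(the sum over unordered pairs inside `Λ` is written as half the ordered sum). -/
def isingWeight (β h : ℝ) (Λ : Finset (ℤ × ℤ)) (σ ω : Cfg2) : ℝ :=
  Real.exp (β * ((∑ x ∈ Λ, ∑ y ∈ Λ.filter (fun y => y ∈ nbrs x),
        sval (ω x) * sval (ω y)) / 2
      + ∑ x ∈ Λ, ∑ y ∈ (nbrs x).filter (fun y => y ∉ Λ), sval (ω x) * sval (σ y))
    - h * ∑ x ∈ Λ, sval (ω x))

/-- Fill in the values `τ` inside `Λ` and `σ` outside. -/
def fill (Λ : Finset (ℤ × ℤ)) (σ : Cfg2) (τ : ↥Λ → Bool) : Cfg2 :=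
  fun x => if hx : x ∈ Λ then τ ⟨x, hx⟩ else σ x

/-- The finite-volume Ising measure in `Λ` with boundary condition `σ`, viewed as a measure on
the full configuration space, the spins outside `Λ` being frozen to `σ`. -/
def isingFV (β h : ℝ) (Λ : Finset (ℤ × ℤ)) (σ : Cfg2) : Measure Cfg2 :=
  (∑ τ : ↥Λ → Bool, ENNReal.ofReal (isingWeight β h Λ σ (fill Λ σ τ)))⁻¹ •
    ∑ τ : ↥Λ → Bool,
      ENNReal.ofReal (isingWeight β h Λ σ (fill Λ σ τ)) • Measure.dirac (fill Λ σ τ)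

/-- The box `[-n,n]²`. -/
def box (n : ℕ) : Finset (ℤ × ℤ) :=
  (Finset.Icc (-(n : ℤ)) (n : ℤ)) ×ˢ (Finset.Icc (-(n : ℤ)) (n : ℤ))

/-- Convergence of a sequence of measures on a product space in the sense of convergence of the
measures of all finite-dimensional cylinder events; for probability measures on `{−1,+1}^ι`
this is exactly weak convergence. -/
def CylTendsto {ι A : Type*} [MeasurableSpace A] (μs : ℕ → Measure (ι → A))
    (μ : Measure (ι → A)) : Prop :=
  ∀ (s : Finset ι) (f : ι → A),
    Tendsto (fun n => μs n {η | ∀ i ∈ s, η i = f i}) atTop (𝓝 (μ {η | ∀ i ∈ s, η i = f i}))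

/-- `μ` is the plus phase `μ_{β,h}^+`: the weak limit of the finite-volume Ising measures on
`[-n,n]²` with all-plus boundary conditions. -/
def IsPlusPhase (β h : ℝ) (μ : Measure Cfg2) : Prop :=
  IsProbabilityMeasure μ ∧ CylTendsto (fun n => isingFV β h (box n) (fun _ => true)) μ

/-- `μ` is the minus phase `μ_{β,h}^-`. -/
def IsMinusPhase (β h : ℝ) (μ : Measure Cfg2) : Prop :=
  IsProbabilityMeasure μ ∧ CylTendsto (fun n => isingFV β h (box n) (fun _ => false)) μ

/-- The critical inverse temperature `β_c = ln(1+√2)/2`. -/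
def betaCrit : ℝ := Real.log (1 + Real.sqrt 2) / 2

/-- Projection of a two-dimensional configuration onto the line `ℤ × {0}`. -/
def lineProj (η : Cfg2) : ZSeq Bool := fun i => η (i, 0)

/-- The Schonmann projection of a measure on `{−1,+1}^{ℤ²}`. -/
def schonmann (μ : Measure Cfg2) : Measure (ZSeq Bool) := μ.map lineProj

/-- Restriction of a two-sided sequence to its strict past; index `k` is coordinate `-(k+1)`. -/
def restrictPast {A : Type*} (ω : ZSeq A) : Past A := fun k => ω (-(k + 1 : ℤ))

/-- The shift on two-sided sequences. -/
def shiftSeq {A : Type*} : ZSeq A → ZSeq A := fun ω i => ω (i + 1)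

/-- The σ-algebra `ℱ_{<0}` generated by the coordinates of negative index. -/
def pastSigma (A : Type*) [MeasurableSpace A] : MeasurableSpace (ZSeq A) :=
  MeasurableSpace.comap (fun ω : ZSeq A => restrictPast ω) inferInstance

/-- The σ-algebra generated by the coordinates in `S`. -/
def sigmaOn {ι A : Type*} [MeasurableSpace A] (S : Set ι) : MeasurableSpace (ι → A) :=
  MeasurableSpace.comap (fun ω : ι → A => S.restrict ω) inferInstance

/-- A g-function on the alphabet `A`: measurable, `[0,1]`-valued, normalized. -/
def IsGFunction {A : Type*} [Fintype A] [MeasurableSpace A] (P : A → Past A → ℝ) : Prop :=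
  (∀ a, Measurable (P a)) ∧ ∀ ω, (∑ a : A, P a ω) = 1 ∧ ∀ a, P a ω ∈ Set.Icc (0 : ℝ) 1

/-- `μ` is a translation-invariant g-measure consistent with the g-function `P`: for each `a`,
`ω ↦ P a (restrictPast ω)` is a version of the conditional probability `μ(X₀ = a | ℱ_{<0})`. -/
def IsGMeasure {A : Type*} [MeasurableSpace A] (μ : Measure (ZSeq A))
    (P : A → Past A → ℝ) : Prop :=
  IsProbabilityMeasure μ ∧ μ.map shiftSeq = μ ∧
    ∀ a : A, (fun ω => P a (restrictPast ω))
      =ᵐ[μ] μ[Set.indicator {ω : ZSeq A | ω 0 = a} (fun _ => (1 : ℝ)) | pastSigma A]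

/-- The `k`-th variation of a g-function: the supremum of `|P a ω − P a σ|` over pasts agreeing
on the coordinates `−k,…,−1`. -/
def varG {A : Type*} (P : A → Past A → ℝ) (k : ℕ) : ℝ :=
  sSup {d : ℝ | ∃ (a : A) (ω σ' : Past A), (∀ j < k, ω j = σ' j) ∧ d = |P a ω - P a σ'|}

/-- Elementary conditional probability `μ(B | A)`, as a real number. -/
def condProbR {X : Type*} [MeasurableSpace X] (μ : Measure X) (B A : Set X) : ℝ :=
  ((μ[|A]) B).toReal

/-- The event that `η_i = ω` (suitably reindexed) for `−n ≤ i ≤ −1` and `η_i = b`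
for `−(n+l) ≤ i ≤ −(n+1)`. -/
def pastEvt (n l : ℕ) (b : Bool) (ω : Past Bool) : Set (ZSeq Bool) :=
  {η | (∀ i : ℤ, -(n : ℤ) ≤ i → i ≤ -1 → η i = ω (i.natAbs - 1)) ∧
       (∀ i : ℤ, -((n : ℤ) + l) ≤ i → i ≤ -((n : ℤ) + 1) → η i = b)}

/-- The event that `η_i = b` for `−(n+l) ≤ i ≤ −n`. -/
def blockEvt (n l : ℕ) (b : Bool) : Set (ZSeq Bool) :=
  {η | ∀ i : ℤ, -((n : ℤ) + l) ≤ i → i ≤ -(n : ℤ) → η i = b}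

/-- The event that `η_i = b` for `−n ≤ i ≤ −1`. -/
def allBlock (n : ℕ) (b : Bool) : Set (ZSeq Bool) :=
  {η | ∀ i : ℤ, -(n : ℤ) ≤ i → i ≤ -1 → η i = b}

/-- `P` is the g-function `P^{+,b}` obtained from `ν` by conditioning on the symbol `b`
in the far past: `P(a|ω) = lim_n lim_l ν(η₀ = a | η = b on [−(n+l),−(n+1)], η = ω on [−n,−1])`,
both iterated limits being required to exist. -/
def IsCondG (ν : Measure (ZSeq Bool)) (b : Bool) (P : Bool → Past Bool → ℝ) : Prop :=
  ∀ (a : Bool) (ω : Past Bool), ∃ L : ℕ → ℝ,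
    (∀ n, Tendsto (fun l => condProbR ν {η | η 0 = a} (pastEvt n l b ω)) atTop (𝓝 (L n))) ∧
    Tendsto L atTop (𝓝 (P a ω))

/-- `ν'` is the iterated weak limit `lim_n lim_l ν( · | η = b on [−(n+l),−n])`. -/
def IsCondLimitMeasure (ν : Measure (ZSeq Bool)) (b : Bool) (ν' : Measure (ZSeq Bool)) : Prop :=
  ∃ νseq : ℕ → Measure (ZSeq Bool),
    (∀ n, CylTendsto (fun l => ν[|blockEvt n l b]) (νseq n)) ∧ CylTendsto νseq ν'

/-- Stochastic domination: `ν ≤ μ` iff `ν B ≤ μ B` for every increasing measurable event `B`. -/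
def StochDom {A : Type*} [MeasurableSpace A] [Preorder A]
    (ν μ : Measure (ZSeq A)) : Prop :=
  ∀ B : Set (ZSeq A), MeasurableSet B → (∀ ⦃x y : ZSeq A⦄, x ≤ y → x ∈ B → y ∈ B) → ν B ≤ μ B

/-- `π` is the i.i.d. product measure with `π(η_i = +1) = ρ` for each coordinate. -/
def IsBernoulliProd (ρ : ℝ) (π : Measure (ZSeq Bool)) : Prop :=
  IsProbabilityMeasure π ∧ ∀ (s : Finset ℤ) (f : ℤ → Bool),
    π {η | ∀ i ∈ s, η i = f i} = ∏ i ∈ s, ENNReal.ofReal (if f i then ρ else 1 - ρ)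

/-- Splicing of pasts: coordinates `−k,…,−1` (indices `< k`) from `ω`, the rest from `σ`. -/
def splice {A : Type*} (σ ω : Past A) (k : ℕ) : Past A := fun j => if j < k then ω j else σ j

/-- `ν'` is an extreme point of the convex set of g-measures consistent with `P`. -/
def ExtremeGMeasure (ν' : Measure (ZSeq Bool)) (P : Bool → Past Bool → ℝ) : Prop :=
  IsGMeasure ν' P ∧
  ∀ ν₁ ν₂ : Measure (ZSeq Bool), IsGMeasure ν₁ P → IsGMeasure ν₂ P →
    ∀ t : ℝ, t ∈ Set.Ioo (0 : ℝ) 1 →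
      ν' = ENNReal.ofReal t • ν₁ + ENNReal.ofReal (1 - t) • ν₂ → ν₁ = ν' ∧ ν₂ = ν'

/-- The event that the spins on the line are `−1` on `{−m,…,−n} × {0}`. -/
def lineMinusEvt (n m : ℕ) : Set Cfg2 :=
  {η | ∀ i : ℤ, -(m : ℤ) ≤ i → i ≤ -(n : ℤ) → η (i, 0) = false}

/-- Nearest-neighbour adjacency in `ℤ²` (`‖x−y‖₁ = 1`). -/
def adj2 (x y : ℤ × ℤ) : Prop := (x.1 - y.1).natAbs + (x.2 - y.2).natAbs = 1

/-- The event `A_n`: there is an infinite nearest-neighbour path of `+1` spins starting at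
`(n,0)` entirely contained in the half-plane `{x ≤ n}`. -/
def plusPathEvt (n : ℕ) : Set Cfg2 :=
  {η | ∃ γ : ℕ → ℤ × ℤ, γ 0 = ((n : ℤ), 0) ∧ (∀ j, adj2 (γ j) (γ (j + 1))) ∧
    Function.Injective γ ∧ (∀ j, (γ j).1 ≤ (n : ℤ)) ∧ ∀ j, η (γ j) = true}

/-- The block map for the decimation `ν_{l,k}`: the `j`-th letter consists of the spins on
`[j(k+l), j(k+l)+l−1]`. -/
def blockMap (l k : ℕ) (η : ZSeq Bool) : ZSeq (Fin l → Bool) :=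
  fun j r => η (j * ((k : ℤ) + l) + r)

end

noncomputable section

lemma sval_true : sval true = 1 := by simp [sval]
lemma sval_false : sval false = -1 := by simp [sval]
lemma sval_mul_self (b : Bool) : sval b * sval b = 1 := by cases b <;> simp [sval]
lemma sval_not (b : Bool) : sval (!b) = -sval b := by cases b <;> simp [sval]
lemma abs_sval (b : Bool) : |sval b| = 1 := by cases b <;> simp [sval]
lemma sval_le_one (b : Bool) : sval b ≤ 1 := by cases b <;> simp [sval]
lemma neg_one_le_sval (b : Bool) : -1 ≤ sval b := by cases b <;> simp [sval]

lemma mem_nbrs_comm {x y : ℤ × ℤ} : y ∈ nbrs x ↔ x ∈ nbrs y := by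
  rcases x with ⟨a, b⟩
  rcases y with ⟨c, d⟩
  simp only [nbrs, Finset.mem_insert, Finset.mem_singleton, Prod.mk.injEq]
  omega

lemma card_nbrs_le (x : ℤ × ℤ) : (nbrs x).card ≤ 4 := by
  unfold nbrs
  exact (Finset.card_le_four)

/-- Configurations agreeing with `σ` outside `U`. -/
def agr (U : Finset (ℤ × ℤ)) (σ : Cfg2) : Finset Cfg2 := by
  classical exact Finset.univ.image (fill U σ)

lemma mem_agr {U : Finset (ℤ × ℤ)} {σ η : Cfg2} : η ∈ agr U σ ↔ ∀ x ∉ U, η x = σ x := by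
  classical
  simp only [agr, Finset.mem_image, Finset.mem_univ, true_and]
  constructor
  · rintro ⟨τ, rfl⟩ x hx
    simp [fill, hx]
  · intro h
    refine ⟨fun x => η x, ?_⟩
    funext x
    by_cases hx : x ∈ U
    · simp [fill, hx]
    · simp [fill, hx, h x hx]

lemma self_mem_agr (U : Finset (ℤ × ℤ)) (σ : Cfg2) : σ ∈ agr U σ := mem_agr.2 fun _ _ => rfl

lemma agr_congr {U : Finset (ℤ × ℤ)} {σ σ' : Cfg2} (h : ∀ x ∉ U, σ x = σ' x) :
    agr U σ = agr U σ' := by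
  ext η
  simp only [mem_agr]
  exact forall₂_congr fun x hx => by rw [h x hx]

lemma agr_eq_of_mem {U : Finset (ℤ × ℤ)} {σ η : Cfg2} (h : η ∈ agr U σ) : agr U η = agr U σ :=
  agr_congr (mem_agr.1 h)

lemma agr_comm {U : Finset (ℤ × ℤ)} {σ η : Cfg2} : η ∈ agr U σ ↔ σ ∈ agr U η := by
  simp only [mem_agr]
  exact forall₂_congr fun x hx => eq_comm

lemma fill_injective (U : Finset (ℤ × ℤ)) (σ : Cfg2) : Function.Injective (fill U σ) := by
  intro τ τ' h
  funext x
  have := congrFun h x.1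
  simpa [fill, x.2] using this

lemma sum_agr {M : Type*} [AddCommMonoid M] (U : Finset (ℤ × ℤ)) (σ : Cfg2) (g : Cfg2 → M) :
    ∑ η ∈ agr U σ, g η = ∑ τ : ↥U → Bool, g (fill U σ τ) := by
  classical
  rw [agr, Finset.sum_image]
  exact fun _ _ _ _ h => fill_injective U σ h

/-- Interaction energy of the region `U`. -/
def engy (U : Finset (ℤ × ℤ)) (η : Cfg2) : ℝ :=
  ∑ x ∈ U, ∑ y ∈ nbrs x, (if y ∈ U then (1 / 2 : ℝ) else 1) * (sval (η x) * sval (η y))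

/-- Boltzmann weight of `η` in `U`. -/
def gw (β h : ℝ) (U : Finset (ℤ × ℤ)) (η : Cfg2) : ℝ :=
  Real.exp (β * engy U η - h * ∑ x ∈ U, sval (η x))

lemma gw_pos (β h : ℝ) (U : Finset (ℤ × ℤ)) (η : Cfg2) : 0 < gw β h U η := Real.exp_pos _

lemma isingWeight_eq_gw (β h : ℝ) (U : Finset (ℤ × ℤ)) (σ η : Cfg2) (hη : η ∈ agr U σ) :
    isingWeight β h U σ η = gw β h U η := by
  classical
  unfold isingWeight gw engy
  congr 3
  rw [Finset.sum_div, ← Finset.sum_add_distrib]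
  refine Finset.sum_congr rfl fun x hx => ?_
  have h1 : U.filter (fun y => y ∈ nbrs x) = (nbrs x).filter (fun y => y ∈ U) := by
    ext y; simp [and_comm]
  rw [h1, Finset.sum_div, ← Finset.sum_filter_add_sum_filter_not (nbrs x) (fun y => y ∈ U)]
  congr 1
  · refine Finset.sum_congr rfl fun y hy => ?_
    rw [if_pos (Finset.mem_filter.1 hy).2]; ring
  · refine Finset.sum_congr rfl fun y hy => ?_
    rw [if_neg (Finset.mem_filter.1 hy).2, mem_agr.1 hη y (Finset.mem_filter.1 hy).2]; ring

lemma engy_eq_pairs (U W : Finset (ℤ × ℤ)) (hUW : U ⊆ W) (hn : ∀ x ∈ U, nbrs x ⊆ W) (η : Cfg2) :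
    engy U η = (1 / 2) * ∑ x ∈ W, ∑ y ∈ W, if (y ∈ nbrs x) ∧ (x ∈ U ∨ y ∈ U) then
      sval (η x) * sval (η y) else 0 := by
  classical
  have key : ∀ x y : ℤ × ℤ, (if (y ∈ nbrs x) ∧ (x ∈ U ∨ y ∈ U) then
      sval (η x) * sval (η y) else 0) =
      (if x ∈ U ∧ y ∈ nbrs x then (if y ∈ U then (1 / 2 : ℝ) else 1) *
        (sval (η x) * sval (η y)) else 0) +
      (if y ∈ U ∧ x ∈ nbrs y then (if x ∈ U then (1 / 2 : ℝ) else 1) *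
        (sval (η y) * sval (η x)) else 0) := by
    intro x y
    by_cases h1 : y ∈ nbrs x <;> by_cases h2 : x ∈ U <;> by_cases h3 : y ∈ U <;>
      simp [h1, h2, h3, mem_nbrs_comm.1, mem_nbrs_comm (x := y) (y := x)] <;> ring
  have e1 : engy U η = ∑ x ∈ W, ∑ y ∈ W,
      (if x ∈ U ∧ y ∈ nbrs x then (if y ∈ U then (1 / 2 : ℝ) else 1) *
        (sval (η x) * sval (η y)) else 0) := by
    unfold engy
    rw [← Finset.sum_subset hUW]
    · refine Finset.sum_congr rfl fun x hx => ?_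
      rw [← Finset.sum_subset (hn x hx)]
      · refine Finset.sum_congr rfl fun y hy => ?_
        rw [if_pos (show x ∈ U ∧ y ∈ nbrs x from ⟨hx, hy⟩)]
      · intro y _ hy
        rw [if_neg (fun h => hy h.2)]
    · intro x _ hx
      refine Finset.sum_eq_zero fun y _ => ?_
      rw [if_neg (fun h => hx h.1)]
  simp_rw [key, Finset.sum_add_distrib]
  rw [Finset.sum_comm (f := fun x y => (if y ∈ U ∧ x ∈ nbrs y then
    (if x ∈ U then (1 / 2 : ℝ) else 1) * (sval (η y) * sval (η x)) else 0)), ← e1]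
  ring

lemma gw_swap (β h : ℝ) {U V : Finset (ℤ × ℤ)} (hVU : V ⊆ U) {η ζ : Cfg2}
    (hηζ : ∀ x ∉ V, η x = ζ x) :
    gw β h U η * gw β h V ζ = gw β h U ζ * gw β h V η := by
  classical
  unfold gw
  rw [← Real.exp_add, ← Real.exp_add]
  congr 1
  have hE : engy U η - engy V η = engy U ζ - engy V ζ := by
    set W := U ∪ U.biUnion nbrs with hW
    have hUW : U ⊆ W := Finset.subset_union_left
    have hn : ∀ x ∈ U, nbrs x ⊆ W := fun x hx =>
      (Finset.subset_biUnion_of_mem nbrs hx).trans Finset.subset_union_right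
    rw [engy_eq_pairs U W hUW hn, engy_eq_pairs V W (hVU.trans hUW) (fun x hx => hn x (hVU hx)),
      engy_eq_pairs U W hUW hn, engy_eq_pairs V W (hVU.trans hUW) (fun x hx => hn x (hVU hx)),
      ← mul_sub, ← mul_sub, ← Finset.sum_sub_distrib, ← Finset.sum_sub_distrib]
    congr 1
    refine Finset.sum_congr rfl fun x _ => ?_
    rw [← Finset.sum_sub_distrib, ← Finset.sum_sub_distrib]
    refine Finset.sum_congr rfl fun y _ => ?_
    by_cases hx : x ∈ V
    · simp [hx, hVU hx]
    · by_cases hy : y ∈ V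
      · simp [hy, hVU hy]
      · rw [hηζ x hx, hηζ y hy]
  have hF : ∑ x ∈ U, sval (η x) - ∑ x ∈ V, sval (η x)
      = ∑ x ∈ U, sval (ζ x) - ∑ x ∈ V, sval (ζ x) := by
    rw [← Finset.sum_sdiff hVU, ← Finset.sum_sdiff hVU (f := fun x => sval (ζ x))]
    simp only [add_sub_cancel_right]
    exact Finset.sum_congr rfl fun x hx => by rw [hηζ x (Finset.mem_sdiff.1 hx).2]
  linear_combination β * hE - h * hF

/-- Partition function. -/
def pf (β h : ℝ) (U : Finset (ℤ × ℤ)) (σ : Cfg2) : ℝ := ∑ η ∈ agr U σ, gw β h U η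

lemma pf_pos (β h : ℝ) (U : Finset (ℤ × ℤ)) (σ : Cfg2) : 0 < pf β h U σ :=
  Finset.sum_pos (fun _ _ => gw_pos _ _ _ _) ⟨σ, self_mem_agr U σ⟩

/-- Finite-volume expectation of `f` in `U` with boundary condition `σ`. -/
def ev (β h : ℝ) (U : Finset (ℤ × ℤ)) (f : Cfg2 → ℝ) (σ : Cfg2) : ℝ :=
  (∑ η ∈ agr U σ, gw β h U η * f η) / pf β h U σ

section
variable {β h : ℝ} {U V : Finset (ℤ × ℤ)} {f g : Cfg2 → ℝ} {σ σ' : Cfg2}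

lemma ev_congr (hfg : ∀ η ∈ agr U σ, f η = g η) : ev β h U f σ = ev β h U g σ := by
  unfold ev
  congr 1
  exact Finset.sum_congr rfl fun η hη => by rw [hfg η hη]

lemma ev_congr_bd (hσ : ∀ x ∉ U, σ x = σ' x) : ev β h U f σ = ev β h U f σ' := by
  unfold ev pf
  rw [agr_congr hσ]

lemma ev_mono (hfg : ∀ η ∈ agr U σ, f η ≤ g η) : ev β h U f σ ≤ ev β h U g σ := by
  unfold ev
  refine div_le_div_of_nonneg_right ?_ (pf_pos _ _ _ _).le
  exact Finset.sum_le_sum fun η hη => mul_le_mul_of_nonneg_left (hfg η hη) (gw_pos _ _ _ _).le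

lemma ev_const (c : ℝ) : ev β h U (fun _ => c) σ = c := by
  unfold ev
  rw [← Finset.sum_mul, ← pf, mul_div_assoc, mul_div_cancel₀]
  exact (pf_pos _ _ _ _).ne'

lemma ev_of_const {c : ℝ} (hf : ∀ η ∈ agr U σ, f η = c) : ev β h U f σ = c := by
  rw [ev_congr hf, ev_const]

lemma ev_add : ev β h U (fun η => f η + g η) σ = ev β h U f σ + ev β h U g σ := by
  unfold ev
  simp only [mul_add, Finset.sum_add_distrib, add_div]

lemma ev_sub : ev β h U (fun η => f η - g η) σ = ev β h U f σ - ev β h U g σ := by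
  unfold ev
  simp only [mul_sub, Finset.sum_sub_distrib, sub_div]

lemma ev_mul_left (c : ℝ) : ev β h U (fun η => c * f η) σ = c * ev β h U f σ := by
  unfold ev
  rw [← mul_div_assoc, Finset.mul_sum]
  congr 1
  exact Finset.sum_congr rfl fun _ _ => by ring

lemma ev_sum {ι : Type*} (s : Finset ι) (F : ι → Cfg2 → ℝ) :
    ev β h U (fun η => ∑ i ∈ s, F i η) σ = ∑ i ∈ s, ev β h U (F i) σ := by
  classical
  induction s using Finset.induction_on with
  | empty => simp [ev_const]
  | insert a s ha ih => simp only [Finset.sum_insert ha, ev_add, ih]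

lemma ev_nonneg (hf : ∀ η ∈ agr U σ, 0 ≤ f η) : 0 ≤ ev β h U f σ := by
  rw [← ev_const (β := β) (h := h) (U := U) (σ := σ) 0]
  exact ev_mono hf

lemma ev_le_const {c : ℝ} (hf : ∀ η ∈ agr U σ, f η ≤ c) : ev β h U f σ ≤ c := by
  rw [← ev_const (β := β) (h := h) (U := U) (σ := σ) c]
  exact ev_mono hf

lemma const_le_ev {c : ℝ} (hf : ∀ η ∈ agr U σ, c ≤ f η) : c ≤ ev β h U f σ := by
  rw [← ev_const (β := β) (h := h) (U := U) (σ := σ) c]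
  exact ev_mono hf

lemma agr_mono (hVU : V ⊆ U) {η : Cfg2} (hη : η ∈ agr V σ) : η ∈ agr U σ :=
  mem_agr.2 fun x hx => mem_agr.1 hη x fun hx' => hx (hVU hx')

lemma agr_trans (hVU : V ⊆ U) {η ζ : Cfg2} (hη : η ∈ agr U σ) (hζ : ζ ∈ agr V η) :
    ζ ∈ agr U σ :=
  (agr_eq_of_mem hη) ▸ agr_mono hVU hζ

lemma pf_eq_of_mem {η : Cfg2} (hη : η ∈ agr U σ) : pf β h U η = pf β h U σ := by
  unfold pf; rw [agr_eq_of_mem hη]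

/-- Consistency of the finite-volume expectations. -/
lemma ev_tower (hVU : V ⊆ U) : ev β h U (ev β h V f) σ = ev β h U f σ := by
  unfold ev
  congr 1
  have h1 : ∀ η ∈ agr U σ, gw β h U η * ((∑ ζ ∈ agr V η, gw β h V ζ * f ζ) / pf β h V η)
      = ∑ ζ ∈ agr V η, gw β h U ζ * f ζ * (gw β h V η / pf β h V ζ) := by
    intro η _
    rw [Finset.sum_div, Finset.mul_sum]
    refine Finset.sum_congr rfl fun ζ hζ => ?_
    rw [pf_eq_of_mem hζ]
    have := gw_swap β h hVU (η := η) (ζ := ζ) (fun x hx => (mem_agr.1 hζ x hx).symm)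
    have hp := (pf_pos β h V η).ne'
    field_simp
    linear_combination f ζ * this
  rw [Finset.sum_congr rfl h1]
  rw [Finset.sum_comm' (t' := agr U σ) (s' := fun ζ => agr V ζ)]
  · refine Finset.sum_congr rfl fun ζ _ => ?_
    rw [← Finset.mul_sum, ← Finset.sum_div, ← pf, div_self (pf_pos _ _ _ _).ne', mul_one]
  · intro η ζ
    constructor
    · rintro ⟨a, b⟩
      exact ⟨agr_comm.1 b, agr_trans hVU a b⟩
    · rintro ⟨a, b⟩
      exact ⟨agr_trans hVU b a, agr_comm.1 a⟩

lemma sval_lattice (a b c d : Bool) : sval a * sval b + sval c * sval d ≤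
    sval (a ⊓ c) * sval (b ⊓ d) + sval (a ⊔ c) * sval (b ⊔ d) := by
  cases a <;> cases b <;> cases c <;> cases d <;> norm_num [sval]

lemma sval_lattice' (a c : Bool) : sval a + sval c = sval (a ⊓ c) + sval (a ⊔ c) := by
  cases a <;> cases c <;> norm_num [sval]

lemma gw_logsupermodular (hβ : 0 ≤ β) (U : Finset (ℤ × ℤ)) (η ζ : Cfg2) :
    gw β h U η * gw β h U ζ ≤ gw β h U (η ⊓ ζ) * gw β h U (η ⊔ ζ) := by
  unfold gw
  rw [← Real.exp_add, ← Real.exp_add, Real.exp_le_exp]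
  have h1 : engy U η + engy U ζ ≤ engy U (η ⊓ ζ) + engy U (η ⊔ ζ) := by
    unfold engy
    simp only [← Finset.sum_add_distrib, ← mul_add]
    refine Finset.sum_le_sum fun x _ => Finset.sum_le_sum fun y _ => ?_
    refine mul_le_mul_of_nonneg_left ?_ (by split_ifs <;> norm_num)
    exact sval_lattice _ _ _ _
  have h2 : ∑ x ∈ U, sval (η x) + ∑ x ∈ U, sval (ζ x)
      = ∑ x ∈ U, sval ((η ⊓ ζ) x) + ∑ x ∈ U, sval ((η ⊔ ζ) x) := by
    simp only [← Finset.sum_add_distrib]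
    exact Finset.sum_congr rfl fun x _ => sval_lattice' _ _
  nlinarith [mul_le_mul_of_nonneg_left h1 hβ, congrArg (fun t => h * t) h2]

open scoped FinsetFamily in
/-- Monotonicity in the boundary condition. -/
lemma ev_mono_bd (hβ : 0 ≤ β) (hf : Monotone f) (hf0 : ∀ η, 0 ≤ f η) (hσ : σ ≤ σ') :
    ev β h U f σ ≤ ev β h U f σ' := by
  classical
  unfold ev
  rw [div_le_div_iff₀ (pf_pos _ _ _ _) (pf_pos _ _ _ _)]
  have h4 := four_functions_theorem (f₁ := fun η => gw β h U η * f η) (f₂ := fun η => gw β h U η)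
    (f₃ := fun η => gw β h U η) (f₄ := fun η => gw β h U η * f η)
    (fun η => mul_nonneg (gw_pos _ _ _ _).le (hf0 η)) (fun η => (gw_pos _ _ _ _).le)
    (fun η => (gw_pos _ _ _ _).le) (fun η => mul_nonneg (gw_pos _ _ _ _).le (hf0 η))
    (fun a b => by
      have h1 := gw_logsupermodular (h := h) hβ U a b
      have h2 : f a ≤ f (a ⊔ b) := hf le_sup_left
      have h3 := mul_le_mul h1 h2 (hf0 a) (mul_nonneg (gw_pos β h U _).le (gw_pos β h U _).le)
      show gw β h U a * f a * gw β h U b ≤ gw β h U (a ⊓ b) * (gw β h U (a ⊔ b) * f (a ⊔ b))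
      linarith)
    (agr U σ) (agr U σ')
  refine h4.trans ?_
  rw [mul_comm]
  refine mul_le_mul ?_ ?_ (Finset.sum_nonneg fun _ _ => (gw_pos _ _ _ _).le)
    (Finset.sum_nonneg fun _ _ => mul_nonneg (gw_pos _ _ _ _).le (hf0 _))
  · refine Finset.sum_le_sum_of_subset_of_nonneg ?_
      (fun _ _ _ => mul_nonneg (gw_pos _ _ _ _).le (hf0 _))
    intro c hc
    obtain ⟨a, ha, b, hb, rfl⟩ := Finset.mem_sups.1 hc
    refine mem_agr.2 fun x hx => ?_
    simp only [Pi.sup_apply, mem_agr.1 ha x hx, mem_agr.1 hb x hx]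
    exact sup_eq_right.2 (hσ x)
  · refine Finset.sum_le_sum_of_subset_of_nonneg ?_ (fun _ _ _ => (gw_pos _ _ _ _).le)
    intro c hc
    obtain ⟨a, ha, b, hb, rfl⟩ := Finset.mem_infs.1 hc
    refine mem_agr.2 fun x hx => ?_
    simp only [Pi.inf_apply, mem_agr.1 ha x hx, mem_agr.1 hb x hx]
    exact inf_eq_left.2 (hσ x)

/-- Locality. -/
lemma ev_local (hf : ∀ η η' : Cfg2, (∀ x ∈ U, η x = η' x) → f η = f η')
    (hσ : ∀ x ∉ U, ∀ y ∈ nbrs x, y ∈ U → σ x = σ' x) : ev β h U f σ = ev β h U f σ' := by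
  have hfill : ∀ τ : ↥U → Bool, gw β h U (fill U σ τ) = gw β h U (fill U σ' τ) := by
    intro τ
    unfold gw engy
    have hin : ∀ x ∈ U, fill U σ τ x = fill U σ' τ x := fun x hx => by simp [fill, hx]
    congr 2
    · congr 1
      refine Finset.sum_congr rfl fun x hx => Finset.sum_congr rfl fun y hy => ?_
      rw [hin x hx]
      by_cases hyU : y ∈ U
      · rw [hin y hyU]
      · have : fill U σ τ y = fill U σ' τ y := by
          simp only [fill, hyU, dite_false]
          exact hσ y hyU x (mem_nbrs_comm.1 hy) hx
        rw [this]
    · congr 1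
      exact Finset.sum_congr rfl fun x hx => by rw [hin x hx]
  unfold ev pf
  simp only [sum_agr, hfill]
  congr 1
  refine Finset.sum_congr rfl fun τ _ => ?_
  rw [hf (fill U σ τ) (fill U σ' τ) fun x hx => by simp [fill, hx]]

end

/-- Indicator that the spin at `x` is `+1`. -/
def ind (x : ℤ × ℤ) (η : Cfg2) : ℝ := if η x then 1 else 0

lemma ind_nonneg (x : ℤ × ℤ) (η : Cfg2) : 0 ≤ ind x η := by unfold ind; split_ifs <;> norm_num
lemma ind_le_one (x : ℤ × ℤ) (η : Cfg2) : ind x η ≤ 1 := by unfold ind; split_ifs <;> norm_num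
lemma ind_mono (x : ℤ × ℤ) : Monotone (ind x) := by
  intro η ζ hle
  unfold ind
  have h : η x ≤ ζ x := hle x
  by_cases h1 : η x = true
  · rw [if_pos h1, if_pos (Bool.le_iff_imp.1 h h1)]
  · rw [if_neg h1]
    split_ifs <;> norm_num

end

noncomputable section

/-- Finite-energy constant. -/
def eps1 (β h : ℝ) : ℝ := Real.exp (-(2 * (4 * β + |h|))) / 2

lemma eps1_pos (β h : ℝ) : 0 < eps1 β h := by unfold eps1; positivity

section
variable {β h : ℝ} {U V : Finset (ℤ × ℤ)} {f g : Cfg2 → ℝ} {σ σ' : Cfg2}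

lemma gw_singleton_bounds (hβ : 0 ≤ β) (x : ℤ × ℤ) (η : Cfg2) :
    Real.exp (-(4 * β + |h|)) ≤ gw β h {x} η ∧ gw β h {x} η ≤ Real.exp (4 * β + |h|) := by
  have h1 : |engy {x} η| ≤ 4 := by
    unfold engy
    rw [Finset.sum_singleton]
    refine (Finset.abs_sum_le_sum_abs _ _).trans ?_
    calc _ ≤ ∑ y ∈ nbrs x, (1 : ℝ) := by
          refine Finset.sum_le_sum fun y _ => ?_
          rw [abs_mul, abs_mul, abs_sval, abs_sval]
          split_ifs <;> norm_num
      _ ≤ 4 := by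
          rw [Finset.sum_const, nsmul_eq_mul, mul_one]
          exact_mod_cast card_nbrs_le x
  have h2 : |β * engy {x} η - h * ∑ y ∈ {x}, sval (η y)| ≤ 4 * β + |h| := by
    rw [Finset.sum_singleton]
    refine (abs_sub _ _).trans ?_
    rw [abs_mul, abs_mul, abs_sval, abs_of_nonneg hβ]
    nlinarith
  rw [abs_le] at h2
  exact ⟨Real.exp_le_exp.2 h2.1, Real.exp_le_exp.2 h2.2⟩

lemma eps1_le_ev_singleton (hβ : 0 ≤ β) (x : ℤ × ℤ) (hg : ∀ η, 0 ≤ g η) {η₀ : Cfg2}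
    (h₀ : η₀ ∈ agr {x} σ) (hg₀ : g η₀ = 1) : eps1 β h ≤ ev β h {x} g σ := by
  classical
  unfold ev
  rw [le_div_iff₀ (pf_pos _ _ _ _)]
  have h1 : pf β h {x} σ ≤ 2 * Real.exp (4 * β + |h|) := by
    unfold pf
    rw [sum_agr]
    calc _ ≤ ∑ τ : ↥({x} : Finset (ℤ × ℤ)) → Bool, Real.exp (4 * β + |h|) :=
          Finset.sum_le_sum fun τ _ => (gw_singleton_bounds hβ x _).2
      _ = _ := by simp
  have h2 : Real.exp (-(4 * β + |h|)) ≤ ∑ η ∈ agr {x} σ, gw β h {x} η * g η := by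
    refine (gw_singleton_bounds hβ x η₀).1.trans ?_
    have := Finset.single_le_sum (f := fun η => gw β h {x} η * g η)
      (fun η _ => mul_nonneg (gw_pos _ _ _ _).le (hg η)) h₀
    simpa [hg₀] using this
  calc eps1 β h * pf β h {x} σ ≤ eps1 β h * (2 * Real.exp (4 * β + |h|)) :=
        mul_le_mul_of_nonneg_left h1 (eps1_pos _ _).le
    _ = Real.exp (-(4 * β + |h|)) := by
        unfold eps1
        rw [show ∀ a b : ℝ, a / 2 * (2 * b) = a * b by intros; ring, ← Real.exp_add]
        congr 1; ring
    _ ≤ _ := h2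

lemma eps1_le_ev_ind (hβ : 0 ≤ β) {x : ℤ × ℤ} (hx : x ∈ U) : eps1 β h ≤ ev β h U (ind x) σ := by
  classical
  rw [← ev_tower (V := {x}) (by simpa using hx)]
  refine const_le_ev fun η _ => ?_
  refine eps1_le_ev_singleton hβ x (ind_nonneg x) (η₀ := Function.update η x true) ?_ ?_
  · exact mem_agr.2 fun y hy => Function.update_of_ne (by simpa using hy) _ _
  · simp [ind]

lemma ev_ind_le (hβ : 0 ≤ β) {x : ℤ × ℤ} (hx : x ∈ U) :
    ev β h U (ind x) σ ≤ 1 - eps1 β h := by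
  classical
  have : eps1 β h ≤ ev β h U (fun η => 1 - ind x η) σ := by
    rw [← ev_tower (V := {x}) (by simpa using hx)]
    refine const_le_ev fun η _ => ?_
    refine eps1_le_ev_singleton hβ x (fun η => sub_nonneg.2 (ind_le_one x η))
      (η₀ := Function.update η x false) ?_ ?_
    · exact mem_agr.2 fun y hy => Function.update_of_ne (by simpa using hy) _ _
    · simp [ind]
  rw [ev_sub, ev_const] at this
  linarith

lemma eps1_le_half (hβ : 0 ≤ β) : 2 * eps1 β h ≤ 1 := by
  have := (eps1_le_ev_ind (U := {(0, 0)}) (x := (0, 0)) (h := h) (σ := fun _ => true) hβ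
    (by simp)).trans (ev_ind_le hβ (by simp))
  linarith

/-- Invariance under automorphisms of the square lattice. -/
lemma ev_map (e : (ℤ × ℤ) ≃ (ℤ × ℤ)) (he : ∀ x y, y ∈ nbrs x ↔ e y ∈ nbrs (e x)) :
    ev β h (U.map e.toEmbedding) f σ = ev β h U (fun η => f (η ∘ e.symm)) (σ ∘ e) := by
  classical
  have hn : ∀ x, nbrs (e x) = (nbrs x).map e.toEmbedding := by
    intro x; ext y
    rw [Finset.mem_map_equiv, he x (e.symm y), e.apply_symm_apply]
  have hgw : ∀ η : Cfg2, gw β h (U.map e.toEmbedding) η = gw β h U (η ∘ e) := by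
    intro η
    unfold gw engy
    rw [Finset.sum_map, Finset.sum_map]
    congr 3
    refine Finset.sum_congr rfl fun x _ => ?_
    rw [Equiv.coe_toEmbedding, hn, Finset.sum_map]
    refine Finset.sum_congr rfl fun y _ => ?_
    simp
  have hs : ∀ g : Cfg2 → ℝ, ∑ η ∈ agr (U.map e.toEmbedding) σ, g η
      = ∑ η ∈ agr U (σ ∘ e), g (η ∘ e.symm) := by
    intro g
    refine Finset.sum_bij' (fun η _ => η ∘ e) (fun η _ => η ∘ e.symm) ?_ ?_ ?_ ?_ ?_
    · intro η hη
      refine mem_agr.2 fun x hx => ?_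
      exact mem_agr.1 hη (e x) (by simpa using hx)
    · intro η hη
      refine mem_agr.2 fun x hx => ?_
      have := mem_agr.1 hη (e.symm x) (by simpa [Finset.mem_map_equiv] using hx)
      simpa using this
    · intro η _; funext x; simp
    · intro η _; funext x; simp
    · intro η _; congr 1; funext x; simp
  unfold ev pf
  rw [hs, hs]
  simp only [hgw, Function.comp_assoc, Equiv.symm_comp_self, Function.comp_id]

end

open Classical in
/-- The configuration equal to `ξ` on `F` and `+` elsewhere. -/
def topOn (F : Set (ℤ × ℤ)) (ξ : Cfg2) : Cfg2 := fun x => if x ∈ F then ξ x else true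

open Classical in
/-- The configuration equal to `ξ` on `F` and `-` elsewhere. -/
def botOn (F : Set (ℤ × ℤ)) (ξ : Cfg2) : Cfg2 := fun x => if x ∈ F then ξ x else false

/-- Effect of the boundary condition outside of `F` on the expectation of `f` in `U`. -/
def dd (β h : ℝ) (F : Set (ℤ × ℤ)) (U : Finset (ℤ × ℤ)) (f : Cfg2 → ℝ) (ξ : Cfg2) : ℝ :=
  ev β h U f (topOn F ξ) - ev β h U f (botOn F ξ)

section
variable {β h : ℝ} {F : Set (ℤ × ℤ)} {U V : Finset (ℤ × ℤ)} {f g : Cfg2 → ℝ} {ξ ξ' η η' : Cfg2}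

lemma le_topOn (h : ∀ x ∈ F, η x = ξ x) : η ≤ topOn F ξ := by
  intro x
  by_cases hx : x ∈ F
  · simp [topOn, hx, h x hx]
  · simp only [topOn, hx, if_false]; exact Bool.le_true _

lemma botOn_le (h : ∀ x ∈ F, η x = ξ x) : botOn F ξ ≤ η := by
  intro x
  by_cases hx : x ∈ F
  · simp [botOn, hx, h x hx]
  · simp only [botOn, hx, if_false]; exact Bool.false_le _

lemma topOn_apply {x : ℤ × ℤ} (hx : x ∈ F) : topOn F ξ x = ξ x := by simp [topOn, hx]
lemma botOn_apply {x : ℤ × ℤ} (hx : x ∈ F) : botOn F ξ x = ξ x := by simp [botOn, hx]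

lemma topOn_empty : topOn ∅ ξ = fun _ => true := by funext x; simp [topOn]
lemma botOn_empty : botOn ∅ ξ = fun _ => false := by funext x; simp [botOn]

lemma ev_le_topOn (hβ : 0 ≤ β) (hf : Monotone f) (hf0 : ∀ η, 0 ≤ f η) (hVU : V ⊆ U)
    (hUF : ∀ x ∈ U, x ∉ F) (hη : ∀ x ∈ F, η x = ξ x) :
    ev β h U f η ≤ ev β h V f (topOn F ξ) := by
  rw [← ev_tower hVU]
  refine ev_le_const fun ζ hζ => ev_mono_bd hβ hf hf0 (le_topOn fun x hx => ?_)
  rw [mem_agr.1 hζ x (fun hxU => hUF x hxU hx), hη x hx]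

lemma botOn_le_ev (hβ : 0 ≤ β) (hf : Monotone f) (hf0 : ∀ η, 0 ≤ f η) (hVU : V ⊆ U)
    (hUF : ∀ x ∈ U, x ∉ F) (hη : ∀ x ∈ F, η x = ξ x) :
    ev β h V f (botOn F ξ) ≤ ev β h U f η := by
  rw [← ev_tower (U := U) hVU]
  refine const_le_ev fun ζ hζ => ev_mono_bd hβ hf hf0 (botOn_le fun x hx => ?_)
  rw [mem_agr.1 hζ x (fun hxU => hUF x hxU hx), hη x hx]

lemma ev_sub_le_dd (hβ : 0 ≤ β) (hf : Monotone f) (hf0 : ∀ η, 0 ≤ f η) (hVU : V ⊆ U)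
    (hUF : ∀ x ∈ U, x ∉ F) (hη : ∀ x ∈ F, η x = ξ x) (hη' : ∀ x ∈ F, η' x = ξ x) :
    ev β h U f η - ev β h U f η' ≤ dd β h F V f ξ :=
  sub_le_sub (ev_le_topOn hβ hf hf0 hVU hUF hη) (botOn_le_ev hβ hf hf0 hVU hUF hη')

lemma dd_anti (hβ : 0 ≤ β) (hf : Monotone f) (hf0 : ∀ η, 0 ≤ f η) (hVU : V ⊆ U)
    (hUF : ∀ x ∈ U, x ∉ F) : dd β h F U f ξ ≤ dd β h F V f ξ :=
  ev_sub_le_dd hβ hf hf0 hVU hUF (fun _ hx => topOn_apply hx) (fun _ hx => botOn_apply hx)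

lemma dd_le_empty (hβ : 0 ≤ β) (hf : Monotone f) (hf0 : ∀ η, 0 ≤ f η) (hVU : V ⊆ U) :
    dd β h F U f ξ ≤ dd β h ∅ V f ξ' :=
  ev_sub_le_dd hβ hf hf0 hVU (fun _ _ h => h) (fun _ hx => hx.elim) (fun _ hx => hx.elim)

lemma dd_nonneg (hβ : 0 ≤ β) (hf : Monotone f) (hf0 : ∀ η, 0 ≤ f η) : 0 ≤ dd β h F U f ξ :=
  sub_nonneg.2 (ev_mono_bd hβ hf hf0 (le_topOn fun _ hx => botOn_apply hx))

lemma dd_le_one (hf0 : ∀ η, 0 ≤ f η) (hf1 : ∀ η, f η ≤ 1) : dd β h F U f ξ ≤ 1 := by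
  have h1 : ev β h U f (topOn F ξ) ≤ 1 := ev_le_const fun η _ => hf1 η
  have h2 : 0 ≤ ev β h U f (botOn F ξ) := ev_nonneg fun η _ => hf0 η
  unfold dd; linarith

end

/-- Influence of the boundary of the box of radius `r` on the spin at its centre. -/
def Dr (β h : ℝ) (r : ℕ) : ℝ := dd β h ∅ (box r) (ind (0, 0)) (fun _ => true)

/-- The box of radius `r` centred at `x`. -/
def boxAt (x : ℤ × ℤ) (r : ℕ) : Finset (ℤ × ℤ) := (box r).map (Equiv.addRight x).toEmbedding

lemma mem_box {n : ℕ} {x : ℤ × ℤ} : x ∈ box n ↔ |x.1| ≤ n ∧ |x.2| ≤ n := by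
  simp [box, abs_le]

lemma mem_boxAt {x y : ℤ × ℤ} {r : ℕ} : y ∈ boxAt x r ↔ |y.1 - x.1| ≤ r ∧ |y.2 - x.2| ≤ r := by
  unfold boxAt
  rw [Finset.mem_map_equiv, mem_box]
  simp [sub_eq_add_neg]

lemma nbrs_add (v x y : ℤ × ℤ) : y ∈ nbrs x ↔ y + v ∈ nbrs (x + v) := by
  rcases x with ⟨a, b⟩
  rcases y with ⟨c, d⟩
  rcases v with ⟨u, w⟩
  simp only [nbrs, Finset.mem_insert, Finset.mem_singleton, Prod.mk.injEq, Prod.mk_add_mk]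
  omega

section
variable {β h : ℝ} {F : Set (ℤ × ℤ)} {U V : Finset (ℤ × ℤ)} {f : Cfg2 → ℝ} {ξ : Cfg2}

lemma ev_add_map (v : ℤ × ℤ) (σ : Cfg2) :
    ev β h (U.map (Equiv.addRight v).toEmbedding) f σ
      = ev β h U (fun η => f (fun x => η (x - v))) (fun x => σ (x + v)) := by
  have he : ∀ x y, y ∈ nbrs x ↔ Equiv.addRight v y ∈ nbrs (Equiv.addRight v x) := by
    intro x y
    simp only [Equiv.coe_addRight]
    exact nbrs_add v x y
  rw [ev_map _ he]
  rfl

lemma dd_boxAt (x : ℤ × ℤ) (r : ℕ) : dd β h ∅ (boxAt x r) (ind x) ξ = Dr β h r := by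
  unfold Dr dd boxAt
  rw [ev_add_map, ev_add_map]
  have : (fun η : Cfg2 => ind x (fun y => η (y - x))) = ind (0, 0) := by
    funext η
    simp only [ind, sub_self]
    rfl
  rw [this]
  simp only [topOn_empty, botOn_empty]

lemma dd_ind_le_Dr (hβ : 0 ≤ β) {x : ℤ × ℤ} {r : ℕ} (hr : boxAt x r ⊆ U) :
    dd β h F U (ind x) ξ ≤ Dr β h r := by
  rw [← dd_boxAt x r (ξ := ξ)]
  exact dd_le_empty hβ (ind_mono x) (ind_nonneg x) hr

lemma box_mono {m n : ℕ} (hmn : m ≤ n) : box m ⊆ box n := by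
  intro x hx
  rw [mem_box] at *
  have : (m : ℤ) ≤ n := by exact_mod_cast hmn
  exact ⟨hx.1.trans this, hx.2.trans this⟩

lemma Dr_antitone (hβ : 0 ≤ β) : Antitone (Dr β h) := fun _ _ hmn =>
  dd_anti hβ (ind_mono _) (ind_nonneg _) (box_mono hmn) (fun _ _ h => h)

lemma Dr_nonneg (hβ : 0 ≤ β) (r : ℕ) : 0 ≤ Dr β h r := dd_nonneg hβ (ind_mono _) (ind_nonneg _)

open Classical in
/-- Indicator that all spins in `A` are `+1`. -/
def indA (A : Finset (ℤ × ℤ)) (η : Cfg2) : ℝ := if ∀ x ∈ A, η x = true then 1 else 0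

lemma indA_nonneg (A : Finset (ℤ × ℤ)) (η : Cfg2) : 0 ≤ indA A η := by
  unfold indA; split_ifs <;> norm_num
lemma indA_le_one (A : Finset (ℤ × ℤ)) (η : Cfg2) : indA A η ≤ 1 := by
  unfold indA; split_ifs <;> norm_num
lemma indA_mono (A : Finset (ℤ × ℤ)) : Monotone (indA A) := by
  intro η ζ hle
  unfold indA
  by_cases h1 : ∀ x ∈ A, η x = true
  · rw [if_pos h1, if_pos fun x hx => Bool.le_iff_imp.1 (hle x) (h1 x hx)]
  · rw [if_neg h1]; split_ifs <;> norm_num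

lemma indA_singleton (x : ℤ × ℤ) : indA {x} = ind x := by
  funext η; simp [indA, ind]

lemma dd_indA_le (hβ : 0 ≤ β) (A : Finset (ℤ × ℤ)) :
    dd β h F U (indA A) ξ ≤ ∑ x ∈ A, dd β h F U (ind x) ξ := by
  classical
  rcases A.eq_empty_or_nonempty with rfl | ⟨a, ha⟩
  · have h1 : ∀ σ : Cfg2, ev β h U (indA ∅) σ = 1 := fun σ => ev_of_const fun η _ => by simp [indA]
    simp [dd, h1]
  · set f : Cfg2 → ℝ := fun η => ∑ x ∈ A, ind x η - indA A η with hf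
    have hm : Monotone f := by
      intro η ζ hle
      simp only [hf]
      have hs : ∀ x ∈ A, ind x η ≤ ind x ζ := fun x _ => ind_mono x hle
      have h0 := Finset.sum_le_sum hs
      by_cases h1 : ∀ x ∈ A, η x = true
      · have h2 : ∀ x ∈ A, ζ x = true := fun x hx => Bool.le_iff_imp.1 (hle x) (h1 x hx)
        simp only [indA, if_pos h1, if_pos h2]
        linarith
      · by_cases h2 : ∀ x ∈ A, ζ x = true
        · simp only [indA, if_neg h1, if_pos h2]
          push Not at h1
          obtain ⟨x, hx, hx1⟩ := h1
          have hx1' : η x = false := by simpa using hx1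
          have h3 := Finset.sum_le_sum (s := A.erase x) fun y hy =>
            hs y (Finset.mem_of_mem_erase hy)
          rw [← Finset.add_sum_erase A _ hx, ← Finset.add_sum_erase A _ hx]
          have e1 : ind x η = 0 := by simp [ind, hx1']
          have e2 : ind x ζ = 1 := by simp [ind, h2 x hx]
          rw [e1, e2]; linarith
        · simp only [indA, if_neg h1, if_neg h2]; linarith
    have hp : ∀ η, 0 ≤ f η := by
      intro η
      simp only [hf]
      by_cases h1 : ∀ x ∈ A, η x = true
      · have h3 := Finset.single_le_sum (f := fun x => ind x η) (fun x _ => ind_nonneg x η) ha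
        have e1 : ind a η = 1 := by simp [ind, h1 a ha]
        simp only [indA, if_pos h1]
        simp only [e1] at h3
        linarith
      · simp only [indA, if_neg h1, sub_zero]
        exact Finset.sum_nonneg fun x _ => ind_nonneg x η
    have h1 : 0 ≤ dd β h F U f ξ := dd_nonneg hβ hm hp
    unfold dd at h1 ⊢
    simp only [hf, ev_sub, ev_sum] at h1
    rw [Finset.sum_sub_distrib]
    linarith

end

lemma isingFV_apply (β h : ℝ) (U : Finset (ℤ × ℤ)) (σ : Cfg2) (B : Set Cfg2) :
    isingFV β h U σ B = ENNReal.ofReal (ev β h U (B.indicator 1) σ) := by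
  classical
  have hw : ∀ τ : ↥U → Bool, isingWeight β h U σ (fill U σ τ) = gw β h U (fill U σ τ) :=
    fun τ => isingWeight_eq_gw β h U σ _ (mem_agr.2 fun x hx => by simp [fill, hx])
  have hsum : (∑ τ : ↥U → Bool, ENNReal.ofReal (gw β h U (fill U σ τ)))
      = ENNReal.ofReal (pf β h U σ) := by
    rw [pf, sum_agr, ENNReal.ofReal_sum_of_nonneg fun τ _ => (gw_pos _ _ _ _).le]
  unfold isingFV ev
  simp only [hw, hsum]
  rw [Measure.smul_apply, Measure.finsetSum_apply, sum_agr, ENNReal.ofReal_div_of_pos (pf_pos _ _ _ _),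
    smul_eq_mul, mul_comm, ENNReal.div_eq_inv_mul, mul_comm]
  congr 1
  rw [ENNReal.ofReal_sum_of_nonneg]
  · refine Finset.sum_congr rfl fun τ _ => ?_
    rw [Measure.smul_apply, Measure.dirac_apply, smul_eq_mul, ENNReal.ofReal_mul (gw_pos _ _ _ _).le]
    congr 1
    by_cases hB : fill U σ τ ∈ B <;> simp [hB]
  · intro τ _
    refine mul_nonneg (gw_pos _ _ _ _).le (Set.indicator_nonneg (fun _ _ => zero_le_one) _)

end

noncomputable section

section
variable {β h : ℝ} {F : Set (ℤ × ℤ)} {U V T : Finset (ℤ × ℤ)} {f g : Cfg2 → ℝ} {ξ ξ' : Cfg2}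

lemma ev_split (t : ℤ × ℤ) (U : Finset (ℤ × ℤ)) (g : Cfg2 → ℝ) (ξ : Cfg2) :
    ev β h (insert t U) g ξ = ev β h (insert t U) (ind t) ξ * ev β h U g (Function.update ξ t true)
      + (1 - ev β h (insert t U) (ind t) ξ) * ev β h U g (Function.update ξ t false) := by
  classical
  rw [← ev_tower (Finset.subset_insert t U)]
  have h1 : ∀ η ∈ agr (insert t U) ξ, ev β h U g η
      = (ev β h U g (Function.update ξ t true) - ev β h U g (Function.update ξ t false)) * ind t η
        + ev β h U g (Function.update ξ t false) := by
    intro η hη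
    have h2 : ev β h U g η = ev β h U g (Function.update ξ t (η t)) := by
      refine ev_congr_bd fun x hx => ?_
      by_cases hxt : x = t
      · subst hxt; simp
      · rw [Function.update_of_ne hxt]
        exact mem_agr.1 hη x (by simp [hxt, hx])
    rw [h2]
    cases ht : η t <;> simp [ind, ht]
  rw [ev_congr h1, ev_add, ev_mul_left, ev_const]
  ring

lemma update_mono_true {t : ℤ × ℤ} {b c : Bool} (hbc : b ≤ c) (hξ : ξ' ≤ ξ) :
    Function.update ξ' t b ≤ Function.update ξ t c :=
  update_le_update_iff.2 ⟨hbc, fun x _ => hξ x⟩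

lemma mem_agr_insert_of_update {t : ℤ × ℤ} {b : Bool} {η : Cfg2}
    (hη : η ∈ agr T (Function.update ξ t b)) : η ∈ agr (insert t T) ξ := by
  refine mem_agr.2 fun x hx => ?_
  rw [Finset.mem_insert, not_or] at hx
  rw [mem_agr.1 hη x hx.2, Function.update_of_ne hx.1]

/-- Propagation of a bound for ordered pairs from a smaller to a larger region. -/
lemma ev_sub_le_of_pairs (hβ : 0 ≤ β) {a : ℝ} (T : Finset (ℤ × ℤ)) : ∀ ξ ξ' : Cfg2, ξ' ≤ ξ →
    (∀ η ∈ agr T ξ, ∀ η' ∈ agr T ξ', η' ≤ η → ev β h V g η - ev β h V g η' ≤ a) →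
    ev β h (T ∪ V) g ξ - ev β h (T ∪ V) g ξ' ≤ a := by
  classical
  induction T using Finset.induction_on with
  | empty =>
    intro ξ ξ' hle H
    simpa using H ξ (self_mem_agr _ _) ξ' (self_mem_agr _ _) hle
  | insert t T _ ih =>
    intro ξ ξ' hle H
    rw [Finset.insert_union, ev_split t _ g ξ, ev_split t _ g ξ']
    set p := ev β h (insert t (T ∪ V)) (ind t) ξ
    set p' := ev β h (insert t (T ∪ V)) (ind t) ξ'
    have hp : p' ≤ p := ev_mono_bd hβ (ind_mono t) (ind_nonneg t) hle
    have hp1 : p ≤ 1 := ev_le_const fun η _ => ind_le_one t η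
    have hp0 : 0 ≤ p' := ev_nonneg fun η _ => ind_nonneg t η
    have key : ∀ b c : Bool, b ≤ c → ev β h (T ∪ V) g (Function.update ξ t c)
        - ev β h (T ∪ V) g (Function.update ξ' t b) ≤ a := fun b c hbc =>
      ih _ _ (update_mono_true hbc hle) fun η hη η' hη' hle' =>
        H η (mem_agr_insert_of_update hη) η' (mem_agr_insert_of_update hη') hle'
    have k1 := key true true le_rfl
    have k2 := key false true (Bool.false_le _)
    have k3 := key false false le_rfl
    nlinarith [mul_le_mul_of_nonneg_left k1 hp0, mul_le_mul_of_nonneg_left k2 (sub_nonneg.2 hp),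
      mul_le_mul_of_nonneg_left k3 (sub_nonneg.2 hp1)]

/-- Strict contraction when few sites have to agree. -/
lemma ev_sub_le_of_pairs_agree (hβ : 0 ≤ β) {a : ℝ} (ha : 0 ≤ a) (T : Finset (ℤ × ℤ)) :
    ∀ ξ ξ' : Cfg2, ξ' ≤ ξ →
    (∀ η ∈ agr T ξ, ∀ η' ∈ agr T ξ', η' ≤ η → ev β h V g η - ev β h V g η' ≤ a) →
    (∀ η ∈ agr T ξ, ∀ η' ∈ agr T ξ', η' ≤ η → (∀ x ∈ T, η x = η' x) →
      ev β h V g η - ev β h V g η' ≤ 0) →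
    ev β h (T ∪ V) g ξ - ev β h (T ∪ V) g ξ' ≤ (1 - (2 * eps1 β h) ^ T.card) * a := by
  classical
  induction T using Finset.induction_on with
  | empty =>
    intro ξ ξ' hle _ H
    simpa using H ξ (self_mem_agr _ _) ξ' (self_mem_agr _ _) hle (by simp)
  | insert t T ht ih =>
    intro ξ ξ' hle H H0
    rw [Finset.insert_union, ev_split t _ g ξ, ev_split t _ g ξ', Finset.card_insert_of_notMem ht]
    set p := ev β h (insert t (T ∪ V)) (ind t) ξ with hpd
    set p' := ev β h (insert t (T ∪ V)) (ind t) ξ' with hpd'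
    have hp : p' ≤ p := ev_mono_bd hβ (ind_mono t) (ind_nonneg t) hle
    have hp1 : p ≤ 1 - eps1 β h := ev_ind_le hβ (Finset.mem_insert_self _ _)
    have hp0 : eps1 β h ≤ p' := eps1_le_ev_ind hβ (Finset.mem_insert_self _ _)
    have he := eps1_pos β h
    have key : ∀ b : Bool, ev β h (T ∪ V) g (Function.update ξ t b)
        - ev β h (T ∪ V) g (Function.update ξ' t b) ≤ (1 - (2 * eps1 β h) ^ T.card) * a := fun b =>
      ih _ _ (update_mono_true le_rfl hle) (fun η hη η' hη' hle' =>
        H η (mem_agr_insert_of_update hη) η' (mem_agr_insert_of_update hη') hle')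
        (fun η hη η' hη' hle' hag => H0 η (mem_agr_insert_of_update hη) η'
          (mem_agr_insert_of_update hη') hle' fun x hx => by
            rcases Finset.mem_insert.1 hx with rfl | hx
            · rw [mem_agr.1 hη x ht, mem_agr.1 hη' x ht]; simp
            · exact hag x hx)
    have k1 := key true
    have k2 : ev β h (T ∪ V) g (Function.update ξ t true)
        - ev β h (T ∪ V) g (Function.update ξ' t false) ≤ a :=
      ev_sub_le_of_pairs hβ T _ _ (update_mono_true (Bool.false_le _) hle)
        fun η hη η' hη' hle' =>
        H η (mem_agr_insert_of_update hη) η' (mem_agr_insert_of_update hη') hle'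
    have k3 := key false
    have e0 : 0 ≤ (2 * eps1 β h) ^ T.card * a := by positivity
    have m1 := mul_le_mul_of_nonneg_left k1 (he.le.trans hp0)
    have m2 := mul_le_mul_of_nonneg_left k2 (sub_nonneg.2 hp)
    have m3 := mul_le_mul_of_nonneg_left k3 (show 0 ≤ 1 - p by linarith)
    have m4 : 0 ≤ (1 - (p - p') - 2 * eps1 β h) * ((2 * eps1 β h) ^ T.card * a) :=
      mul_nonneg (by linarith) e0
    rw [pow_succ]
    linear_combination m1 + m2 + m3 + m4

open Classical in
/-- The sites of the box of radius `r` outside `F`. -/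
def boxOff (F : Set (ℤ × ℤ)) (r : ℕ) : Finset (ℤ × ℤ) := (box r).filter (fun x => x ∉ F)

lemma mem_boxOff {r : ℕ} {x : ℤ × ℤ} : x ∈ boxOff F r ↔ x ∈ box r ∧ x ∉ F := by simp [boxOff]

lemma boxOff_mono {m n : ℕ} (hmn : m ≤ n) : boxOff F m ⊆ boxOff F n := fun x hx => by
  rw [mem_boxOff] at *
  exact ⟨box_mono hmn hx.1, hx.2⟩

lemma mem_box_succ_of_nbr {r : ℕ} {x y : ℤ × ℤ} (hx : x ∈ box r) (hy : y ∈ nbrs x) :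
    y ∈ box (r + 1) := by
  rcases x with ⟨a, b⟩
  rcases y with ⟨c, d⟩
  simp only [mem_box, nbrs, Finset.mem_insert, Finset.mem_singleton, Prod.mk.injEq, abs_le] at *
  push_cast
  omega

lemma ind_sub_of_le {x : ℤ × ℤ} (hle : ξ' ≤ ξ) :
    ind x ξ - ind x ξ' = if ξ x ≠ ξ' x then 1 else 0 := by
  have h := hle x
  cases h1 : ξ x <;> cases h2 : ξ' x <;> simp_all [ind]
  exact (Bool.false_ne_true (Bool.le_iff_imp.1 h rfl)).elim

lemma ev_ind_of_not_mem {x : ℤ × ℤ} (hx : x ∉ U) : ev β h U (ind x) ξ = ind x ξ :=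
  ev_of_const fun η hη => by simp [ind, mem_agr.1 hη x hx]

set_option maxHeartbeats 1000000 in
lemma contraction_induction (hβ : 0 ≤ β) (ξ₀ : Cfg2) (hF0 : (0, 0) ∉ F) (n : ℕ)
    (v : ℕ → ℝ) (κ : ℝ) (M : ℕ) (hκ : 0 ≤ κ) (hv0 : v 0 = 1) (hvn : ∀ j, j ≤ n → 0 ≤ v j)
    (hbad : ∀ j, v j - v (j + 1) ≤ κ * M)
    (hgood : ∀ j, j < n → (1 - (2 * eps1 β h) ^ (4 * M)) * v j ≤ v (j + 1)) :
    ∀ j, j ≤ n → ∀ ξ ξ' : Cfg2, ξ' ≤ ξ → (∀ x ∈ F, ξ x = ξ₀ x) → (∀ x ∈ F, ξ' x = ξ₀ x) →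
    ev β h (boxOff F (n + j)) (ind (0, 0)) ξ - ev β h (boxOff F (n + j)) (ind (0, 0)) ξ' ≤
      dd β h F (boxOff F n) (ind (0, 0)) ξ₀ * (v j + κ * ∑ x ∈ box (n + j + 1) \ box n,
        (ev β h (boxOff F (n + j)) (ind x) ξ - ev β h (boxOff F (n + j)) (ind x) ξ')) := by
  classical
  set Δ := dd β h F (boxOff F n) (ind (0, 0)) ξ₀ with hΔ
  have hΔ0 : 0 ≤ Δ := dd_nonneg hβ (ind_mono _) (ind_nonneg _)
  have hnotF : ∀ r, ∀ x ∈ boxOff F r, x ∉ F := fun r x hx => (mem_boxOff.1 hx).2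
  intro j
  induction j with
  | zero =>
    intro _ ξ ξ' hle h1 h2
    have hG := ev_sub_le_dd (f := ind (0, 0)) (h := h) hβ (ind_mono _) (ind_nonneg _)
      (Finset.Subset.refl (boxOff F n)) (hnotF n) h1 h2
    have hK : 0 ≤ ∑ x ∈ box (n + 0 + 1) \ box n,
        (ev β h (boxOff F (n + 0)) (ind x) ξ - ev β h (boxOff F (n + 0)) (ind x) ξ') :=
      Finset.sum_nonneg fun x _ => sub_nonneg.2 (ev_mono_bd hβ (ind_mono x) (ind_nonneg x) hle)
    rw [hv0]
    refine hG.trans ?_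
    rw [← hΔ]
    nlinarith [mul_nonneg hΔ0 (mul_nonneg hκ hK)]
  | succ j ih =>
    clear_value Δ
    intro hj ξ ξ' hle h1 h2
    have hjn : j ≤ n := by omega
    rw [show n + (j + 1) = n + j + 1 by ring]
    set r := n + j with hr
    set Q : Cfg2 → ℝ := fun η => ∑ x ∈ box (r + 1) \ box n, ind x η with hQ
    set g : Cfg2 → ℝ := fun η => ind (0, 0) η - Δ * κ * Q η with hg
    have hev : ∀ U η, ev β h U g η = ev β h U (ind (0, 0)) η - Δ * κ * ∑ x ∈ box (r + 1) \ box n,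
        ev β h U (ind x) η := by
      intro U η
      rw [hg, ev_sub, ev_mul_left, hQ, ev_sum]
    have hpair : ∀ ζ ζ' : Cfg2, ζ' ≤ ζ → (∀ x ∈ F, ζ x = ξ₀ x) → (∀ x ∈ F, ζ' x = ξ₀ x) →
        ev β h (boxOff F r) g ζ - ev β h (boxOff F r) g ζ' ≤ Δ * v j := by
      intro ζ ζ' hle' hz hz'
      have := ih hjn ζ ζ' hle' hz hz'
      rw [hev, hev]
      rw [Finset.sum_sub_distrib] at this
      linarith
    -- the outer shell
    set A := (box (r + 2) \ box (r + 1)).filter (fun x => ξ x ≠ ξ' x) with hA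
    have hshell : ∑ x ∈ box (r + 2) \ box (r + 1),
        (ev β h (boxOff F (r + 1)) (ind x) ξ - ev β h (boxOff F (r + 1)) (ind x) ξ')
        = A.card := by
      rw [hA, Finset.card_filter]
      push_cast
      refine Finset.sum_congr rfl fun x hx => ?_
      have hx' : x ∉ boxOff F (r + 1) := fun h => (Finset.mem_sdiff.1 hx).2 (mem_boxOff.1 h).1
      rw [ev_ind_of_not_mem hx', ev_ind_of_not_mem hx', ind_sub_of_le hle]
    have hsplit : ∑ x ∈ box (r + 1 + 1) \ box n,
        (ev β h (boxOff F (r + 1)) (ind x) ξ - ev β h (boxOff F (r + 1)) (ind x) ξ')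
        = A.card + (∑ x ∈ box (r + 1) \ box n, ev β h (boxOff F (r + 1)) (ind x) ξ
          - ∑ x ∈ box (r + 1) \ box n, ev β h (boxOff F (r + 1)) (ind x) ξ') := by
      rw [← hshell, ← Finset.sum_sub_distrib, ← Finset.sum_union]
      · refine Finset.sum_congr ?_ fun _ _ => rfl
        rw [show r + 1 + 1 = r + 2 by ring]
        ext x
        have hm1 : x ∈ box n → x ∈ box (r + 1) := fun h => box_mono (by omega) h
        have hm2 : x ∈ box (r + 1) → x ∈ box (r + 2) := fun h => box_mono (by omega) h
        simp only [Finset.mem_sdiff, Finset.mem_union]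
        tauto
      · rw [Finset.disjoint_left]
        intro x hx hx'
        exact (Finset.mem_sdiff.1 hx).2 (Finset.mem_sdiff.1 hx').1
    rw [hsplit]
    set S := ∑ x ∈ box (r + 1) \ box n, ev β h (boxOff F (r + 1)) (ind x) ξ
    set S' := ∑ x ∈ box (r + 1) \ box n, ev β h (boxOff F (r + 1)) (ind x) ξ'
    have hFT : ∀ {T : Finset (ℤ × ℤ)} {ζ ρ : Cfg2}, T ⊆ boxOff F (r + 1) → ζ ∈ agr T ρ →
        (∀ x ∈ F, ρ x = ξ₀ x) → ∀ x ∈ F, ζ x = ξ₀ x := by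
      intro T ζ ρ hT hζ hρ x hx
      rw [mem_agr.1 hζ x fun hxT => hnotF _ x (hT hxT) hx, hρ x hx]
    by_cases hc : M ≤ A.card
    · have h3 := ev_sub_le_of_pairs (h := h) (V := boxOff F r) (g := g) (a := Δ * v j) hβ
        (boxOff F (r + 1) \ boxOff F r) ξ ξ' hle fun η hη η' hη' hle' =>
          hpair η η' hle' (hFT Finset.sdiff_subset hη h1) (hFT Finset.sdiff_subset hη' h2)
      rw [Finset.sdiff_union_of_subset (boxOff_mono (Nat.le_succ r)), hev, hev] at h3
      have hcM : (M : ℝ) ≤ A.card := by exact_mod_cast hc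
      have := mul_le_mul_of_nonneg_left (hbad j) hΔ0
      have := mul_le_mul_of_nonneg_left hcM (mul_nonneg hΔ0 hκ)
      linarith
    · set T := (boxOff F (r + 1)).filter (fun x => ∃ y ∈ nbrs x, y ∉ box (r + 1) ∧ ξ y ≠ ξ' y)
        with hT
      have hTU : T ⊆ boxOff F (r + 1) := Finset.filter_subset _ _
      have hTcard : T.card ≤ 4 * M := by
        have : T ⊆ A.biUnion nbrs := by
          intro x hx
          obtain ⟨hxU, y, hy, hyb, hyξ⟩ := Finset.mem_filter.1 hx
          refine Finset.mem_biUnion.2 ⟨y, ?_, mem_nbrs_comm.1 hy⟩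
          refine Finset.mem_filter.2 ⟨Finset.mem_sdiff.2 ⟨?_, hyb⟩, hyξ⟩
          exact mem_box_succ_of_nbr (mem_boxOff.1 hxU).1 hy
        calc T.card ≤ (A.biUnion nbrs).card := Finset.card_le_card this
          _ ≤ ∑ a ∈ A, (nbrs a).card := Finset.card_biUnion_le
          _ ≤ ∑ a ∈ A, 4 := Finset.sum_le_sum fun a _ => card_nbrs_le a
          _ = 4 * A.card := by rw [Finset.sum_const, smul_eq_mul, mul_comm]
          _ ≤ 4 * M := by omega
      have hTr : ∀ x ∈ T, x ∉ boxOff F r := by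
        intro x hx hxr
        obtain ⟨_, y, hy, hyb, _⟩ := Finset.mem_filter.1 hx
        exact hyb (mem_box_succ_of_nbr (mem_boxOff.1 hxr).1 hy)
      have hvj := hvn j hjn
      have h3 := ev_sub_le_of_pairs_agree (h := h) (V := boxOff F (r + 1) \ T) (g := g)
        (a := Δ * v j) hβ (mul_nonneg hΔ0 hvj) T ξ ξ' hle ?_ ?_
      · rw [Finset.union_sdiff_of_subset hTU, hev, hev] at h3
        have he := eps1_pos β h
        have h4 : (2 * eps1 β h) ^ (4 * M) ≤ (2 * eps1 β h) ^ T.card :=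
          pow_le_pow_of_le_one (by positivity) (eps1_le_half hβ) hTcard
        have h5 := mul_le_mul_of_nonneg_right h4 (mul_nonneg hΔ0 hvj)
        have h6 := mul_le_mul_of_nonneg_left (hgood j (by omega)) hΔ0
        have h7 : 0 ≤ Δ * κ * A.card := by positivity
        linarith
      · intro η hη η' hη' hle'
        have hsub : boxOff F r ⊆ boxOff F (r + 1) \ T := fun x hx =>
          Finset.mem_sdiff.2 ⟨boxOff_mono (Nat.le_succ r) hx, fun hxT => hTr x hxT hx⟩
        have h4 := ev_sub_le_of_pairs (h := h) (V := boxOff F r) (g := g) (a := Δ * v j) hβ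
          ((boxOff F (r + 1) \ T) \ boxOff F r) η η' hle' fun ζ hζ ζ' hζ' hle'' => by
            have hs : ((boxOff F (r + 1) \ T) \ boxOff F r) ⊆ boxOff F (r + 1) :=
              Finset.sdiff_subset.trans Finset.sdiff_subset
            exact hpair ζ ζ' hle'' (hFT hs hζ (hFT hTU hη h1)) (hFT hs hζ' (hFT hTU hη' h2))
        rwa [Finset.sdiff_union_of_subset hsub] at h4
      · intro η hη η' hη' hle' hag
        have hloc : ev β h (boxOff F (r + 1) \ T) (ind (0, 0)) η
            = ev β h (boxOff F (r + 1) \ T) (ind (0, 0)) η' := by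
          refine ev_local ?_ ?_
          · intro ζ ζ' hz
            have h0 : ((0, 0) : ℤ × ℤ) ∈ boxOff F r := mem_boxOff.2 ⟨by simp [mem_box], hF0⟩
            unfold ind
            rw [hz (0, 0) (Finset.mem_sdiff.2 ⟨boxOff_mono (Nat.le_succ r) h0,
              fun hxT => hTr _ hxT h0⟩)]
          · intro x hx y hy hyV
            by_cases hxT : x ∈ T
            · exact hag x hxT
            · rw [mem_agr.1 hη x hxT, mem_agr.1 hη' x hxT]
              by_contra hne
              have hxF : x ∉ F := fun hxF => hne (by rw [h1 x hxF, h2 x hxF])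
              have hxb : x ∉ box (r + 1) := fun hxb =>
                hx (Finset.mem_sdiff.2 ⟨mem_boxOff.2 ⟨hxb, hxF⟩, hxT⟩)
              exact (Finset.mem_sdiff.1 hyV).2 (Finset.mem_filter.2
                ⟨(Finset.mem_sdiff.1 hyV).1, x, mem_nbrs_comm.1 hy, hxb, hne⟩)
        rw [hev, hev, hloc]
        have : 0 ≤ ∑ x ∈ box (r + 1) \ box n, ev β h (boxOff F (r + 1) \ T) (ind x) η
            - ∑ x ∈ box (r + 1) \ box n, ev β h (boxOff F (r + 1) \ T) (ind x) η' := by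
          rw [← Finset.sum_sub_distrib]
          exact Finset.sum_nonneg fun x _ =>
            sub_nonneg.2 (ev_mono_bd hβ (ind_mono x) (ind_nonneg x) hle')
        have := mul_nonneg (mul_nonneg hΔ0 hκ) this
        linarith

end

end

noncomputable section

lemma card_box (n : ℕ) : ((box n).card : ℝ) = (2 * n + 1) ^ 2 := by
  have : (box n).card = (2 * n + 1) ^ 2 := by
    unfold box
    rw [Finset.card_product, Int.card_Icc]
    have : ((n : ℤ) + 1 - -(n : ℤ)).toNat = 2 * n + 1 := by omega
    rw [this, sq]
  rw [this]; push_cast; ring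

lemma card_shell (n : ℕ) : ((box (n + 1) \ box n).card : ℝ) = 8 * (n + 1) := by
  rw [Finset.cast_card_sdiff (box_mono (Nat.le_succ n)), card_box, card_box]
  push_cast; ring

lemma contraction {β : ℝ} (h : ℝ) (hβ : 0 ≤ β) (C' : ℝ) (hC' : 0 ≤ C') :
    ∃ m₀ : ℕ, ∀ (F : Set (ℤ × ℤ)) (ξ₀ : Cfg2), (0, 0) ∉ F →
    (∀ N : ℕ, 1 ≤ N → ∑ x ∈ box N, dd β h F (boxOff F N) (ind x) ξ₀ ≤ C' * N) → ∀ n : ℕ, m₀ ≤ n →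
    dd β h F (boxOff F (2 * n)) (ind (0, 0)) ξ₀ ≤ dd β h F (boxOff F n) (ind (0, 0)) ξ₀ / 8 := by
  set B : ℝ := C' + 12 with hB
  obtain ⟨M, hM⟩ := exists_nat_ge (30 * B)
  set ε : ℝ := (2 * eps1 β h) ^ (4 * M) with hε
  have hε0 : 0 < ε := by have := eps1_pos β h; positivity
  obtain ⟨m, hm⟩ := exists_nat_ge (15 / ε)
  refine ⟨m + 1, fun F ξ₀ hF0 hsum n hn => ?_⟩
  have hn1 : (1 : ℝ) ≤ n := by exact_mod_cast (by omega : 1 ≤ n)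
  have hn0 : (0 : ℝ) < n := by linarith
  have hmn : (m : ℝ) ≤ n := by exact_mod_cast (by omega : m ≤ n)
  have hB0 : 0 < B := by linarith
  have h15 : 15 / n ≤ ε := by
    rw [div_le_iff₀ hn0]
    have := (div_le_iff₀ hε0).1 (hm.trans hmn)
    linarith
  have key := contraction_induction (h := h) hβ ξ₀ hF0 n (fun j => 1 - j * ((15 / 16) / n))
    (1 / (32 * B * n)) M (by positivity) (by simp) ?_ ?_ ?_ n le_rfl (topOn F ξ₀) (botOn F ξ₀)
    (le_topOn fun x hx => botOn_apply hx) (fun x hx => topOn_apply hx) (fun x hx => botOn_apply hx)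
  · rw [← two_mul] at key
    change dd β h F (boxOff F (2 * n)) (ind (0, 0)) ξ₀ ≤ _ at key
    have hΔ : 0 ≤ dd β h F (boxOff F n) (ind (0, 0)) ξ₀ := dd_nonneg hβ (ind_mono _) (ind_nonneg _)
    have hK : ∑ x ∈ box (2 * n + 1) \ box n, (ev β h (boxOff F (2 * n)) (ind x) (topOn F ξ₀)
        - ev β h (boxOff F (2 * n)) (ind x) (botOn F ξ₀)) ≤ 2 * B * n := by
      calc _ ≤ ∑ x ∈ box (2 * n + 1), dd β h F (boxOff F (2 * n)) (ind x) ξ₀ :=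
            Finset.sum_le_sum_of_subset_of_nonneg Finset.sdiff_subset fun x _ _ =>
              dd_nonneg hβ (ind_mono _) (ind_nonneg _)
        _ = ∑ x ∈ box (2 * n + 1) \ box (2 * n), dd β h F (boxOff F (2 * n)) (ind x) ξ₀
            + ∑ x ∈ box (2 * n), dd β h F (boxOff F (2 * n)) (ind x) ξ₀ :=
            (Finset.sum_sdiff (box_mono (Nat.le_succ _))).symm
        _ ≤ ∑ x ∈ box (2 * n + 1) \ box (2 * n), 1 + C' * (2 * n : ℕ) :=
            add_le_add (Finset.sum_le_sum fun x _ => dd_le_one (ind_nonneg _) (ind_le_one _))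
              (hsum _ (by omega))
        _ = 8 * (2 * n + 1) + C' * (2 * n) := by
            rw [Finset.sum_const, nsmul_eq_mul, card_shell]; push_cast; ring
        _ ≤ 2 * B * n := by rw [hB]; nlinarith
    have h1 : (1 / (32 * B * n)) * ∑ x ∈ box (2 * n + 1) \ box n,
        (ev β h (boxOff F (2 * n)) (ind x) (topOn F ξ₀)
        - ev β h (boxOff F (2 * n)) (ind x) (botOn F ξ₀)) ≤ 1 / 16 := by
      refine (mul_le_mul_of_nonneg_left hK (by positivity)).trans_eq ?_
      field_simp; norm_num
    have h2 : (1 : ℝ) - n * ((15 / 16) / n) = 1 / 16 := by field_simp; norm_num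
    simp only [h2] at key
    nlinarith [mul_le_mul_of_nonneg_left h1 hΔ]
  · intro j hj
    have hjn : (j : ℝ) ≤ n := by exact_mod_cast hj
    have : (j : ℝ) * ((15 / 16) / n) ≤ 15 / 16 := by
      rw [← mul_div_assoc, div_le_iff₀ hn0]; nlinarith
    show 0 ≤ 1 - (j : ℝ) * ((15 / 16) / n)
    linarith
  · intro j
    show 1 - (j : ℝ) * ((15 / 16) / n) - (1 - ((j + 1 : ℕ) : ℝ) * ((15 / 16) / n)) ≤ _
    have : (15 / 16) / (n : ℝ) ≤ 1 / (32 * B * n) * M := by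
      rw [div_mul_eq_mul_div, one_mul, div_le_div_iff₀ hn0 (by positivity)]
      nlinarith
    push_cast
    linarith
  · intro j hj
    show (1 - ε) * (1 - (j : ℝ) * ((15 / 16) / n)) ≤ 1 - ((j + 1 : ℕ) : ℝ) * ((15 / 16) / n)
    have hjn : (j : ℝ) ≤ n := by exact_mod_cast hj.le
    have h1 : (j : ℝ) * ((15 / 16) / n) ≤ 15 / 16 := by
      rw [← mul_div_assoc, div_le_iff₀ hn0]; nlinarith
    have h2 : (15 / 16) / (n : ℝ) = 15 / n * (1 / 16) := by ring
    push_cast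
    have h3 := mul_le_mul_of_nonneg_left h1 hε0.le
    linarith

lemma quadratic_of_halving (m₀ : ℕ) : ∃ C : ℝ, 0 ≤ C ∧ ∀ a : ℕ → ℝ, Antitone a → (∀ n, a n ≤ 1) →
    (∀ n, m₀ ≤ n → a (2 * n) ≤ a n / 8) → ∀ n : ℕ, 1 ≤ n → a n ≤ C / (n : ℝ) ^ 2 := by
  refine ⟨4 * (m₀ + 2 : ℝ) ^ 2, by positivity, fun a ha ha1 hh n => ?_⟩
  induction n using Nat.strong_induction_on with
  | _ n ih =>
    intro hn
    have hn0 : (0 : ℝ) < n := by exact_mod_cast hn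
    by_cases hlt : n < 2 * (m₀ + 2)
    · refine (ha1 n).trans ?_
      rw [le_div_iff₀ (by positivity), one_mul]
      have : (n : ℝ) ≤ 2 * (m₀ + 2) := by exact_mod_cast hlt.le
      nlinarith
    · obtain ⟨m, hm⟩ : ∃ m, n = 2 * m ∨ n = 2 * m + 1 := ⟨n / 2, by omega⟩
      have hm2 : m₀ + 2 ≤ m := by omega
      have h1 := ih m (by omega) (by omega)
      have h2 : a n ≤ a (2 * m) := ha (by omega)
      have h3 := hh m (by omega)
      have hm0 : (2 : ℝ) ≤ m := by exact_mod_cast (by omega : 2 ≤ m)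
      have h4 : (n : ℝ) ≤ 2 * m + 1 := by exact_mod_cast (by omega : n ≤ 2 * m + 1)
      have h5 : (n : ℝ) ^ 2 ≤ 8 * (m : ℝ) ^ 2 := by nlinarith
      calc a n ≤ 4 * (m₀ + 2 : ℝ) ^ 2 / (m : ℝ) ^ 2 / 8 := by linarith
        _ = 4 * (m₀ + 2 : ℝ) ^ 2 / (8 * (m : ℝ) ^ 2) := by rw [div_div, mul_comm ((m : ℝ) ^ 2)]
        _ ≤ _ := div_le_div_of_nonneg_left (by positivity) (by positivity) h5

/-- A linear bound on the total influence gives quadratic decay of the influence at the origin. -/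
lemma quadratic_decay {β : ℝ} (h : ℝ) (hβ : 0 ≤ β) (C' : ℝ) (hC' : 0 ≤ C') :
    ∃ C : ℝ, 0 ≤ C ∧ ∀ (F : Set (ℤ × ℤ)) (ξ₀ : Cfg2), (0, 0) ∉ F →
    (∀ N : ℕ, 1 ≤ N → ∑ x ∈ box N, dd β h F (boxOff F N) (ind x) ξ₀ ≤ C' * N) → ∀ n : ℕ, 1 ≤ n →
    dd β h F (boxOff F n) (ind (0, 0)) ξ₀ ≤ C / (n : ℝ) ^ 2 := by
  obtain ⟨m₀, hm₀⟩ := contraction h hβ C' hC'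
  obtain ⟨C, hC, hq⟩ := quadratic_of_halving m₀
  refine ⟨C, hC, fun F ξ₀ hF0 hsum n hn => ?_⟩
  refine hq (fun n => dd β h F (boxOff F n) (ind (0, 0)) ξ₀) ?_ ?_ (hm₀ F ξ₀ hF0 hsum) n hn
  · intro m n hmn
    exact dd_anti hβ (ind_mono _) (ind_nonneg _) (boxOff_mono hmn) fun x hx => (mem_boxOff.1 hx).2
  · exact fun n => dd_le_one (ind_nonneg _) (ind_le_one _)

lemma summable_of_quadratic {a : ℕ → ℝ} (ha : ∀ n, 0 ≤ a n) {C : ℝ}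
    (h : ∀ n : ℕ, 1 ≤ n → a n ≤ C / (n : ℝ) ^ 2) : Summable a := by
  rw [← summable_nat_add_iff 1]
  refine Summable.of_nonneg_of_le (fun n => ha _) (fun n => h (n + 1) (by omega)) ?_
  have := (summable_nat_add_iff 1).2 ((Real.summable_nat_pow_inv (p := 2)).2 (by norm_num))
  simpa [div_eq_mul_inv] using this.mul_left C

end

noncomputable section

/-- The negative half-line. -/
def slit : Set (ℤ × ℤ) := {x | x.2 = 0 ∧ x.1 < 0}

lemma sum_comp_le_tsum {ι : Type*} {a : ℕ → ℝ} (ha : ∀ n, 0 ≤ a n) (hs : Summable a)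
    (s : Finset ι) (g : ι → ℕ) (hg : Set.InjOn g s) : ∑ k ∈ s, a (g k) ≤ ∑' n, a n := by
  classical
  rw [← Finset.sum_image hg]
  exact hs.sum_le_tsum _ fun n _ => ha n

lemma sum_natAbs_le {a : ℕ → ℝ} (ha : ∀ n, 0 ≤ a n) (hs : Summable a) (s : Finset ℤ) :
    ∑ k ∈ s, a k.natAbs ≤ 2 * ∑' n, a n := by
  classical
  rw [← Finset.sum_filter_add_sum_filter_not s (fun k => 0 ≤ k), two_mul]
  refine add_le_add (sum_comp_le_tsum ha hs _ _ ?_) (sum_comp_le_tsum ha hs _ _ ?_)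
  · intro i hi j hj hij
    simp only [Finset.coe_filter, Set.mem_ofPred_eq] at hi hj
    omega
  · intro i hi j hj hij
    simp only [Finset.coe_filter, Set.mem_ofPred_eq] at hi hj
    omega

/-- `Dr` with a first term `1` prepended. -/
def Dr1 (β h : ℝ) (k : ℕ) : ℝ := if k = 0 then 1 else Dr β h (k - 1)

lemma dd_axis_le {β h : ℝ} (hβ : 0 ≤ β) {F : Set (ℤ × ℤ)} (hF : ∀ x ∈ F, x.2 = 0) (ξ₀ : Cfg2) (N : ℕ) (x : ℤ × ℤ) (hx : x ∈ box N) :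
    dd β h F (boxOff F N) (ind x) ξ₀ ≤
      (Dr β h (N - x.1).toNat + Dr β h (N + x.1).toNat)
      + (Dr β h (N - x.2).toNat + Dr β h (N + x.2).toNat + Dr1 β h x.2.natAbs) := by
  have e1 := Dr_nonneg (h := h) hβ (N - x.1).toNat
  have e2 := Dr_nonneg (h := h) hβ (N + x.1).toNat
  have e3 := Dr_nonneg (h := h) hβ (N - x.2).toNat
  have e4 := Dr_nonneg (h := h) hβ (N + x.2).toNat
  have e5 := Dr_nonneg (h := h) hβ (x.2.natAbs - 1)
  rw [mem_box, abs_le, abs_le] at hx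
  obtain ⟨⟨x1, x2⟩, x3, x4⟩ := hx
  by_cases h0 : x.2 = 0
  · have h1 : dd β h F (boxOff F N) (ind x) ξ₀ ≤ 1 :=
      dd_le_one (ind_nonneg _) (ind_le_one _)
    have h2 : Dr1 β h x.2.natAbs = 1 := by simp [Dr1, h0]
    rw [h2]
    linarith
  · have h2 : Dr1 β h x.2.natAbs = Dr β h (x.2.natAbs - 1) := by simp [Dr1, h0]
    rw [h2]
    have key : ∀ r : ℕ, (r : ℤ) ≤ N - x.1 → (r : ℤ) ≤ N + x.1 → (r : ℤ) ≤ N - x.2 →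
        (r : ℤ) ≤ N + x.2 → r ≤ x.2.natAbs - 1 →
        dd β h F (boxOff F N) (ind x) ξ₀ ≤ Dr β h r := by
      intro r r1 r2 r3 r4 r5
      refine dd_ind_le_Dr hβ fun y hy => ?_
      rw [mem_boxAt, abs_le, abs_le] at hy
      rw [mem_boxOff, mem_box, abs_le, abs_le]
      refine ⟨by omega, fun hyF => ?_⟩
      have := hF y hyF
      omega
    obtain ⟨r, hr⟩ : ∃ r : ℕ, r = min (min (N - x.1).toNat (N + x.1).toNat)
      (min (min (N - x.2).toNat (N + x.2).toNat) (x.2.natAbs - 1)) := ⟨_, rfl⟩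
    have hk := key r (by omega) (by omega) (by omega) (by omega) (by omega)
    have hcase : r = (N - x.1).toNat ∨ r = (N + x.1).toNat ∨ r = (N - x.2).toNat ∨
        r = (N + x.2).toNat ∨ r = x.2.natAbs - 1 := by omega
    rcases hcase with hc | hc | hc | hc | hc <;> rw [hc] at hk <;> linarith

lemma sum_box_le {N : ℕ} (hN : 1 ≤ N) {u v : ℤ → ℝ} {A B : ℝ} (hA : 0 ≤ A) (hB : 0 ≤ B)
    (hu : ∑ k ∈ Finset.Icc (-(N : ℤ)) N, u k ≤ A) (hv : ∑ k ∈ Finset.Icc (-(N : ℤ)) N, v k ≤ B) :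
    ∑ x ∈ box N, (u x.1 + v x.2) ≤ 3 * (A + B) * N := by
  have hcard : ((Finset.Icc (-(N : ℤ)) N).card : ℝ) = 2 * N + 1 := by
    rw [Int.card_Icc, show ((N : ℤ) + 1 - -(N : ℤ)).toNat = 2 * N + 1 by omega]
    push_cast; ring
  unfold box
  rw [Finset.sum_add_distrib, Finset.sum_product_right, Finset.sum_product]
  simp only [Finset.sum_const, nsmul_eq_mul, hcard]
  have hN1 : (1 : ℝ) ≤ N := by exact_mod_cast hN
  nlinarith

lemma sum_axis_le {β h : ℝ} (hβ : 0 ≤ β) (hs : Summable (Dr β h)) : ∃ C' : ℝ, 0 ≤ C' ∧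
    ∀ (F : Set (ℤ × ℤ)), (∀ x ∈ F, x.2 = 0) → ∀ (ξ₀ : Cfg2) (N : ℕ), 1 ≤ N →
    ∑ x ∈ box N, dd β h F (boxOff F N) (ind x) ξ₀ ≤ C' * N := by
  have ha0 : ∀ k, 0 ≤ Dr1 β h k := fun k => by
    unfold Dr1; split_ifs
    · exact zero_le_one
    · exact Dr_nonneg hβ _
  have has : Summable (Dr1 β h) := by
    rw [← summable_nat_add_iff 1]
    simpa [Dr1] using hs
  have hD0 : ∀ k, 0 ≤ Dr β h k := Dr_nonneg hβ
  have hS : 0 ≤ ∑' n, Dr β h n := tsum_nonneg hD0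
  have hS' : 0 ≤ ∑' n, Dr1 β h n := tsum_nonneg ha0
  refine ⟨3 * (2 * ∑' n, Dr β h n + (2 * ∑' n, Dr β h n + 2 * ∑' n, Dr1 β h n)), by positivity,
    fun F hF ξ₀ N hN => ?_⟩
  have hinj1 : Set.InjOn (fun k : ℤ => ((N : ℤ) - k).toNat) (Finset.Icc (-(N : ℤ)) N) := by
    intro i hi j hj hij
    simp only [Finset.coe_Icc, Set.mem_Icc] at hi hj hij
    omega
  have hinj2 : Set.InjOn (fun k : ℤ => ((N : ℤ) + k).toNat) (Finset.Icc (-(N : ℤ)) N) := by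
    intro i hi j hj hij
    simp only [Finset.coe_Icc, Set.mem_Icc] at hi hj hij
    omega
  have b1 := sum_comp_le_tsum hD0 hs (Finset.Icc (-(N : ℤ)) N) _ hinj1
  have b2 := sum_comp_le_tsum hD0 hs (Finset.Icc (-(N : ℤ)) N) _ hinj2
  have b3 := sum_natAbs_le ha0 has (Finset.Icc (-(N : ℤ)) N)
  refine (Finset.sum_le_sum (dd_axis_le hβ hF ξ₀ N)).trans ?_
  refine sum_box_le hN
    (u := fun k => Dr β h ((N : ℤ) - k).toNat + Dr β h ((N : ℤ) + k).toNat)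
    (v := fun k => Dr β h ((N : ℤ) - k).toNat + Dr β h ((N : ℤ) + k).toNat + Dr1 β h k.natAbs)
    (by positivity) (by positivity) ?_ ?_
  · rw [Finset.sum_add_distrib]
    linarith
  · rw [Finset.sum_add_distrib, Finset.sum_add_distrib]
    linarith

lemma mem_slit {x : ℤ × ℤ} : x ∈ slit ↔ x.2 = 0 ∧ x.1 < 0 := Iff.rfl

/-- Quadratic decay of the influence through the complement of the slit. -/
lemma slit_decay {β h : ℝ} (hβ : 0 ≤ β) (hs : Summable (Dr β h)) : ∃ C : ℝ, 0 ≤ C ∧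
    ∀ (ξ₀ : Cfg2) (i n : ℕ), 1 ≤ n →
    dd β h slit (boxOff slit (n + i)) (ind ((i : ℤ), 0)) ξ₀ ≤ C / (n : ℝ) ^ 2 := by
  obtain ⟨C', hC', hsum⟩ := sum_axis_le hβ hs
  obtain ⟨C, hC, hq⟩ := quadratic_decay h hβ C' hC'
  refine ⟨C, hC, fun ξ₀ i n hn => ?_⟩
  set F : Set (ℤ × ℤ) := {x | x + ((i : ℤ), 0) ∈ slit} with hF
  have hFm : ∀ x : ℤ × ℤ, x ∈ F ↔ x.2 = 0 ∧ x.1 + i < 0 := fun x => by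
    show x + ((i : ℤ), 0) ∈ slit ↔ _
    rw [mem_slit]; simp
  have hF0 : ((0, 0) : ℤ × ℤ) ∉ F := by rw [hFm]; simp
  have h1 := hq F (fun x => ξ₀ (x + ((i : ℤ), 0))) hF0
    (hsum F (fun x hx => ((hFm x).1 hx).1) _) n hn
  refine le_trans ?_ h1
  have hsub : (boxOff F n).map (Equiv.addRight ((i : ℤ), (0 : ℤ))).toEmbedding
      ⊆ boxOff slit (n + i) := by
    intro y hy
    rw [Finset.mem_map_equiv] at hy
    rw [mem_boxOff, mem_box, abs_le, abs_le, hFm] at hy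
    rw [mem_boxOff, mem_box, abs_le, abs_le, mem_slit]
    simp at hy
    push_cast
    omega
  refine (dd_anti hβ (ind_mono _) (ind_nonneg _) hsub fun x hx => (mem_boxOff.1 hx).2).trans_eq ?_
  unfold dd
  rw [ev_add_map, ev_add_map]
  have e1 : (fun η : Cfg2 => ind ((i : ℤ), 0) (fun y => η (y - ((i : ℤ), 0)))) = ind (0, 0) := by
    funext η
    simp only [ind, sub_self]
    rfl
  rw [e1]
  rfl

end

noncomputable section

/-- The configuration equal to the given past on the slit and `+1` elsewhere. -/
def emb (ω : Past Bool) : Cfg2 := fun x => if x.2 = 0 ∧ x.1 < 0 then ω (x.1.natAbs - 1) else true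

/-- Indicator that the spins at the sites `(i, 0)`, `i ∈ A`, are all `+1`. -/
def LI (A : Finset ℤ) : Cfg2 → ℝ := indA (A.image fun i => (i, (0 : ℤ)))

/-- Probability that the spins on `A` are `+1` given the past. -/
def Qf (β h : ℝ) (A : Finset ℤ) (ω : Past Bool) : ℝ :=
  ⨅ n, ev β h (boxOff slit n) (LI A) (emb ω)

section
variable {β h : ℝ} {A : Finset ℤ} {ω ω' : Past Bool}

lemma LI_apply (A : Finset ℤ) (η : Cfg2) [Decidable (∀ i ∈ A, η (i, 0) = true)] :
    LI A η = if ∀ i ∈ A, η (i, 0) = true then 1 else 0 := by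
  simp [LI, indA]

lemma LI_nonneg (A : Finset ℤ) (η : Cfg2) : 0 ≤ LI A η := indA_nonneg _ _
lemma LI_le_one (A : Finset ℤ) (η : Cfg2) : LI A η ≤ 1 := indA_le_one _ _
lemma LI_mono (A : Finset ℤ) : Monotone (LI A) := indA_mono _

lemma LI_singleton (i : ℤ) : LI {i} = ind (i, 0) := by
  simp [LI, indA_singleton]

lemma topOn_emb (ω : Past Bool) : topOn slit (emb ω) = emb ω := by
  funext x
  unfold topOn emb
  split_ifs <;> simp_all [mem_slit]

lemma boxOff_off (F : Set (ℤ × ℤ)) (n : ℕ) : ∀ x ∈ boxOff F n, x ∉ F := fun _ hx => (mem_boxOff.1 hx).2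

lemma Qf_bddBelow (A : Finset ℤ) (ω : Past Bool) :
    BddBelow (Set.range fun n => ev β h (boxOff slit n) (LI A) (emb ω)) :=
  ⟨0, by rintro _ ⟨n, rfl⟩; exact ev_nonneg fun η _ => LI_nonneg A η⟩

lemma Qf_le (n : ℕ) : Qf β h A ω ≤ ev β h (boxOff slit n) (LI A) (emb ω) :=
  ciInf_le (Qf_bddBelow A ω) n

lemma le_Qf (hβ : 0 ≤ β) (n : ℕ) :
    ev β h (boxOff slit n) (LI A) (botOn slit (emb ω)) ≤ Qf β h A ω := by
  refine le_ciInf fun m => ?_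
  refine (botOn_le_ev hβ (LI_mono A) (LI_nonneg A) (boxOff_mono (le_max_right m n))
    (boxOff_off _ _) (η := emb ω) fun _ _ => rfl).trans ?_
  have := ev_le_topOn (h := h) hβ (LI_mono A) (LI_nonneg A) (boxOff_mono (F := slit) (le_max_left m n))
    (boxOff_off _ _) (η := emb ω) (ξ := emb ω) fun _ _ => rfl
  rwa [topOn_emb] at this

lemma Qf_sandwich (hβ : 0 ≤ β) {n : ℕ} {W : Finset (ℤ × ℤ)} (hW : boxOff slit n ⊆ W)
    (hWF : ∀ x ∈ W, x ∉ slit) {ζ : Cfg2} (hζ : ∀ x ∈ slit, ζ x = emb ω x) :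
    |ev β h W (LI A) ζ - Qf β h A ω| ≤ dd β h slit (boxOff slit n) (LI A) (emb ω) := by
  have h1 := Qf_le (β := β) (h := h) (A := A) (ω := ω) n
  have h2 := le_Qf (h := h) (A := A) (ω := ω) hβ n
  have h3 := ev_le_topOn (h := h) hβ (LI_mono A) (LI_nonneg A) hW hWF hζ
  have h4 := botOn_le_ev (h := h) hβ (LI_mono A) (LI_nonneg A) hW hWF hζ
  unfold dd
  rw [topOn_emb] at *
  rw [abs_le]
  constructor <;> linarith

lemma dd_LI_tendsto (hβ : 0 ≤ β) (hs : Summable (Dr β h)) (A : Finset ℤ) : ∃ b : ℕ → ℝ,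
    Tendsto b atTop (𝓝 0) ∧ ∀ n ξ, dd β h slit (boxOff slit n) (LI A) ξ ≤ b n := by
  obtain ⟨C, hC, hdec⟩ := slit_decay hβ hs
  refine ⟨fun n => ∑ i ∈ A, if n ≤ i.toNat then 1 else C / ((n - i.toNat : ℕ) : ℝ) ^ 2, ?_, ?_⟩
  · rw [show (0 : ℝ) = ∑ i ∈ A, 0 by simp]
    refine tendsto_finsetSum _ fun i _ => ?_
    have h1 : Tendsto (fun n : ℕ => C / ((n - i.toNat : ℕ) : ℝ) ^ 2) atTop (𝓝 0) := by
      refine Tendsto.comp (g := fun m : ℕ => C / (m : ℝ) ^ 2) ?_ (tendsto_sub_atTop_nat _)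
      exact tendsto_const_nhds.div_atTop
        ((tendsto_pow_atTop two_ne_zero).comp tendsto_natCast_atTop_atTop)
    refine h1.congr' ?_
    filter_upwards [eventually_gt_atTop i.toNat] with n hn
    rw [if_neg (by omega)]
  · intro n ξ
    refine (dd_indA_le hβ _).trans ?_
    rw [Finset.sum_image (by intro a _ b _ hab; simpa using hab)]
    refine Finset.sum_le_sum fun i _ => ?_
    split_ifs with hn
    · exact dd_le_one (ind_nonneg _) (ind_le_one _)
    · rcases lt_or_ge i 0 with hi | hi
      · have hni : ((i, 0) : ℤ × ℤ) ∉ boxOff slit n := fun hx => (mem_boxOff.1 hx).2 ⟨rfl, hi⟩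
        unfold dd
        rw [ev_ind_of_not_mem hni, ev_ind_of_not_mem hni]
        have hsl : ((i, 0) : ℤ × ℤ) ∈ slit := ⟨rfl, hi⟩
        simp only [ind, topOn_apply hsl, botOn_apply hsl, sub_self]
        positivity
      · have := hdec ξ i.toNat (n - i.toNat) (by omega)
        rwa [Nat.sub_add_cancel (by omega), Int.toNat_of_nonneg hi] at this

lemma Qf_tendsto (hβ : 0 ≤ β) (hs : Summable (Dr β h)) {W : ℕ → Finset (ℤ × ℤ)}
    (hW : ∀ n, boxOff slit n ⊆ W n) (hWF : ∀ n, ∀ x ∈ W n, x ∉ slit) {ζ : Cfg2}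
    (hζ : ∀ x ∈ slit, ζ x = emb ω x) :
    Tendsto (fun n => ev β h (W n) (LI A) ζ) atTop (𝓝 (Qf β h A ω)) := by
  obtain ⟨b, hb, hbd⟩ := dd_LI_tendsto hβ hs A
  rw [tendsto_iff_dist_tendsto_zero]
  refine squeeze_zero (fun _ => dist_nonneg) (fun n => ?_) hb
  rw [Real.dist_eq]
  exact (Qf_sandwich hβ (hW n) (hWF n) hζ).trans (hbd n _)

lemma continuous_ind (x : ℤ × ℤ) : Continuous (ind x) := by
  have : ind x = (fun b : Bool => if b then (1 : ℝ) else 0) ∘ fun η : Cfg2 => η x := rfl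
  rw [this]
  exact continuous_of_discreteTopology.comp (continuous_apply x)

lemma continuous_sval_apply (x : ℤ × ℤ) : Continuous fun η : Cfg2 => sval (η x) :=
  (continuous_of_discreteTopology (f := sval)).comp (continuous_apply x)

lemma indA_eq_prod (A : Finset (ℤ × ℤ)) (η : Cfg2) : indA A η = ∏ x ∈ A, ind x η := by
  unfold indA ind
  rw [Finset.prod_ite_zero]
  simp

lemma continuous_indA (A : Finset (ℤ × ℤ)) : Continuous (indA A) := by
  rw [show indA A = fun η => ∏ x ∈ A, ind x η from funext (indA_eq_prod A)]
  exact continuous_finsetProd _ fun x _ => continuous_ind x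

lemma continuous_gw (U : Finset (ℤ × ℤ)) : Continuous (gw β h U) := by
  unfold gw engy
  have := continuous_sval_apply
  fun_prop

lemma continuous_fill (U : Finset (ℤ × ℤ)) (τ : ↥U → Bool) : Continuous fun σ => fill U σ τ := by
  refine continuous_pi fun x => ?_
  unfold fill
  split_ifs
  · exact continuous_const
  · exact continuous_apply x

lemma continuous_ev (U : Finset (ℤ × ℤ)) {f : Cfg2 → ℝ} (hf : Continuous f) :
    Continuous (ev β h U f) := by
  unfold ev
  have hp : Continuous (pf β h U) := by
    unfold pf
    simp_rw [sum_agr]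
    exact continuous_finsetSum _ fun τ _ => (continuous_gw U).comp (continuous_fill U τ)
  refine Continuous.div ?_ hp fun σ => (pf_pos _ _ _ _).ne'
  simp_rw [sum_agr]
  exact continuous_finsetSum _ fun τ _ =>
    ((continuous_gw U).comp (continuous_fill U τ)).mul (hf.comp (continuous_fill U τ))

lemma continuous_emb : Continuous emb := by
  refine continuous_pi fun x => ?_
  unfold emb
  split_ifs
  · exact continuous_apply _
  · exact continuous_const

lemma continuous_Qf (hβ : 0 ≤ β) (hs : Summable (Dr β h)) (A : Finset ℤ) :
    Continuous (Qf β h A) := by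
  obtain ⟨b, hb, hbd⟩ := dd_LI_tendsto hβ hs A
  have hu : TendstoUniformly (fun n ω => ev β h (boxOff slit n) (LI A) (emb ω)) (Qf β h A) atTop := by
    rw [Metric.tendstoUniformly_iff]
    intro ε hε
    filter_upwards [hb.eventually (gt_mem_nhds hε)] with n hn ω
    rw [dist_comm, Real.dist_eq]
    exact ((Qf_sandwich hβ subset_rfl (boxOff_off _ _) fun _ _ => rfl).trans (hbd n _)).trans_lt hn
  exact hu.continuous (Eventually.of_forall fun n =>
    (continuous_ev _ (continuous_indA _)).comp continuous_emb).frequently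

lemma origin_mem (n : ℕ) : ((0, 0) : ℤ × ℤ) ∈ boxOff slit n := by
  simp [mem_boxOff, mem_box, mem_slit]

lemma Qf_zero_bounds (hβ : 0 ≤ β) : eps1 β h ≤ Qf β h {0} ω ∧ Qf β h {0} ω ≤ 1 - eps1 β h := by
  constructor
  · refine le_ciInf fun n => ?_
    rw [LI_singleton]
    exact eps1_le_ev_ind hβ (origin_mem n)
  · refine (Qf_le 0).trans ?_
    rw [LI_singleton]
    exact ev_ind_le hβ (origin_mem 0)

lemma Qf_nonneg : 0 ≤ Qf β h A ω := le_ciInf fun _ => ev_nonneg fun η _ => LI_nonneg A η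

lemma Qf_le_one : Qf β h A ω ≤ 1 := (Qf_le 0).trans (ev_le_const fun η _ => LI_le_one A η)

lemma Qf_variation (hβ : 0 ≤ β) (k : ℕ) (hag : ∀ j < k + 1, ω j = ω' j) :
    Qf β h {0} ω - Qf β h {0} ω' ≤ dd β h slit (boxOff slit k) (ind (0, 0)) (emb ω') := by
  have h1 := Qf_le (β := β) (h := h) (A := {0}) (ω := ω) k
  have h2 := le_Qf (h := h) (A := {0}) (ω := ω') hβ k
  rw [LI_singleton] at h1 h2
  have h3 : ev β h (boxOff slit k) (ind (0, 0)) (emb ω) = ev β h (boxOff slit k) (ind (0, 0)) (emb ω') := by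
    refine ev_local (fun η η' hη => by simp [ind, hη _ (origin_mem k)]) fun x hx y hy hyU => ?_
    unfold emb
    split_ifs with hc
    · refine hag _ ?_
      have := mem_box.1 (mem_box_succ_of_nbr (mem_boxOff.1 hyU).1 (mem_nbrs_comm.1 hy))
      have h4 := (abs_le.1 this.1).1
      push_cast at h4
      omega
    · rfl
  unfold dd
  rw [topOn_emb]
  linarith

/-- The g-function of the projection. -/
def gP (β h : ℝ) (a : Bool) (ω : Past Bool) : ℝ := if a then Qf β h {0} ω else 1 - Qf β h {0} ω

lemma gP_abs_sub (a : Bool) : |gP β h a ω - gP β h a ω'| = |Qf β h {0} ω - Qf β h {0} ω'| := by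
  cases a
  · simp only [gP]
    rw [abs_sub_comm]
    simp
  · simp [gP]

lemma summable_varG (hβ : 0 ≤ β) (hs : Summable (Dr β h)) :
    Summable fun k : ℕ => varG (gP β h) (k + 1) := by
  obtain ⟨C, hC, hdec⟩ := slit_decay hβ hs
  refine summable_of_quadratic (C := C) (fun n => Real.sSup_nonneg ?_) fun n hn => Real.sSup_le ?_ ?_
  · rintro d ⟨a, ω, σ', -, rfl⟩
    exact abs_nonneg _
  · rintro d ⟨a, ω, σ', hag, rfl⟩
    rw [gP_abs_sub, abs_sub_le_iff]
    have hd := fun ξ => hdec ξ 0 n hn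
    simp only [add_zero, Nat.cast_zero] at hd
    exact ⟨(Qf_variation hβ n hag).trans (hd _),
      (Qf_variation hβ n fun j hj => (hag j hj).symm).trans (hd _)⟩
  · positivity

/-- Prepend a symbol to a past. -/
def consP (a : Bool) (p : Past Bool) : Past Bool
  | 0 => a
  | k + 1 => p k

/-- Translate of a finite set of integers. -/
def shiftA (A : Finset ℤ) (k : ℤ) : Finset ℤ := A.image (· + k)

lemma mem_shifted {n : ℕ} {x : ℤ × ℤ} :
    x ∈ insert ((0, 0) : ℤ × ℤ) ((boxOff slit (n + 1)).map (Equiv.addRight ((1, 0) : ℤ × ℤ)).toEmbedding)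
      ↔ x ∈ boxAt (1, 0) (n + 1) ∧ x ∉ slit := by
  rcases x with ⟨a, b⟩
  simp only [Finset.mem_insert, Finset.mem_map, mem_boxAt, mem_boxOff, mem_box,
    mem_slit, Prod.mk.injEq, Equiv.coe_toEmbedding, Equiv.coe_addRight, Prod.exists, abs_le,
    Prod.mk_add_mk]
  constructor
  · intro hx
    push_cast at *
    rcases hx with ⟨h1, h2⟩ | ⟨c, d, h1, h2, h3⟩
    · subst h1 h2
      refine ⟨⟨⟨?_, ?_⟩, ?_, ?_⟩, ?_⟩ <;> omega
    · omega
  · intro h1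
    by_cases h2 : a = 0 ∧ b = 0
    · exact Or.inl h2
    · refine Or.inr ⟨a - 1, b, ?_, by omega, by omega⟩
      push_cast at *
      omega

lemma gP_cons (hβ : 0 ≤ β) (hs : Summable (Dr β h)) (A : Finset ℤ) (p : Past Bool) :
    gP β h true p * Qf β h A (consP true p) + gP β h false p * Qf β h A (consP false p)
      = Qf β h (shiftA A 1) p := by
  classical
  set T : ℕ → Finset (ℤ × ℤ) := fun n =>
    (boxOff slit (n + 1)).map (Equiv.addRight ((1, 0) : ℤ × ℤ)).toEmbedding with hT
  have hsub : ∀ n, boxOff slit n ⊆ insert ((0, 0) : ℤ × ℤ) (T n) := by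
    intro n x hx
    refine mem_shifted.2 ⟨?_, (mem_boxOff.1 hx).2⟩
    have := mem_box.1 (mem_boxOff.1 hx).1
    rw [mem_boxAt]
    simp only [abs_le] at this ⊢
    push_cast
    omega
  have hoff : ∀ n, ∀ x ∈ insert ((0, 0) : ℤ × ℤ) (T n), x ∉ slit := by
    intro n x hx
    exact (mem_shifted.1 hx).2
  have hL := Qf_tendsto (A := shiftA A 1) hβ hs hsub hoff (ω := p) (ζ := emb p) fun _ _ => rfl
  have hp := Qf_tendsto (A := {0}) hβ hs hsub hoff (ω := p) (ζ := emb p) fun _ _ => rfl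
  have hR : ∀ a, Tendsto (fun n => ev β h (T n) (LI (shiftA A 1)) (Function.update (emb p) (0, 0) a))
      atTop (𝓝 (Qf β h A (consP a p))) := by
    intro a
    have hfun : (fun η : Cfg2 => LI (shiftA A 1) (fun x => η (x - ((1, 0) : ℤ × ℤ)))) = LI A := by
      funext η
      rw [LI_apply, LI_apply]
      congr 1
      simp only [shiftA, Finset.mem_image, forall_exists_index, and_imp, forall_apply_eq_imp_iff₂,
        Prod.mk_sub_mk, add_sub_cancel_right, sub_zero]
    simp only [hT, ev_add_map, hfun]
    refine Qf_tendsto (W := fun n => boxOff slit (n + 1)) hβ hs (fun n => boxOff_mono (Nat.le_succ n))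
      (fun n => boxOff_off _ _) ?_
    rintro ⟨x, y⟩ hx
    simp only [mem_slit] at hx
    obtain ⟨rfl, hx⟩ := hx
    simp only [Prod.mk_add_mk, add_zero, Function.update_apply, Prod.mk.injEq, and_true, emb, true_and]
    rw [if_pos hx]
    by_cases h1 : x = -1
    · subst h1; simp [consP]
    · rw [if_neg (by omega), if_pos (by omega)]
      obtain ⟨k, hk⟩ : ∃ k : ℕ, x = -(k + 2) := ⟨(-x - 2).toNat, by omega⟩
      subst hk
      have e1 : (-((k : ℤ) + 2)).natAbs - 1 = k + 1 := by omega
      have e2 : (-((k : ℤ) + 2) + 1).natAbs - 1 = k := by omega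
      rw [e1, e2]
      rfl
  have hsp : ∀ n, ev β h (insert (0, 0) (T n)) (LI (shiftA A 1)) (emb p) = _ := fun n =>
    ev_split (0, 0) (T n) (LI (shiftA A 1)) (emb p)
  rw [funext hsp, ← LI_singleton] at hL
  have := (hp.mul (hR true)).add ((hp.const_sub 1).mul (hR false))
  have h2 := tendsto_nhds_unique hL this
  simp only [gP, if_true] 
  simpa using h2.symm

end

end

noncomputable section

lemma measurableSet_cyl {ι : Type*} (s : Finset ι) (g : ι → Bool) :
    MeasurableSet {ζ : ι → Bool | ∀ x ∈ s, ζ x = g x} := by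
  have : {η : ι → Bool | ∀ i ∈ s, η i = g i} = ⋂ i ∈ s, (fun η => η i) ⁻¹' {g i} := by
    ext η; simp
  rw [this]
  exact Finset.measurableSet_biInter s fun i _ => measurable_pi_apply i (measurableSet_singleton _)

lemma measure_ext_of_plus {ι : Type*} (m m' : Measure (ι → Bool)) [IsFiniteMeasure m]
    (h : ∀ s : Finset ι, m {η | ∀ i ∈ s, η i = true} = m' {η | ∀ i ∈ s, η i = true}) : m = m' := by
  classical
  refine ext_of_generate_finite (Set.range fun s : Finset ι => {η : ι → Bool | ∀ i ∈ s, η i = true})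
    ?_ ?_ ?_ ?_
  · refine le_antisymm ?_ (MeasurableSpace.generateFrom_le ?_)
    · refine iSup_le fun i => ?_
      rw [← measurable_iff_comap_le]
      refine @measurable_to_bool _ (_) _ ?_
      refine MeasurableSpace.measurableSet_generateFrom ⟨{i}, ?_⟩
      ext η
      simp
    · rintro _ ⟨s, rfl⟩
      exact measurableSet_cyl s fun _ => true
  · rintro _ ⟨s, rfl⟩ _ ⟨t, rfl⟩ -
    refine ⟨s ∪ t, ?_⟩
    ext η
    simp only [Finset.mem_union, Set.mem_ofPred_eq, Set.mem_inter_iff]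
    constructor
    · exact fun hη => ⟨fun i hi => hη i (Or.inl hi), fun i hi => hη i (Or.inr hi)⟩
    · rintro ⟨h1, h2⟩ i (hi | hi)
      · exact h1 i hi
      · exact h2 i hi
  · rintro _ ⟨s, rfl⟩
    exact h s
  · have := h ∅
    simpa using this

section
variable {β h : ℝ} {μ : Measure Cfg2}

lemma continuous_of_local (s : Finset (ℤ × ℤ)) {f : Cfg2 → ℝ}
    (hf : ∀ η η' : Cfg2, (∀ x ∈ s, η x = η' x) → f η = f η') (η : Cfg2) :
    f η = ∑ τ : ↥s → Bool, f (fill s (fun _ => true) τ) *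
      ({ζ : Cfg2 | ∀ x ∈ s, ζ x = fill s (fun _ => true) τ x}.indicator 1 η) := by
  classical
  rw [Finset.sum_eq_single (fun x : ↥s => η x)]
  · rw [Set.indicator_of_mem (by intro x hx; simp [fill, hx])]
    simp only [Pi.one_apply, mul_one]
    exact hf _ _ fun x hx => by simp [fill, hx]
  · intro τ _ hτ
    rw [Set.indicator_of_notMem, mul_zero]
    intro hη
    apply hτ
    funext x
    have := hη x x.2
    simp only [fill, x.2, dif_pos] at this
    exact this.symm
  · simp

lemma local_tendsto (hμ : IsPlusPhase β h μ) (s : Finset (ℤ × ℤ)) {f : Cfg2 → ℝ}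
    (hf : ∀ η η' : Cfg2, (∀ x ∈ s, η x = η' x) → f η = f η') :
    Tendsto (fun N => ev β h (box N) f fun _ => true) atTop (𝓝 (∫ η, f η ∂μ)) := by
  classical
  have := hμ.1
  have hrep := continuous_of_local s hf
  have h1 : ∀ N, ev β h (box N) f (fun _ => true) = ∑ τ : ↥s → Bool, f (fill s (fun _ => true) τ) *
      (isingFV β h (box N) (fun _ => true)
        {ζ : Cfg2 | ∀ x ∈ s, ζ x = fill s (fun _ => true) τ x}).toReal := by
    intro N
    have : f = fun η => ∑ τ ∈ (Finset.univ : Finset (↥s → Bool)), (fun τ η => f (fill s (fun _ => true) τ) *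
      ({ζ : Cfg2 | ∀ x ∈ s, ζ x = fill s (fun _ => true) τ x}.indicator 1 η)) τ η := funext hrep
    conv_lhs => rw [this]
    rw [ev_sum]
    refine Finset.sum_congr rfl fun τ _ => ?_
    rw [isingFV_apply, ENNReal.toReal_ofReal (ev_nonneg fun η _ => Set.indicator_nonneg (by simp) _),
      ev_mul_left]
  have h2 : ∫ η, f η ∂μ = ∑ τ : ↥s → Bool, f (fill s (fun _ => true) τ) *
      (μ {ζ : Cfg2 | ∀ x ∈ s, ζ x = fill s (fun _ => true) τ x}).toReal := by
    rw [integral_congr_ae (Eventually.of_forall hrep), integral_finsetSum]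
    · refine Finset.sum_congr rfl fun τ _ => ?_
      rw [integral_const_mul]
      congr 1
      · rw [integral_indicator_one (measurableSet_cyl s _)]
        rfl
    · intro τ _
      refine Integrable.const_mul ?_ _
      exact (integrable_const (1 : ℝ)).indicator (measurableSet_cyl s _)
  rw [h2, funext h1]
  refine tendsto_finsetSum _ fun τ _ => Tendsto.const_mul _ ?_
  exact (ENNReal.tendsto_toReal (measure_ne_top _ _)).comp (hμ.2 s _)

lemma indA_local (A : Finset (ℤ × ℤ)) (η η' : Cfg2) (h : ∀ x ∈ A, η x = η' x) :
    indA A η = indA A η' := by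
  rw [indA_eq_prod, indA_eq_prod]
  exact Finset.prod_congr rfl fun x hx => by simp [ind, h x hx]

lemma integral_indA_shift (hβ : 0 ≤ β) (hμ : IsPlusPhase β h μ) (A : Finset (ℤ × ℤ)) :
    ∫ η, indA (A.map (Equiv.addRight ((1, 0) : ℤ × ℤ)).toEmbedding) η ∂μ = ∫ η, indA A η ∂μ := by
  set v : ℤ × ℤ := (1, 0)
  set A' := A.map (Equiv.addRight v).toEmbedding with hA'
  have h1 := local_tendsto hμ A (indA_local A)
  have h2 := local_tendsto hμ A' (indA_local A')
  have hsh : ∀ N, ev β h ((box N).map (Equiv.addRight v).toEmbedding) (indA A') (fun _ => true)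
      = ev β h (box N) (indA A) (fun _ => true) := by
    intro N
    rw [ev_add_map]
    congr 1
    funext η
    rw [indA_eq_prod, indA_eq_prod, hA', Finset.prod_map]
    refine Finset.prod_congr rfl fun x _ => ?_
    simp [ind]
  have hmono : ∀ U V : Finset (ℤ × ℤ), V ⊆ U →
      ev β h U (indA A') (fun _ => true) ≤ ev β h V (indA A') (fun _ => true) := by
    intro U V hVU
    have := ev_le_topOn (h := h) (F := ∅) (ξ := fun _ => true) (η := fun _ => true) hβ (indA_mono A')
      (indA_nonneg A') hVU (by simp) (by simp)
    rwa [topOn_empty] at this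
  have hs1 : ∀ N, box N ⊆ (box (N + 1)).map (Equiv.addRight v).toEmbedding := by
    intro N x hx
    change x ∈ boxAt v (N + 1)
    rw [mem_boxAt]
    rw [mem_box] at hx
    simp only [abs_le, v] at hx ⊢
    push_cast
    omega
  have hs2 : ∀ N, (box (N + 1)).map (Equiv.addRight v).toEmbedding ⊆ box (N + 2) := by
    intro N x hx
    change x ∈ boxAt v (N + 1) at hx
    rw [mem_boxAt] at hx
    rw [mem_box]
    simp only [abs_le, v] at hx ⊢
    push_cast at *
    omega
  have h1' := (tendsto_add_atTop_iff_nat 1).2 h1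
  refine le_antisymm ?_ ?_
  · refine le_of_tendsto_of_tendsto' ((tendsto_add_atTop_iff_nat 2).2 h2) h1' fun N => ?_
    rw [← hsh]
    exact hmono _ _ (hs2 N)
  · refine le_of_tendsto_of_tendsto' h1' h2 fun N => ?_
    rw [← hsh]
    exact hmono _ _ (hs1 N)

lemma measurable_lineProj : Measurable lineProj :=
  measurable_pi_lambda _ fun i => measurable_pi_apply (i, 0)

lemma measurable_shiftSeq : Measurable (shiftSeq (A := Bool)) :=
  measurable_pi_lambda _ fun i => measurable_pi_apply (i + 1)

lemma measurable_restrictPast : Measurable (restrictPast (A := Bool)) :=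
  measurable_pi_lambda _ fun _ => measurable_pi_apply _

lemma integral_indA_eq [IsFiniteMeasure μ] (A : Finset (ℤ × ℤ)) :
    ∫ η, indA A η ∂μ = μ.real {η | ∀ x ∈ A, η x = true} := by
  classical
  have h1 : indA A = {η : Cfg2 | ∀ x ∈ A, η x = true}.indicator 1 := by
    funext η
    simp [indA, Set.indicator]
  rw [h1, integral_indicator_one]
  exact measurableSet_cyl A fun _ => true

lemma schonmann_isProbability (hμ : IsPlusPhase β h μ) : IsProbabilityMeasure (schonmann μ) :=
  have := hμ.1
  Measure.isProbabilityMeasure_map measurable_lineProj.aemeasurable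

lemma schonmann_shift (hβ : 0 ≤ β) (hμ : IsPlusPhase β h μ) :
    (schonmann μ).map shiftSeq = schonmann μ := by
  classical
  have := hμ.1
  have := schonmann_isProbability hμ
  refine measure_ext_of_plus _ _ fun s => ?_
  have hm := measurableSet_cyl s fun _ : ℤ => true
  rw [Measure.map_apply measurable_shiftSeq hm]
  unfold schonmann
  rw [Measure.map_apply measurable_lineProj hm,
    Measure.map_apply measurable_lineProj (measurable_shiftSeq hm)]
  have h1 := integral_indA_shift hβ hμ (s.image fun i => (i, (0 : ℤ)))
  rw [integral_indA_eq, integral_indA_eq] at h1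
  have h2 := (ENNReal.toReal_eq_toReal_iff' (measure_ne_top _ _) (measure_ne_top _ _)).1 h1
  convert h2 using 2
  · ext η
    simp only [lineProj, shiftSeq, Set.preimage_ofPred_eq, Set.mem_ofPred_eq, Finset.mem_map, Finset.mem_image]
    constructor
    · rintro hη _ ⟨_, ⟨i, hi, rfl⟩, rfl⟩
      simpa using hη i hi
    · intro hη i hi
      exact hη _ ⟨_, ⟨i, hi, rfl⟩, by simp⟩
  · ext η
    simp [lineProj]

end

end

noncomputable section

section
variable {β h : ℝ} {μ : Measure Cfg2}

/-- The past of a planar configuration along the line. -/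
def pastOf (η : Cfg2) : Past Bool := restrictPast (lineProj η)

lemma emb_pastOf (η : Cfg2) {x : ℤ × ℤ} (hx : x ∈ slit) : η x = emb (pastOf η) x := by
  obtain ⟨a, b⟩ := x
  obtain ⟨rfl, ha⟩ : b = 0 ∧ a < 0 := hx
  simp only [emb, pastOf, restrictPast, lineProj, true_and, if_pos ha]
  congr 2
  omega

lemma measurableSet_origin (a : Bool) : MeasurableSet {ω : ZSeq Bool | ω 0 = a} := by
  have h1 : Measurable fun ω : ZSeq Bool => ω 0 := measurable_pi_apply 0
  exact h1 (measurableSet_singleton a)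

lemma continuous_pastOf : Continuous pastOf :=
  continuous_pi fun _ => continuous_apply _

lemma continuous_restrictPast : Continuous (restrictPast (A := Bool)) :=
  continuous_pi fun _ => continuous_apply _

lemma integrable_of_bdd {X : Type*} [MeasurableSpace X] {m : Measure X} [IsFiniteMeasure m]
    {f : X → ℝ} (hf : Measurable f) (h0 : ∀ x, 0 ≤ f x) (h1 : ∀ x, f x ≤ 1) : Integrable f m :=
  Integrable.of_bound hf.aestronglyMeasurable 1 (Eventually.of_forall fun x => by
    rw [Real.norm_eq_abs, abs_of_nonneg (h0 x)]; exact h1 x)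

lemma LI_eq_of_agr {A : Finset ℤ} (hA : ∀ i ∈ A, i < 0) {n : ℕ} {η ζ : Cfg2}
    (hζ : ζ ∈ agr (boxOff slit n) η) : LI A ζ = LI A η := by
  refine indA_local _ _ _ fun x hx => ?_
  obtain ⟨i, hi, rfl⟩ := Finset.mem_image.1 hx
  exact mem_agr.1 hζ _ fun hmem => (mem_boxOff.1 hmem).2 ⟨rfl, hA i hi⟩

lemma plus_consistency (hβ : 0 ≤ β) (hs : Summable (Dr β h)) (hμ : IsPlusPhase β h μ)
    {A : Finset ℤ} (hA : ∀ i ∈ A, i < 0) :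
    ∫ η, LI A η * ind (0, 0) η ∂μ = ∫ η, LI A η * Qf β h {0} (pastOf η) ∂μ := by
  classical
  have := hμ.1
  have hstep : ∀ n, ∫ η, LI A η * ev β h (boxOff slit n) (ind (0, 0)) η ∂μ = ∫ η, LI A η * ind (0, 0) η ∂μ := by
    intro n
    have h1 := local_tendsto hμ (A.image (fun i => (i, (0 : ℤ))) ∪ {(0, 0)})
      (f := fun η => LI A η * ind (0, 0) η) fun η η' hη => by
        have e1 : LI A η = LI A η' := indA_local _ _ _ fun x hx => hη x (Finset.mem_union_left _ hx)
        have e2 : ind (0, 0) η = ind (0, 0) η' := by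
          unfold ind
          rw [hη (0, 0) (Finset.mem_union_right _ (Finset.mem_singleton_self _))]
        exact congrArg₂ _ e1 e2
    have h2 := local_tendsto hμ (A.image (fun i => (i, (0 : ℤ))) ∪ (boxOff slit n).biUnion nbrs)
      (f := fun η => LI A η * ev β h (boxOff slit n) (ind (0, 0)) η) fun η η' hη => by
        have e1 : LI A η = LI A η' := indA_local _ _ _ fun x hx => hη x (Finset.mem_union_left _ hx)
        have e2 : ev β h (boxOff slit n) (ind (0, 0)) η = ev β h (boxOff slit n) (ind (0, 0)) η' := by
          refine ev_local (fun ζ ζ' hζ => by simp [ind, hζ _ (origin_mem n)]) fun x _ y hy hyU => ?_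
          exact hη x (Finset.mem_union_right _ (Finset.mem_biUnion.2 ⟨y, hyU, mem_nbrs_comm.1 hy⟩))
        exact congrArg₂ _ e1 e2
    refine tendsto_nhds_unique h2 (h1.congr' ?_)
    filter_upwards [eventually_ge_atTop n] with N hN
    have hsub : boxOff slit n ⊆ box N := fun x hx => box_mono hN (mem_boxOff.1 hx).1
    rw [← ev_tower hsub]
    refine ev_congr fun η _ => ?_
    rw [← ev_mul_left]
    exact ev_congr fun ζ hζ => by rw [LI_eq_of_agr hA hζ]
  obtain ⟨b, hb, hbd⟩ := dd_LI_tendsto hβ hs {0}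
  have hLIc : Continuous (LI A) := continuous_indA _
  have hQc : Continuous fun η => Qf β h {0} (pastOf η) := (continuous_Qf hβ hs {0}).comp continuous_pastOf
  have hbound : ∀ n, |∫ η, LI A η * ind (0, 0) η ∂μ - ∫ η, LI A η * Qf β h {0} (pastOf η) ∂μ| ≤ b n := by
    intro n
    have hec : Continuous (ev β h (boxOff slit n) (ind (0, 0))) := continuous_ev _ (continuous_ind _)
    rw [← hstep n, ← integral_sub]
    · rw [← Real.norm_eq_abs]
      refine (norm_integral_le_of_norm_le_const (C := b n) (Eventually.of_forall fun η => ?_)).trans ?_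
      · rw [← mul_sub, Real.norm_eq_abs, abs_mul, abs_of_nonneg (LI_nonneg A η)]
        have h3 := (Qf_sandwich (h := h) (A := {0}) (ω := pastOf η) (n := n) hβ subset_rfl (boxOff_off _ _)
          fun x hx => emb_pastOf η hx).trans (hbd n _)
        rw [LI_singleton] at h3
        exact (mul_le_of_le_one_left (abs_nonneg _) (LI_le_one A η)).trans h3
      · simp
    · exact integrable_of_bdd (hLIc.mul hec).measurable
        (fun η => mul_nonneg (LI_nonneg _ _) (ev_nonneg fun _ _ => ind_nonneg _ _))
        (fun η => mul_le_one₀ (LI_le_one _ _) (ev_nonneg fun _ _ => ind_nonneg _ _) (ev_le_const fun _ _ => ind_le_one _ _))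
    · exact integrable_of_bdd (hLIc.mul hQc).measurable
        (fun η => mul_nonneg (LI_nonneg _ _) Qf_nonneg)
        (fun η => mul_le_one₀ (LI_le_one _ _) Qf_nonneg Qf_le_one)
  have h0 := ge_of_tendsto' hb hbound
  exact sub_eq_zero.1 (abs_eq_zero.1 (le_antisymm h0 (abs_nonneg _)))

lemma gP_nonneg (a : Bool) (p : Past Bool) : 0 ≤ gP β h a p := by
  have h1 := Qf_nonneg (β := β) (h := h) (A := {0}) (ω := p)
  have h2 := Qf_le_one (β := β) (h := h) (A := {0}) (ω := p)
  cases a <;> simp [gP] <;> linarith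

lemma gP_le_one (a : Bool) (p : Past Bool) : gP β h a p ≤ 1 := by
  have h1 := Qf_nonneg (β := β) (h := h) (A := {0}) (ω := p)
  have h2 := Qf_le_one (β := β) (h := h) (A := {0}) (ω := p)
  cases a <;> simp [gP] <;> linarith

lemma gP_continuous (hβ : 0 ≤ β) (hs : Summable (Dr β h)) (a : Bool) : Continuous (gP β h a) := by
  have := continuous_Qf hβ hs {0}
  cases a
  · exact continuous_const.sub this
  · exact this

lemma setIntegral_past (hβ : 0 ≤ β) (hs : Summable (Dr β h)) (hμ : IsPlusPhase β h μ)
    {B : Set (Past Bool)} (hB : MeasurableSet B) :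
    ∫ ω in restrictPast ⁻¹' B, gP β h true (restrictPast ω) ∂(schonmann μ)
      = ∫ ω in restrictPast ⁻¹' B, Set.indicator {ω : ZSeq Bool | ω 0 = true} (fun _ => (1 : ℝ)) ω
          ∂(schonmann μ) := by
  classical
  have := hμ.1
  have := schonmann_isProbability hμ
  set ν := schonmann μ
  have hG : Continuous fun ω : ZSeq Bool => gP β h true (restrictPast ω) :=
    (gP_continuous hβ hs true).comp continuous_restrictPast
  have hT : MeasurableSet {ω : ZSeq Bool | ω 0 = true} :=
    measurableSet_origin true
  set I : ZSeq Bool → ℝ := Set.indicator {ω : ZSeq Bool | ω 0 = true} (fun _ => (1 : ℝ)) with hI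
  have hIm : Measurable I := measurable_const.indicator hT
  have hI0 : ∀ ω, 0 ≤ I ω := fun ω => Set.indicator_nonneg (by simp) _
  have hI1 : ∀ ω, I ω ≤ 1 := fun ω => Set.indicator_le_self' (by simp) _
  have key : (ν.withDensity fun ω => ENNReal.ofReal (gP β h true (restrictPast ω))).map restrictPast
      = (ν.withDensity fun ω => ENNReal.ofReal (I ω)).map restrictPast := by
    have : IsFiniteMeasure (ν.withDensity fun ω => ENNReal.ofReal (gP β h true (restrictPast ω))) :=
      isFiniteMeasure_withDensity_ofReal
        (integrable_of_bdd hG.measurable (fun _ => gP_nonneg _ _) (fun _ => gP_le_one _ _)).2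
    refine measure_ext_of_plus _ _ fun s => ?_
    have hm := measurableSet_cyl s fun _ : ℕ => true
    rw [Measure.map_apply measurable_restrictPast hm, Measure.map_apply measurable_restrictPast hm,
      withDensity_apply _ (measurable_restrictPast hm), withDensity_apply _ (measurable_restrictPast hm),
      ← ofReal_integral_eq_lintegral_ofReal, ← ofReal_integral_eq_lintegral_ofReal]
    · congr 1
      rw [← integral_indicator (measurable_restrictPast hm),
        ← integral_indicator (measurable_restrictPast hm)]
      have h1 := plus_consistency hβ hs hμ (A := s.image fun k : ℕ => -((k : ℤ) + 1)) (by
        intro i hi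
        obtain ⟨k, -, rfl⟩ := Finset.mem_image.1 hi
        omega)
      have hLI : ∀ η : Cfg2, LI (s.image fun k : ℕ => -((k : ℤ) + 1)) η =
          if lineProj η ∈ restrictPast ⁻¹' {p : Past Bool | ∀ k ∈ s, p k = true} then 1 else 0 := by
        intro η
        rw [LI_apply]
        congr 1
        simp [restrictPast, lineProj]
      have hmap : ∀ f : ZSeq Bool → ℝ, Measurable f → ∫ ω, f ω ∂ν = ∫ η, f (lineProj η) ∂μ :=
        fun f hf => integral_map measurable_lineProj.aemeasurable hf.aestronglyMeasurable
      rw [hmap _ (hG.measurable.indicator (measurable_restrictPast hm)),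
        hmap _ (hIm.indicator (measurable_restrictPast hm))]
      rw [eq_comm]
      convert h1 using 2
      · funext η
        rw [hLI η, Set.indicator_apply]
        by_cases ha : η (0, 0) = true <;> simp [hI, ind, lineProj, ha]
      · funext η
        rw [hLI η, Set.indicator_apply]
        simp only [gP, pastOf]
        split_ifs <;> simp
    · exact (integrable_of_bdd hIm hI0 hI1).integrableOn
    · exact Eventually.of_forall hI0
    · exact (integrable_of_bdd hG.measurable (fun _ => gP_nonneg _ _) (fun _ => gP_le_one _ _)).integrableOn
    · exact Eventually.of_forall fun _ => gP_nonneg _ _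
  have h2 := congrArg (fun m => (m B).toReal) key
  rw [Measure.map_apply measurable_restrictPast hB, Measure.map_apply measurable_restrictPast hB,
      withDensity_apply _ (measurable_restrictPast hB), withDensity_apply _ (measurable_restrictPast hB),
      ← ofReal_integral_eq_lintegral_ofReal, ← ofReal_integral_eq_lintegral_ofReal,
      ENNReal.toReal_ofReal, ENNReal.toReal_ofReal] at h2
  · exact h2
  · exact integral_nonneg hI0
  · exact integral_nonneg fun _ => gP_nonneg _ _
  · exact (integrable_of_bdd hIm hI0 hI1).integrableOn
  · exact Eventually.of_forall hI0
  · exact (integrable_of_bdd hG.measurable (fun _ => gP_nonneg _ _) (fun _ => gP_le_one _ _)).integrableOn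
  · exact Eventually.of_forall fun _ => gP_nonneg _ _

lemma pastSigma_le : pastSigma Bool ≤ (inferInstance : MeasurableSpace (ZSeq Bool)) :=
  measurable_restrictPast.comap_le

lemma schonmann_isGMeasure (hβ : 0 ≤ β) (hs : Summable (Dr β h)) (hμ : IsPlusPhase β h μ) :
    IsGMeasure (schonmann μ) (gP β h) := by
  have := hμ.1
  have := schonmann_isProbability hμ
  refine ⟨this, schonmann_shift hβ hμ, ?_⟩
  have hT : MeasurableSet {ω : ZSeq Bool | ω 0 = true} :=
    measurableSet_origin true
  have hInt : Integrable (Set.indicator {ω : ZSeq Bool | ω 0 = true} (fun _ => (1 : ℝ))) (schonmann μ) :=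
    (integrable_const 1).indicator hT
  have hG : Continuous fun ω : ZSeq Bool => gP β h true (restrictPast ω) :=
    (gP_continuous hβ hs true).comp continuous_restrictPast
  have htrue : (fun ω => gP β h true (restrictPast ω)) =ᵐ[schonmann μ]
      (schonmann μ)[Set.indicator {ω : ZSeq Bool | ω 0 = true} (fun _ => (1 : ℝ)) | pastSigma Bool] := by
    refine ae_eq_condExp_of_forall_setIntegral_eq pastSigma_le hInt ?_ ?_ ?_
    · intro s _ _
      exact (integrable_of_bdd hG.measurable (fun _ => gP_nonneg _ _) (fun _ => gP_le_one _ _)).integrableOn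
    · rintro _ ⟨B, hB, rfl⟩ -
      exact setIntegral_past hβ hs hμ hB
    · refine StronglyMeasurable.aestronglyMeasurable ?_
      refine Measurable.stronglyMeasurable ?_
      exact (gP_continuous hβ hs true).measurable.comp (comap_measurable _)
  intro a
  cases a
  · have h1 : Set.indicator {ω : ZSeq Bool | ω 0 = false} (fun _ => (1 : ℝ))
        = (fun _ => (1 : ℝ)) - Set.indicator {ω : ZSeq Bool | ω 0 = true} (fun _ => (1 : ℝ)) := by
      funext ω
      rcases Bool.eq_false_or_eq_true (ω 0) with hb | hb <;> simp [hb]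
    rw [h1]
    have h2 := condExp_sub (m := pastSigma Bool) (integrable_const (1 : ℝ)) hInt
    rw [condExp_const pastSigma_le] at h2
    filter_upwards [h2, htrue] with ω h3 h4
    rw [h3, Pi.sub_apply, ← h4]
    simp [gP]
  · exact htrue

end

end

noncomputable section

section
variable {β h : ℝ} {ν ν' : Measure (ZSeq Bool)}

lemma integral_gMeasure_mul {P : Bool → Past Bool → ℝ} (hν : IsGMeasure ν P)
    (a : Bool) {H : Past Bool → ℝ} (hH : Measurable H) (h0 : ∀ p, 0 ≤ H p) (h1 : ∀ p, H p ≤ 1) :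
    ∫ ω, H (restrictPast ω) * Set.indicator {ω : ZSeq Bool | ω 0 = a} (fun _ => (1 : ℝ)) ω ∂ν
      = ∫ ω, H (restrictPast ω) * P a (restrictPast ω) ∂ν := by
  have := hν.1
  have hI : Integrable (Set.indicator {ω : ZSeq Bool | ω 0 = a} (fun _ => (1 : ℝ))) ν :=
    (integrable_const 1).indicator (measurableSet_origin a)
  have hprod : Integrable ((fun ω => H (restrictPast ω)) *
      Set.indicator {ω : ZSeq Bool | ω 0 = a} (fun _ => (1 : ℝ))) ν := by
    refine integrable_of_bdd ((hH.comp measurable_restrictPast).mul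
      (measurable_const.indicator (measurableSet_origin a))) (fun ω => ?_) fun ω => ?_
    · exact mul_nonneg (h0 _) (Set.indicator_nonneg (by simp) _)
    · exact mul_le_one₀ (h1 _) (Set.indicator_nonneg (by simp) _) (Set.indicator_le_self' (by simp) _)
  have h2 := condExp_mul_of_stronglyMeasurable_left (m := pastSigma Bool) (μ := ν)
    (f := fun ω => H (restrictPast ω)) (hH.comp (comap_measurable _)).stronglyMeasurable hprod hI
  have h3 := integral_condExp (μ := ν) (f := (fun ω => H (restrictPast ω)) *
      Set.indicator {ω : ZSeq Bool | ω 0 = a} (fun _ => (1 : ℝ))) pastSigma_le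
  rw [show (∫ ω, H (restrictPast ω) * Set.indicator {ω : ZSeq Bool | ω 0 = a} (fun _ => (1 : ℝ)) ω ∂ν)
    = ∫ ω, ((fun ω => H (restrictPast ω)) *
      Set.indicator {ω : ZSeq Bool | ω 0 = a} (fun _ => (1 : ℝ))) ω ∂ν from rfl, ← h3]
  refine integral_congr_ae ?_
  filter_upwards [h2, hν.2.2 a] with ω h4 h5
  rw [h4, Pi.mul_apply, ← h5]

lemma restrictPast_shiftSeq (ω : ZSeq Bool) :
    restrictPast (shiftSeq ω) = consP (ω 0) (restrictPast ω) := by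
  funext k
  cases k with
  | zero => simp [restrictPast, shiftSeq, consP]
  | succ k => simp only [restrictPast, shiftSeq, consP]; exact congrArg ω (by push_cast; ring)

lemma continuous_consP (a : Bool) : Continuous (consP a) := by
  refine continuous_pi fun k => ?_
  cases k with
  | zero => exact continuous_const
  | succ k => exact continuous_apply k

lemma integral_Qf_step (hβ : 0 ≤ β) (hs : Summable (Dr β h)) (hν : IsGMeasure ν (gP β h)) (A : Finset ℤ) :
    ∫ ω, Qf β h A (restrictPast ω) ∂ν = ∫ ω, Qf β h (shiftA A 1) (restrictPast ω) ∂ν := by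
  have := hν.1
  have hQ := continuous_Qf hβ hs A
  have hm : ∀ a, Measurable fun p => Qf β h A (consP a p) := fun a =>
    (hQ.comp (continuous_consP a)).measurable
  conv_lhs => rw [← hν.2.1]
  have hsm : AEStronglyMeasurable (fun ω => Qf β h A (restrictPast ω)) (ν.map shiftSeq) :=
    (hQ.comp continuous_restrictPast).measurable.aestronglyMeasurable
  rw [integral_map measurable_shiftSeq.aemeasurable hsm]
  have h1 := fun a => integral_gMeasure_mul hν a (hm a) (fun _ => Qf_nonneg) (fun _ => Qf_le_one)
  have e1 : ∀ ω : ZSeq Bool, Qf β h A (restrictPast (shiftSeq ω)) =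
      Qf β h A (consP true (restrictPast ω)) *
        Set.indicator {ω : ZSeq Bool | ω 0 = true} (fun _ => (1 : ℝ)) ω +
      Qf β h A (consP false (restrictPast ω)) *
        Set.indicator {ω : ZSeq Bool | ω 0 = false} (fun _ => (1 : ℝ)) ω := by
    intro ω
    rw [restrictPast_shiftSeq]
    rcases Bool.eq_false_or_eq_true (ω 0) with hb | hb <;> simp [hb]
  have e2 : ∀ ω : ZSeq Bool, Qf β h (shiftA A 1) (restrictPast ω) =
      Qf β h A (consP true (restrictPast ω)) * gP β h true (restrictPast ω) +
      Qf β h A (consP false (restrictPast ω)) * gP β h false (restrictPast ω) := by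
    intro ω
    rw [← gP_cons hβ hs]
    ring
  simp_rw [e1, e2]
  have hi1 : ∀ a, Integrable (fun ω : ZSeq Bool => Qf β h A (consP a (restrictPast ω)) *
        Set.indicator {ω : ZSeq Bool | ω 0 = a} (fun _ => (1 : ℝ)) ω) ν := fun a =>
    integrable_of_bdd (((hm a).comp measurable_restrictPast).mul
      (measurable_const.indicator (measurableSet_origin a)))
      (fun ω => mul_nonneg Qf_nonneg (Set.indicator_nonneg (by simp) _))
      (fun ω => mul_le_one₀ Qf_le_one (Set.indicator_nonneg (by simp) _) (Set.indicator_le_self' (by simp) _))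
  have hi2 : ∀ a, Integrable (fun ω : ZSeq Bool => Qf β h A (consP a (restrictPast ω)) *
        gP β h a (restrictPast ω)) ν := fun a =>
    integrable_of_bdd (((hm a).comp measurable_restrictPast).mul
      ((gP_continuous hβ hs a).measurable.comp measurable_restrictPast))
      (fun ω => mul_nonneg Qf_nonneg (gP_nonneg _ _))
      (fun ω => mul_le_one₀ Qf_le_one (gP_nonneg _ _) (gP_le_one _ _))
  rw [integral_add (hi1 true) (hi1 false), integral_add (hi2 true) (hi2 false), h1 true, h1 false]

lemma shiftA_shiftA (A : Finset ℤ) (k l : ℤ) : shiftA (shiftA A k) l = shiftA A (k + l) := by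
  unfold shiftA
  rw [Finset.image_image]
  exact congrArg (Finset.image · A) (funext fun x => add_assoc x k l)

lemma shiftA_zero (A : Finset ℤ) : shiftA A 0 = A := by simp [shiftA]

/-- The event that the symbols on `A` are all `+1`. -/
def plusOn (A : Finset ℤ) : Set (ZSeq Bool) := {ω | ∀ i ∈ A, ω i = true}

lemma plusOn_step (hν : ν.map shiftSeq = ν) (A : Finset ℤ) : ν (plusOn (shiftA A 1)) = ν (plusOn A) := by
  conv_rhs => rw [← hν]
  have hm : MeasurableSet (plusOn A) := measurableSet_cyl A fun _ => true
  rw [Measure.map_apply measurable_shiftSeq hm]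
  congr 1
  ext ω
  simp only [plusOn, shiftA, shiftSeq, Set.preimage_ofPred_eq, Set.mem_ofPred_eq, Finset.mem_image,
    forall_exists_index, and_imp, forall_apply_eq_imp_iff₂]

lemma eq_of_shift_one {X : Type*} {f : Finset ℤ → X} (hf : ∀ A, f (shiftA A 1) = f A) (A : Finset ℤ) (n : ℕ) :
    f (shiftA A n) = f A := by
  induction n with
  | zero => rw [Nat.cast_zero, shiftA_zero]
  | succ n ih => rw [Nat.cast_succ, ← shiftA_shiftA, hf, ih]

lemma Qf_osc (hβ : 0 ≤ β) (A : Finset ℤ) (r : ℕ) (hA : ∀ i ∈ A, (r : ℤ) < i) (p p' : Past Bool) :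
    |Qf β h A p - Qf β h A p'| ≤ A.card * Dr β h r := by
  classical
  obtain ⟨n, hn⟩ : ∃ n : ℕ, ∀ i ∈ A, i + r ≤ n := by
    refine ⟨(∑ i ∈ A, (i + r)).toNat, fun i hi => ?_⟩
    have := Finset.single_le_sum (f := fun i : ℤ => i + r) (fun j hj => by have := hA j hj; omega) hi
    omega
  set U := boxOff slit n
  have hdd : dd β h ∅ U (LI A) (fun _ => true) ≤ A.card * Dr β h r := by
    refine (dd_indA_le hβ _).trans ?_
    rw [Finset.sum_image (by intro a _ b _ hab; simpa using hab), ← nsmul_eq_mul]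
    refine Finset.sum_le_card_nsmul _ _ _ fun i hi => dd_ind_le_Dr hβ ?_
    rintro ⟨a, b⟩ hx
    rw [mem_boxAt] at hx
    have h1 := hA i hi
    have h2 := hn i hi
    simp only [U, mem_boxOff, mem_box, mem_slit, abs_le] at hx ⊢
    omega
  have hlo : ∀ q, ev β h U (LI A) (fun _ => false) ≤ Qf β h A q := fun q =>
    (ev_mono_bd hβ (LI_mono A) (LI_nonneg A) (fun _ => Bool.false_le _)).trans (le_Qf hβ n)
  have hhi : ∀ q, Qf β h A q ≤ ev β h U (LI A) (fun _ => true) := fun q =>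
    (Qf_le n).trans (ev_mono_bd hβ (LI_mono A) (LI_nonneg A) (fun _ => Bool.le_true _))
  unfold dd at hdd
  rw [topOn_empty, botOn_empty] at hdd
  have := hlo p; have := hlo p'; have := hhi p; have := hhi p'
  rw [abs_le]
  constructor <;> linarith

lemma gMeasure_plusOn (hβ : 0 ≤ β) (hs : Summable (Dr β h)) (hν : IsGMeasure ν (gP β h)) (A : Finset ℤ)
    {m : ℕ} (hm : ∀ i ∈ A, i < m) (n : ℕ) :
    (ν (plusOn A)).toReal = ∫ ω, Qf β h (shiftA A n) (restrictPast ω) ∂ν := by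
  classical
  have := hν.1
  set B := shiftA A (-m) with hB
  have hBneg : ∀ i ∈ B, i < 0 := by
    intro i hi
    obtain ⟨j, hj, rfl⟩ := Finset.mem_image.1 hi
    have := hm j hj
    omega
  have hA : A = shiftA B m := by rw [hB, shiftA_shiftA, neg_add_cancel, shiftA_zero]
  have hI := fun A n => eq_of_shift_one (f := fun A => ∫ ω, Qf β h A (restrictPast ω) ∂ν)
    (fun A => (integral_Qf_step hβ hs hν A).symm) A n
  rw [hI A n]
  rw [hA]
  rw [hI B m, eq_of_shift_one (f := fun A => ν (plusOn A)) (plusOn_step hν.2.1) B m]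
  have hQ : ∀ ω : ZSeq Bool, Qf β h B (restrictPast ω) = (plusOn B).indicator 1 ω := by
    intro ω
    have h1 : ∀ n, ev β h (boxOff slit n) (LI B) (emb (restrictPast ω)) = LI B (emb (restrictPast ω)) :=
      fun n => ev_of_const fun η hη => LI_eq_of_agr hBneg hη
    unfold Qf
    simp_rw [h1]
    rw [ciInf_const, LI_apply, Set.indicator_apply]
    congr 1
    refine propext ⟨fun hh i hi => ?_, fun hh i hi => ?_⟩
    all_goals
      have h2 := hBneg i hi
      have h3 := hh i hi
      have h4 : -(((i.natAbs - 1 : ℕ) : ℤ) + 1) = i := by omega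
      simp only [emb, true_and, h2, if_true, restrictPast, h4] at h3 ⊢
      exact h3
  simp_rw [hQ]
  have hmB : MeasurableSet (plusOn B) := measurableSet_cyl B fun _ => true
  rw [integral_indicator_one hmB]
  rfl

lemma gMeasure_unique (hβ : 0 ≤ β) (hs : Summable (Dr β h)) (hν : IsGMeasure ν (gP β h))
    (hν' : IsGMeasure ν' (gP β h)) : ν = ν' := by
  classical
  have := hν.1
  have := hν'.1
  refine measure_ext_of_plus _ _ fun A => ?_
  change ν (plusOn A) = ν' (plusOn A)
  rw [← ENNReal.toReal_eq_toReal_iff' (measure_ne_top _ _) (measure_ne_top _ _)]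
  obtain ⟨m, hm⟩ : ∃ m : ℕ, ∀ i ∈ A, |i| < m := by
    refine ⟨(∑ i ∈ A, |i|).toNat + 1, fun i hi => ?_⟩
    have := Finset.single_le_sum (f := fun i : ℤ => |i|) (fun j _ => abs_nonneg j) hi
    push_cast
    omega
  have hm' : ∀ i ∈ A, i < m := fun i hi => (le_abs_self i).trans_lt (hm i hi)
  have hbd : ∀ r : ℕ, |(ν (plusOn A)).toReal - (ν' (plusOn A)).toReal| ≤ 2 * (A.card * Dr β h r) := by
    intro r
    set B := shiftA A ((m + r : ℕ) : ℤ) with hB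
    have hosc : ∀ p p' : Past Bool, |Qf β h B p - Qf β h B p'| ≤ A.card * Dr β h r := by
      intro p p'
      refine (Qf_osc hβ B r ?_ p p').trans ?_
      · intro i hi
        obtain ⟨j, hj, rfl⟩ := Finset.mem_image.1 hi
        have := abs_lt.1 (hm j hj)
        push_cast
        omega
      · exact mul_le_mul_of_nonneg_right (by exact_mod_cast Finset.card_image_le) (Dr_nonneg hβ r)
    set c := Qf β h B fun _ => true
    have hone : ∀ {ρ : Measure (ZSeq Bool)}, IsGMeasure ρ (gP β h) →
        |(ρ (plusOn A)).toReal - c| ≤ A.card * Dr β h r := by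
      intro ρ hρ
      have := hρ.1
      rw [gMeasure_plusOn hβ hs hρ A hm' (m + r), ← hB]
      have e : ∫ ω, Qf β h B (restrictPast ω) ∂ρ - c = ∫ ω, (Qf β h B (restrictPast ω) - c) ∂ρ := by
        rw [integral_sub]
        · simp
        · exact integrable_of_bdd ((continuous_Qf hβ hs B).comp continuous_restrictPast).measurable
            (fun _ => Qf_nonneg) fun _ => Qf_le_one
        · exact integrable_const _
      rw [e, ← Real.norm_eq_abs]
      refine (norm_integral_le_of_norm_le_const (Eventually.of_forall fun ω => hosc _ _)).trans ?_
      simp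
    have h1 := abs_le.1 (hone hν)
    have h2 := abs_le.1 (hone hν')
    rw [abs_le]
    constructor <;> linarith
  have hlim : Tendsto (fun r => 2 * ((A.card : ℝ) * Dr β h r)) atTop (𝓝 0) := by
    have := (hs.tendsto_atTop_zero.const_mul (A.card : ℝ)).const_mul 2
    simpa using this
  exact sub_eq_zero.1 (abs_eq_zero.1 (le_antisymm (ge_of_tendsto' hlim hbd) (abs_nonneg _)))

end

/-- The projection of the plus phase is a regular g-measure once the boundary influence is summable. -/
theorem regular_of_summable_influence {β h : ℝ} (hβ : 0 ≤ β) (hs : Summable (Dr β h))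
    (μp : Measure Cfg2) (hμp : IsPlusPhase β h μp) :
    ∃ P : Bool → Past Bool → ℝ,
      IsGFunction P ∧ (∀ a, Continuous (P a)) ∧ (∀ a ω, P a ω ∈ Set.Ioo (0 : ℝ) 1) ∧
      IsGMeasure (schonmann μp) P ∧
      Summable (fun k : ℕ => varG P (k + 1)) ∧
      ∀ ν : Measure (ZSeq Bool), IsGMeasure ν P → ν = schonmann μp := by
  have hG := schonmann_isGMeasure hβ hs hμp
  refine ⟨gP β h, ⟨fun a => (gP_continuous hβ hs a).measurable, fun ω => ⟨?_, fun a => ⟨gP_nonneg a ω, gP_le_one a ω⟩⟩⟩,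
    gP_continuous hβ hs, fun a ω => ?_, hG, summable_varG hβ hs, fun ν hν => gMeasure_unique hβ hs hν hG⟩
  · simp [gP]
  · have h1 := Qf_zero_bounds (h := h) (ω := ω) hβ
    have h2 := eps1_pos β h
    cases a <;> simp only [gP, Set.mem_Ioo, if_true, Bool.false_eq_true, if_false] <;> constructor <;> linarith

end

noncomputable section

set_option linter.unusedSectionVars false

section Cone
variable {S : Type*} [Fintype S]

/-- Functions whose pairing with every element of `M` is nonnegative. -/
def PosOn (M : Set (S → ℝ)) (F : S → ℝ) : Prop := ∀ m ∈ M, 0 ≤ ∑ s, F s * m s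

lemma PosOn.mul_exp {M : Set (S → ℝ)} (hM : ∀ a ∈ M, ∀ b ∈ M, (fun s => a s * b s) ∈ M) {F : S → ℝ}
    (hF : PosOn M F) {a : S → ℝ} (ha : a ∈ M) {c : ℝ} (hc : 0 ≤ c) :
    PosOn M fun s => F s * Real.exp (c * a s) := by
  intro m hm
  have hpow : ∀ n : ℕ, (fun s => m s * a s ^ n) ∈ M := by
    intro n
    induction n with
    | zero => simpa using hm
    | succ n ih =>
      have := hM _ ih _ ha
      simpa [pow_succ, mul_assoc] using this
  have hs : HasSum (fun n : ℕ => ∑ s, F s * m s * ((c * a s) ^ n / n.factorial))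
      (∑ s, F s * m s * Real.exp (c * a s)) := by
    refine hasSum_sum fun s _ => HasSum.mul_left _ ?_
    rw [Real.exp_eq_exp_ℝ]
    exact NormedSpace.expSeries_div_hasSum_exp (c * a s)
  have h0 : 0 ≤ ∑ s, F s * m s * Real.exp (c * a s) := by
    refine hs.nonneg fun n => ?_
    have : ∑ s, F s * m s * ((c * a s) ^ n / n.factorial)
        = c ^ n / n.factorial * ∑ s, F s * (m s * a s ^ n) := by
      rw [Finset.mul_sum]
      exact Finset.sum_congr rfl fun s _ => by rw [mul_pow]; ring
    rw [this]
    exact mul_nonneg (by positivity) (hF _ (hpow n))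
  calc 0 ≤ _ := h0
    _ = _ := Finset.sum_congr rfl fun s _ => by ring

lemma PosOn.exp_sum {M : Set (S → ℝ)} (hM : ∀ a ∈ M, ∀ b ∈ M, (fun s => a s * b s) ∈ M)
    (h1 : PosOn M fun _ => 1) {ι : Type*} (t : Finset ι) (c : ι → ℝ) (a : ι → S → ℝ)
    (hc : ∀ i ∈ t, 0 ≤ c i) (ha : ∀ i ∈ t, a i ∈ M) :
    PosOn M fun s => Real.exp (∑ i ∈ t, c i * a i s) := by
  classical
  induction t using Finset.induction_on with
  | empty => simpa using h1
  | insert i t hi ih =>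
    have h2 := (ih (fun j hj => hc j (Finset.mem_insert_of_mem hj))
      (fun j hj => ha j (Finset.mem_insert_of_mem hj))).mul_exp hM (ha i (Finset.mem_insert_self _ _))
      (hc i (Finset.mem_insert_self _ _))
    refine fun m hm => ?_
    refine (h2 m hm).trans_eq (Finset.sum_congr rfl fun s _ => ?_)
    dsimp only
    rw [Finset.sum_insert hi, Real.exp_add]
    ring

end Cone

section Products
variable {V Q : Type*} [Fintype V] [DecidableEq V] [Fintype Q]

lemma sum_prod_site (φ : V → Q → ℝ) : ∑ s : V → Q, ∏ x, φ x (s x) = ∏ x, ∑ q, φ x q := by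
  classical
  rw [Finset.prod_univ_sum, Fintype.piFinset_univ]

/-- Products of one-site functions taken from a class. -/
def siteProd (T : Set (Q → ℝ)) : Set ((V → Q) → ℝ) :=
  {F | ∃ φ : V → Q → ℝ, (∀ x, φ x ∈ T) ∧ F = fun s => ∏ x, φ x (s x)}

variable {T : Set (Q → ℝ)}

lemma siteProd_mul (hT : ∀ a ∈ T, ∀ b ∈ T, (fun q => a q * b q) ∈ T) :
    ∀ a ∈ siteProd (V := V) T, ∀ b ∈ siteProd (V := V) T, (fun s => a s * b s) ∈ siteProd (V := V) T := by
  rintro _ ⟨φ, hφ, rfl⟩ _ ⟨ψ, hψ, rfl⟩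
  refine ⟨fun x q => φ x q * ψ x q, fun x => hT _ (hφ x) _ (hψ x), ?_⟩
  funext s
  rw [Finset.prod_mul_distrib]

lemma siteProd_pos (h0 : ∀ a ∈ T, 0 ≤ ∑ q, a q) : PosOn (siteProd (V := V) T) fun _ => 1 := by
  rintro _ ⟨φ, hφ, rfl⟩
  simp only [one_mul]
  rw [sum_prod_site]
  exact Finset.prod_nonneg fun x _ => h0 _ (hφ x)

lemma siteProd_single (h1 : (fun _ => 1) ∈ T) (x : V) {a : Q → ℝ} (ha : a ∈ T) :
    (fun s : V → Q => a (s x)) ∈ siteProd (V := V) T := by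
  refine ⟨fun y q => if y = x then a q else 1, fun y => ?_, ?_⟩
  · by_cases hy : y = x
    · simpa [hy] using ha
    · simpa [hy] using h1
  · funext s
    rw [Finset.prod_ite_eq' Finset.univ x fun y => a (s y)]
    simp

lemma siteProd_pair (hT : ∀ a ∈ T, ∀ b ∈ T, (fun q => a q * b q) ∈ T) (h1 : (fun _ => 1) ∈ T)
    (x y : V) {a b : Q → ℝ} (ha : a ∈ T) (hb : b ∈ T) :
    (fun s : V → Q => a (s x) * b (s y)) ∈ siteProd (V := V) T :=
  siteProd_mul hT _ (siteProd_single h1 x ha) _ (siteProd_single h1 y hb)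

end Products

section Ising
variable {V : Type*} [Fintype V]

/-- Minus the energy of a spin configuration for couplings `J` and fields `b`. -/
def engJ (J : V → V → ℝ) (b : V → ℝ) (s : V → Bool) : ℝ :=
  ∑ x, ∑ y, J x y * (sval (s x) * sval (s y)) + ∑ x, b x * sval (s x)

/-- Partition function. -/
def ZJ [DecidableEq V] (J : V → V → ℝ) (b : V → ℝ) : ℝ := ∑ s : V → Bool, Real.exp (engJ J b s)

/-- Gibbs expectation. -/
def exJ [DecidableEq V] (J : V → V → ℝ) (b : V → ℝ) (f : (V → Bool) → ℝ) : ℝ :=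
  (∑ s : V → Bool, f s * Real.exp (engJ J b s)) / ZJ J b

/-- Truncated two-point function. -/
def covJ [DecidableEq V] (J : V → V → ℝ) (b : V → ℝ) (x y : V) : ℝ :=
  exJ J b (fun s => sval (s x) * sval (s y)) - exJ J b (fun s => sval (s x)) * exJ J b (fun s => sval (s y))

variable [DecidableEq V]

lemma ZJ_pos (J : V → V → ℝ) (b : V → ℝ) : 0 < ZJ J b :=
  Finset.sum_pos (fun _ _ => Real.exp_pos _) Finset.univ_nonempty

/-- One-site monomials for four copies of the spins in rotated coordinates. -/
def rot (i : Fin 4) (q : Bool × Bool × Bool × Bool) : ℝ :=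
  ![(sval q.1 + sval q.2.1 + sval q.2.2.1 + sval q.2.2.2) / 2,
    (sval q.1 + sval q.2.1 - sval q.2.2.1 - sval q.2.2.2) / 2,
    (sval q.1 - sval q.2.1 + sval q.2.2.1 - sval q.2.2.2) / 2,
    (-sval q.1 + sval q.2.1 + sval q.2.2.1 - sval q.2.2.2) / 2] i

/-- The class of one-site monomials in the rotated coordinates. -/
def rotMon : Set (Bool × Bool × Bool × Bool → ℝ) :=
  Set.range fun k : Fin 4 → ℕ => fun q => ∏ i, rot i q ^ k i

lemma rotMon_mul : ∀ a ∈ rotMon, ∀ b ∈ rotMon, (fun q => a q * b q) ∈ rotMon := by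
  rintro _ ⟨k, rfl⟩ _ ⟨l, rfl⟩
  refine ⟨k + l, ?_⟩
  funext q
  simp only [Pi.add_apply, pow_add, Finset.prod_mul_distrib]

lemma rotMon_one : (fun _ => (1 : ℝ)) ∈ rotMon := ⟨0, by funext q; simp⟩

lemma rotMon_rot (i : Fin 4) : rot i ∈ rotMon := by
  refine ⟨Pi.single i 1, ?_⟩
  funext q
  dsimp only
  rw [Finset.prod_eq_single i]
  · simp
  · intro j _ hj; simp [hj]
  · simp

lemma rotMon_sum : ∀ a ∈ rotMon, 0 ≤ ∑ q, a q := by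
  rintro _ ⟨k, rfl⟩
  simp only [Fin.prod_univ_four, Fintype.sum_prod_type, Fintype.sum_bool, rot, sval_true, sval_false,
    Matrix.cons_val]
  norm_num
  have h2 : ∀ n : ℕ, (-2 : ℝ) ^ n = (-1) ^ n * 2 ^ n := fun n => by rw [← mul_pow]; norm_num
  simp only [h2]
  have hz : ∀ n : ℕ, (0 : ℝ) ≤ 0 ^ n := fun n => pow_nonneg le_rfl n
  have ht : ∀ n : ℕ, (0 : ℝ) ≤ 2 ^ n := fun n => pow_nonneg (by norm_num) n
  have m0 := mul_nonneg (mul_nonneg (mul_nonneg (ht (k 0)) (hz (k 1))) (hz (k 2))) (hz (k 3))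
  have m1 := mul_nonneg (mul_nonneg (mul_nonneg (hz (k 0)) (ht (k 1))) (hz (k 2))) (hz (k 3))
  have m2 := mul_nonneg (mul_nonneg (mul_nonneg (hz (k 0)) (hz (k 1))) (ht (k 2))) (hz (k 3))
  have m3 := mul_nonneg (mul_nonneg (mul_nonneg (hz (k 0)) (hz (k 1))) (hz (k 2))) (ht (k 3))
  rcases neg_one_pow_eq_or ℝ (k 0) with e0 | e0 <;> rcases neg_one_pow_eq_or ℝ (k 1) with e1 | e1 <;>
  rcases neg_one_pow_eq_or ℝ (k 2) with e2 | e2 <;> rcases neg_one_pow_eq_or ℝ (k 3) with e3 | e3 <;>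
  rw [e0, e1, e2, e3] <;> linarith

end Ising

end

noncomputable section

set_option linter.unusedSectionVars false

section Quadruple
variable {S : Type*} [Fintype S]

lemma sum_four_prod (p q r t : S → ℝ) :
    ∑ a, ∑ b, ∑ c, ∑ d, p a * q b * r c * t d = (∑ a, p a) * (∑ b, q b) * (∑ c, r c) * ∑ d, t d := by
  simp only [← Finset.sum_mul, ← Finset.mul_sum]

/-- Duplicate-variable expansion of a difference of covariances. -/
lemma sum_four_cov (w v f g : S → ℝ) :
    ∑ a, ∑ b, ∑ c, ∑ d, ((f a - f b + f c - f d) * (-g a + g b + g c - g d)) * (w a * w b * v c * v d)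
      = 2 * ((∑ a, f a * g a * v a) * (∑ a, v a) - (∑ a, f a * v a) * (∑ a, g a * v a)) * (∑ a, w a) ^ 2
        - 2 * ((∑ a, f a * g a * w a) * (∑ a, w a) - (∑ a, f a * w a) * (∑ a, g a * w a)) * (∑ a, v a) ^ 2 := by
  have key : ∀ a b c d, ((f a - f b + f c - f d) * (-g a + g b + g c - g d)) * (w a * w b * v c * v d) =
      -((f a * g a * w a) * w b * v c * v d) + (f a * w a) * (g b * w b) * v c * v d
      + (f a * w a) * w b * (g c * v c) * v d - (f a * w a) * w b * v c * (g d * v d)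
      + (g a * w a) * (f b * w b) * v c * v d - w a * (f b * g b * w b) * v c * v d
      - w a * (f b * w b) * (g c * v c) * v d + w a * (f b * w b) * v c * (g d * v d)
      - (g a * w a) * w b * (f c * v c) * v d + w a * (g b * w b) * (f c * v c) * v d
      + w a * w b * (f c * g c * v c) * v d - w a * w b * (f c * v c) * (g d * v d)
      + (g a * w a) * w b * v c * (f d * v d) - w a * (g b * w b) * v c * (f d * v d)
      - w a * w b * (g c * v c) * (f d * v d) + w a * w b * v c * (f d * g d * v d) := by
    intros; ring
  simp only [key, Finset.sum_add_distrib, Finset.sum_sub_distrib, Finset.sum_neg_distrib]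
  rw [sum_four_prod (fun a => f a * g a * w a) w v v,
    sum_four_prod (fun a => f a * w a) (fun a => g a * w a) v v,
    sum_four_prod (fun a => f a * w a) w (fun a => g a * v a) v,
    sum_four_prod (fun a => f a * w a) w v (fun a => g a * v a),
    sum_four_prod (fun a => g a * w a) (fun a => f a * w a) v v,
    sum_four_prod w (fun a => f a * g a * w a) v v,
    sum_four_prod w (fun a => f a * w a) (fun a => g a * v a) v,
    sum_four_prod w (fun a => f a * w a) v (fun a => g a * v a),
    sum_four_prod (fun a => g a * w a) w (fun a => f a * v a) v,
    sum_four_prod w (fun a => g a * w a) (fun a => f a * v a) v,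
    sum_four_prod w w (fun a => f a * g a * v a) v,
    sum_four_prod w w (fun a => f a * v a) (fun a => g a * v a),
    sum_four_prod (fun a => g a * w a) w v (fun a => f a * v a),
    sum_four_prod w (fun a => g a * w a) v (fun a => f a * v a),
    sum_four_prod w w (fun a => g a * v a) (fun a => f a * v a),
    sum_four_prod w w v (fun a => f a * g a * v a)]
  ring

end Quadruple

section EllisMonroe
variable {V : Type*} [Fintype V] [DecidableEq V]

lemma sum_quad (F : (V → Bool) → (V → Bool) → (V → Bool) → (V → Bool) → ℝ) :
    ∑ s : V → Bool × Bool × Bool × Bool, F (fun x => (s x).1) (fun x => (s x).2.1)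
      (fun x => (s x).2.2.1) (fun x => (s x).2.2.2) = ∑ a, ∑ b, ∑ c, ∑ d, F a b c d := by
  let e : (V → Bool × Bool × Bool × Bool) ≃ (V → Bool) × (V → Bool) × (V → Bool) × (V → Bool) :=
    { toFun := fun s => (fun x => (s x).1, fun x => (s x).2.1, fun x => (s x).2.2.1, fun x => (s x).2.2.2)
      invFun := fun p x => (p.1 x, p.2.1 x, p.2.2.1 x, p.2.2.2 x)
      left_inv := fun s => rfl
      right_inv := fun p => rfl }
  refine (Fintype.sum_equiv e _ (fun p => F p.1 p.2.1 p.2.2.1 p.2.2.2) (fun s => rfl)).trans ?_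
  simp only [Fintype.sum_prod_type]

lemma covJ_eq (J : V → V → ℝ) (b : V → ℝ) (x y : V) :
    covJ J b x y * ZJ J b ^ 2 =
      (∑ s : V → Bool, sval (s x) * sval (s y) * Real.exp (engJ J b s)) * (∑ s : V → Bool, Real.exp (engJ J b s))
      - (∑ s : V → Bool, sval (s x) * Real.exp (engJ J b s)) * ∑ s : V → Bool, sval (s y) * Real.exp (engJ J b s) := by
  have h := (ZJ_pos J b).ne'
  have e : (∑ s : V → Bool, Real.exp (engJ J b s)) = ZJ J b := rfl
  unfold covJ exJ
  rw [e]
  field_simp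

/-- The correlation inequality of Ellis and Monroe, in comparison form. -/
theorem covJ_anti {J : V → V → ℝ} (hJ : ∀ x y, 0 ≤ J x y) {a b : V → ℝ} (hab : ∀ x, |b x| ≤ a x) (x y : V) :
    covJ J a x y ≤ covJ J b x y := by
  have hP : PosOn (siteProd (V := V) rotMon) fun s =>
      Real.exp (∑ i : (V × V × Fin 4) ⊕ (V × Bool),
        (Sum.elim (fun i => J i.1 i.2.1) (fun i => if i.2 then a i.1 + b i.1 else a i.1 - b i.1) i : ℝ) *
        (Sum.elim (fun i s => rot i.2.2 (s i.1) * rot i.2.2 (s i.2.1))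
          (fun i s => if i.2 then rot 0 (s i.1) else rot 1 (s i.1)) i : (V → Bool × Bool × Bool × Bool) → ℝ) s) := by
    refine PosOn.exp_sum (siteProd_mul rotMon_mul) (siteProd_pos rotMon_sum) _ _ _ ?_ ?_
    · rintro (i | ⟨i, j⟩) -
      · exact hJ _ _
      · have := abs_le.1 (hab i)
        cases j <;> simp <;> linarith
    · rintro (i | ⟨i, j⟩) -
      · exact siteProd_pair rotMon_mul rotMon_one _ _ (rotMon_rot _) (rotMon_rot _)
      · cases j
        · simpa using siteProd_single rotMon_one i (rotMon_rot 1)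
        · simpa using siteProd_single rotMon_one i (rotMon_rot 0)
  have h1 := hP _ (siteProd_pair rotMon_mul rotMon_one x y (rotMon_rot 2) (rotMon_rot 3))
  have h2 : ∀ s : V → Bool × Bool × Bool × Bool, Real.exp (∑ i : (V × V × Fin 4) ⊕ (V × Bool),
        (Sum.elim (fun i => J i.1 i.2.1) (fun i => if i.2 then a i.1 + b i.1 else a i.1 - b i.1) i : ℝ) *
        (Sum.elim (fun i s => rot i.2.2 (s i.1) * rot i.2.2 (s i.2.1))
          (fun i s => if i.2 then rot 0 (s i.1) else rot 1 (s i.1)) i : (V → Bool × Bool × Bool × Bool) → ℝ) s)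
      = Real.exp (engJ J a fun x => (s x).1) * Real.exp (engJ J a fun x => (s x).2.1) *
        Real.exp (engJ J b fun x => (s x).2.2.1) * Real.exp (engJ J b fun x => (s x).2.2.2) := by
    intro s
    rw [← Real.exp_add, ← Real.exp_add, ← Real.exp_add]
    congr 1
    rw [Fintype.sum_sum_type]
    simp only [Sum.elim_inl, Sum.elim_inr, Fintype.sum_prod_type, Fin.sum_univ_four, Fintype.sum_bool, engJ]
    have e1 : ∀ p q r t p' q' r' t' : ℝ, (p + q) + (p' + q') + (r + r') + (t + t') =
        (p + p' + r + t) + (q + q' + r' + t') := by intros; ring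
    rw [e1]
    simp only [← Finset.sum_add_distrib]
    refine Finset.sum_congr rfl fun i _ => ?_
    refine congrArg₂ (fun u v : ℝ => u + v) (Finset.sum_congr rfl fun j _ => ?_) ?_
    · simp only [rot, Matrix.cons_val]
      ring
    · simp only [rot, Matrix.cons_val]
      simp
      ring
  simp only [h2] at h1
  have h3 := sum_four_cov (fun s : V → Bool => Real.exp (engJ J a s)) (fun s => Real.exp (engJ J b s))
    (fun s => sval (s x)) (fun s => sval (s y))
  rw [← sum_quad (fun p q r t => _)] at h3
  have h4 : 0 ≤ 2 * (covJ J b x y * ZJ J b ^ 2) * ZJ J a ^ 2 - 2 * (covJ J a x y * ZJ J a ^ 2) * ZJ J b ^ 2 := by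
    rw [covJ_eq, covJ_eq]
    refine le_trans ?_ h3.le
    refine le_trans (mul_nonneg (by norm_num : (0 : ℝ) ≤ 4) h1) (le_of_eq ?_)
    rw [Finset.mul_sum]
    refine Finset.sum_congr rfl fun s _ => ?_
    simp only [rot, Matrix.cons_val]
    ring
  have hz : 0 < ZJ J a ^ 2 * ZJ J b ^ 2 := by have := ZJ_pos J a; have := ZJ_pos J b; positivity
  nlinarith

end EllisMonroe

end

noncomputable section

set_option linter.unusedSectionVars false

section Griffiths
variable {V : Type*} [Fintype V] [DecidableEq V]

/-- Powers of the spin at one site. -/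
def spinMon : Set (Bool → ℝ) := Set.range fun k : ℕ => fun q => sval q ^ k

lemma spinMon_mul : ∀ a ∈ spinMon, ∀ b ∈ spinMon, (fun q => a q * b q) ∈ spinMon := by
  rintro _ ⟨k, rfl⟩ _ ⟨l, rfl⟩
  exact ⟨k + l, by funext q; simp only [pow_add]⟩

lemma spinMon_one : (fun _ => (1 : ℝ)) ∈ spinMon := ⟨0, by funext q; simp⟩

lemma spinMon_sval : sval ∈ spinMon := ⟨1, by funext q; simp⟩

lemma spinMon_sum : ∀ a ∈ spinMon, 0 ≤ ∑ q, a q := by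
  rintro _ ⟨k, rfl⟩
  simp only [Fintype.sum_bool, sval_true, sval_false, one_pow]
  rcases neg_one_pow_eq_or ℝ k with e | e <;> rw [e] <;> norm_num

/-- Griffiths' first inequality for two spins. -/
theorem griffiths_first {J : V → V → ℝ} (hJ : ∀ x y, 0 ≤ J x y) (x y : V) :
    0 ≤ ∑ s : V → Bool, sval (s x) * sval (s y) * Real.exp (engJ J 0 s) := by
  have hP := PosOn.exp_sum (siteProd_mul (V := V) spinMon_mul) (siteProd_pos spinMon_sum)
    (Finset.univ : Finset (V × V)) (fun i => J i.1 i.2) (fun i s => sval (s i.1) * sval (s i.2))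
    (fun i _ => hJ _ _) (fun i _ => siteProd_pair spinMon_mul spinMon_one _ _ spinMon_sval spinMon_sval)
  have := hP _ (siteProd_pair spinMon_mul spinMon_one x y spinMon_sval spinMon_sval)
  refine this.trans_eq (Finset.sum_congr rfl fun s _ => ?_)
  rw [mul_comm]
  congr 2
  simp [engJ, Fintype.sum_prod_type]

lemma exJ_pair_nonneg {J : V → V → ℝ} (hJ : ∀ x y, 0 ≤ J x y) (x y : V) :
    0 ≤ exJ J 0 (fun s => sval (s x) * sval (s y)) :=
  div_nonneg (griffiths_first hJ x y) (ZJ_pos J 0).le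

lemma sval_beq (a b : Bool) : sval (a == b) = sval a * sval b := by
  cases a <;> cases b <;> simp [sval]

/-- Pointwise product of spin configurations. -/
def spinMul (s : V → Bool) : (V → Bool) ≃ (V → Bool) where
  toFun t x := s x == t x
  invFun t x := s x == t x
  left_inv t := by funext x; dsimp only; cases s x <;> cases t x <;> rfl
  right_inv t := by funext x; dsimp only; cases s x <;> cases t x <;> rfl

lemma sval_spinMul (s t : V → Bool) (x : V) : sval (spinMul s t x) = sval (s x) * sval (t x) := sval_beq _ _

lemma sum_sum_sub_mul {S : Type*} [Fintype S] (f w v : S → ℝ) :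
    ∑ s, ∑ t, (f s - f t) * (w s * v t) = (∑ s, f s * w s) * (∑ t, v t) - (∑ s, w s) * ∑ t, f t * v t := by
  rw [Finset.sum_mul_sum, Finset.sum_mul_sum, ← Finset.sum_sub_distrib]
  refine Finset.sum_congr rfl fun s _ => ?_
  rw [← Finset.sum_sub_distrib]
  exact Finset.sum_congr rfl fun t _ => by ring

/-- Griffiths' second inequality: two-point functions increase with the couplings. -/
theorem exJ_pair_mono {J J' : V → V → ℝ} (hJ : ∀ x y, 0 ≤ J x y) (hJJ : ∀ x y, J x y ≤ J' x y) (x y : V) :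
    exJ J 0 (fun s => sval (s x) * sval (s y)) ≤ exJ J' 0 (fun s => sval (s x) * sval (s y)) := by
  have h1 : 0 ≤ ∑ s : V → Bool, ∑ t : V → Bool, (sval (s x) * sval (s y) - sval (t x) * sval (t y)) *
      (Real.exp (engJ J' 0 s) * Real.exp (engJ J 0 t)) := by
    have e : ∀ s : V → Bool, ∑ t : V → Bool, (sval (s x) * sval (s y) - sval (t x) * sval (t y)) *
        (Real.exp (engJ J' 0 s) * Real.exp (engJ J 0 t)) =
        ∑ t : V → Bool, (1 - sval (t x) * sval (t y)) * (sval (s x) * sval (s y) *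
          Real.exp (engJ (fun u v => J' u v + J u v * (sval (t u) * sval (t v))) 0 s)) := by
      intro s
      rw [← Equiv.sum_comp (spinMul s)]
      refine Finset.sum_congr rfl fun t _ => ?_
      rw [← Real.exp_add]
      have e2 : engJ J' 0 s + engJ J 0 (spinMul s t) =
          engJ (fun u v => J' u v + J u v * (sval (t u) * sval (t v))) 0 s := by
        simp only [engJ, sval_spinMul, Pi.zero_apply, zero_mul, Finset.sum_const_zero, add_zero,
          ← Finset.sum_add_distrib]
        refine Finset.sum_congr rfl fun u _ => Finset.sum_congr rfl fun v _ => ?_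
        ring
      rw [e2, sval_spinMul, sval_spinMul]
      ring
    simp only [e]
    rw [Finset.sum_comm]
    refine Finset.sum_nonneg fun t _ => ?_
    rw [← Finset.mul_sum]
    have ht : ∀ u v, sval (t u) * sval (t v) ≤ 1 ∧ -1 ≤ sval (t u) * sval (t v) := fun u v => by
      rw [← sval_beq]; exact ⟨sval_le_one _, neg_one_le_sval _⟩
    refine mul_nonneg (sub_nonneg.2 (ht x y).1) (griffiths_first (fun u v => ?_) x y)
    nlinarith [hJ u v, hJJ u v, (ht u v).2]
  have hz := ZJ_pos J (0 : V → ℝ)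
  have hz' := ZJ_pos J' (0 : V → ℝ)
  unfold exJ
  rw [div_le_div_iff₀ hz hz', ← sub_nonneg]
  refine h1.trans_eq ?_
  rw [sum_sum_sub_mul (fun s : V → Bool => sval (s x) * sval (s y))]
  unfold ZJ
  ring

lemma sum_comp_injective {V' : Type*} [Fintype V'] [DecidableEq V'] {e : V → V'} (he : Function.Injective e)
    (F : (V → Bool) → ℝ) :
    Fintype.card (V → Bool) * ∑ s : V' → Bool, F (s ∘ e) = Fintype.card (V' → Bool) * ∑ r : V → Bool, F r := by
  have h1 : ∀ r : V → Bool, ∑ s : V' → Bool, F (s ∘ e) = ∑ s : V' → Bool, F (spinMul (s ∘ e) r) := by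
    intro r
    rw [← Equiv.sum_comp (spinMul (Function.extend e r fun _ => true))]
    refine Finset.sum_congr rfl fun s _ => congrArg F ?_
    funext x
    simp only [spinMul, Equiv.coe_fn_mk, Function.comp, he.extend_apply]
    cases r x <;> cases s (e x) <;> rfl
  have h2 : ∑ r : V → Bool, ∑ s : V' → Bool, F (s ∘ e) = ∑ r : V → Bool, ∑ s : V' → Bool, F (spinMul (s ∘ e) r) :=
    Finset.sum_congr rfl fun r _ => h1 r
  rw [Finset.sum_comm (f := fun r s => F (spinMul (s ∘ e) r))] at h2
  simp only [Equiv.sum_comp, Finset.sum_const, Finset.card_univ, nsmul_eq_mul] at h2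
  exact h2

/-- Two-point functions increase when the graph is embedded into a larger one. -/
theorem exJ_pair_embed {V' : Type*} [Fintype V'] [DecidableEq V'] {e : V → V'} (he : Function.Injective e)
    {J : V → V → ℝ} {J' : V' → V' → ℝ} (hJ : ∀ x y, 0 ≤ J x y) (hJ' : ∀ x y, 0 ≤ J' x y)
    (hJJ : ∀ x y, J x y ≤ J' (e x) (e y)) (x y : V) :
    exJ J 0 (fun s => sval (s x) * sval (s y)) ≤ exJ J' 0 (fun s => sval (s (e x)) * sval (s (e y))) := by
  set K : V' → V' → ℝ := fun p q => ∑ u, ∑ v, if e u = p ∧ e v = q then J u v else 0 with hK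
  have hK0 : ∀ p q, 0 ≤ K p q := fun p q => Finset.sum_nonneg fun u _ => Finset.sum_nonneg fun v _ => by
    split_ifs
    · exact hJ _ _
    · exact le_rfl
  have hKe : ∀ u v, K (e u) (e v) = J u v := fun u v => by
    simp only [hK, he.eq_iff]
    rw [Finset.sum_eq_single u, Finset.sum_eq_single v]
    · simp
    · intro w _ hw; simp [hw]
    · simp
    · intro w _ hw; simp [hw]
    · simp
  have hKJ : ∀ p q, K p q ≤ J' p q := by
    intro p q
    by_cases hp : ∃ u v, e u = p ∧ e v = q
    · obtain ⟨u, v, rfl, rfl⟩ := hp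
      rw [hKe]; exact hJJ u v
    · push Not at hp
      refine le_trans (le_of_eq ?_) (hJ' p q)
      exact Finset.sum_eq_zero fun u _ => Finset.sum_eq_zero fun v _ => if_neg fun h => hp u v h.1 h.2
  refine le_trans (le_of_eq ?_) (exJ_pair_mono hK0 hKJ (e x) (e y))
  have heng : ∀ s : V' → Bool, engJ K 0 s = engJ J 0 (s ∘ e) := by
    intro s
    simp only [engJ, Pi.zero_apply, zero_mul, Finset.sum_const_zero, add_zero, hK, Finset.sum_mul, Function.comp]
    calc _ = ∑ p, ∑ u, ∑ q, ∑ v, (if e u = p ∧ e v = q then J u v else 0) * (sval (s p) * sval (s q)) :=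
          Finset.sum_congr rfl fun p _ => Finset.sum_comm
      _ = ∑ u, ∑ p, ∑ q, ∑ v, (if e u = p ∧ e v = q then J u v else 0) * (sval (s p) * sval (s q)) :=
          Finset.sum_comm
      _ = _ := by
          refine Finset.sum_congr rfl fun u _ => ?_
          rw [Finset.sum_eq_single (e u)]
          · rw [Finset.sum_comm]
            refine Finset.sum_congr rfl fun v _ => ?_
            rw [Finset.sum_eq_single (e v)]
            · simp
            · intro q _ hq; simp [hq.symm]
            · simp
          · intro p _ hp; simp [hp.symm]
          · simp
  have h1 := sum_comp_injective he fun r => sval (r x) * sval (r y) * Real.exp (engJ J 0 r)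
  have h2 := sum_comp_injective he fun r => Real.exp (engJ J 0 r)
  have hc : (0 : ℝ) < Fintype.card (V → Bool) := by exact_mod_cast Fintype.card_pos
  have hc' : (0 : ℝ) < Fintype.card (V' → Bool) := by exact_mod_cast Fintype.card_pos
  unfold exJ ZJ
  simp only [heng]
  have hz1 := (ZJ_pos J 0).ne'
  have hz2 := (ZJ_pos K 0).ne'
  unfold ZJ at hz1 hz2
  simp only [heng] at hz2
  rw [div_eq_div_iff hz1 hz2]
  simp only [Function.comp_apply] at h1
  refine mul_left_cancel₀ hc.ne' ?_
  calc _ = (∑ s : V → Bool, sval (s x) * sval (s y) * Real.exp (engJ J 0 s)) *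
        (Fintype.card (V → Bool) * ∑ s : V' → Bool, Real.exp (engJ J 0 (s ∘ e))) := by ring
    _ = _ := by
      have := congrArg (fun z => z * ∑ r : V → Bool, Real.exp (engJ J 0 r)) h1
      beta_reduce at this
      rw [h2]
      linarith

end Griffiths

end

noncomputable section

set_option linter.unusedSectionVars false

section Fields
variable {V : Type*} [Fintype V] [DecidableEq V] {J : V → V → ℝ}

lemma engJ_add_smul (b v : V → ℝ) (t : ℝ) (s : V → Bool) :
    engJ J (b + t • v) s = engJ J b s + t * ∑ x, v x * sval (s x) := by
  simp only [engJ, Pi.add_apply, Pi.smul_apply, smul_eq_mul, add_mul, Finset.sum_add_distrib, Finset.mul_sum]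
  have : ∀ x, t * v x * sval (s x) = t * (v x * sval (s x)) := fun x => mul_assoc _ _ _
  simp only [this]
  ring

lemma hasDerivAt_sum_exp (b v : V → ℝ) (f : (V → Bool) → ℝ) (t : ℝ) :
    HasDerivAt (fun t : ℝ => ∑ s, f s * Real.exp (engJ J (b + t • v) s))
      (∑ y, v y * ∑ s, f s * sval (s y) * Real.exp (engJ J (b + t • v) s)) t := by
  have h : ∀ s : V → Bool, HasDerivAt (fun t : ℝ => f s * Real.exp (engJ J (b + t • v) s))
      (f s * (Real.exp (engJ J (b + t • v) s) * ∑ x, v x * sval (s x))) t := by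
    intro s
    refine HasDerivAt.const_mul _ (HasDerivAt.exp ?_)
    simp only [engJ_add_smul]
    simpa using ((hasDerivAt_id t).mul_const (∑ x, v x * sval (s x))).const_add (engJ J b s)
  refine (HasDerivAt.fun_sum fun s _ => h s).congr_deriv ?_
  simp only [Finset.mul_sum]
  rw [Finset.sum_comm]
  exact Finset.sum_congr rfl fun y _ => Finset.sum_congr rfl fun s _ => by ring

lemma hasDerivAt_ZJ (b v : V → ℝ) (t : ℝ) :
    HasDerivAt (fun t : ℝ => ZJ J (b + t • v))
      (∑ y, v y * ∑ s, sval (s y) * Real.exp (engJ J (b + t • v) s)) t := by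
  simpa [ZJ] using hasDerivAt_sum_exp (J := J) b v (fun _ => 1) t

lemma hasDerivAt_log_ZJ (b v : V → ℝ) (t : ℝ) :
    HasDerivAt (fun t : ℝ => Real.log (ZJ J (b + t • v)))
      (∑ y, v y * exJ J (b + t • v) fun s => sval (s y)) t := by
  refine ((hasDerivAt_ZJ b v t).log (ZJ_pos J _).ne').congr_deriv ?_
  simp only [exJ]
  rw [Finset.sum_div]
  exact Finset.sum_congr rfl fun y _ => by ring

lemma hasDerivAt_exJ (b v : V → ℝ) (x : V) (t : ℝ) :
    HasDerivAt (fun t : ℝ => exJ J (b + t • v) fun s => sval (s x))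
      (∑ y, v y * covJ J (b + t • v) x y) t := by
  have hz := (ZJ_pos J (b + t • v)).ne'
  refine ((hasDerivAt_sum_exp b v (fun s => sval (s x)) t).div (hasDerivAt_ZJ b v t) hz).congr_deriv ?_
  rw [div_eq_iff (pow_ne_zero 2 hz), Finset.mul_sum _ _ (∑ s : V → Bool, sval (s x) * _), Finset.sum_mul,
    Finset.sum_mul, ← Finset.sum_sub_distrib]
  refine Finset.sum_congr rfl fun y _ => ?_
  rw [mul_assoc (v y) (covJ J (b + t • v) x y), covJ_eq]
  simp only [ZJ]
  ring

/-- Global spin flip. -/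
def spinNeg : (V → Bool) ≃ (V → Bool) where
  toFun s x := !s x
  invFun s x := !s x
  left_inv s := by funext x; simp
  right_inv s := by funext x; simp

lemma engJ_spinNeg (b : V → ℝ) (s : V → Bool) : engJ J b (spinNeg s) = engJ J (-b) s := by
  simp [engJ, spinNeg, sval_not]

lemma ZJ_neg (b : V → ℝ) : ZJ J (-b) = ZJ J b := by
  unfold ZJ
  rw [← Equiv.sum_comp spinNeg]
  simp only [engJ_spinNeg, neg_neg]

lemma exJ_neg (b : V → ℝ) (x : V) : exJ J (-b) (fun s => sval (s x)) = -exJ J b fun s => sval (s x) := by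
  unfold exJ
  rw [ZJ_neg, ← Equiv.sum_comp spinNeg, ← neg_div, ← Finset.sum_neg_distrib]
  simp only [engJ_spinNeg, neg_neg]
  congr 1
  refine Finset.sum_congr rfl fun s _ => ?_
  simp [spinNeg, sval_not]

lemma exJ_zero (x : V) : (exJ J 0 fun s => sval (s x)) = 0 := by
  have := exJ_neg (J := J) 0 x
  rw [neg_zero] at this
  linarith

lemma ZJ_le (c k : V → ℝ) (hk : ∀ x, 0 ≤ k x) : ZJ J (c + k) ≤ Real.exp (2 * ∑ x, k x) * ZJ J (c - k) := by
  unfold ZJ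
  rw [Finset.mul_sum]
  refine Finset.sum_le_sum fun s _ => ?_
  rw [← Real.exp_add, Real.exp_le_exp]
  simp only [engJ, Finset.mul_sum]
  have : ∑ x, (c + k) x * sval (s x) ≤ ∑ x, 2 * k x + ∑ x, (c - k) x * sval (s x) := by
    rw [← Finset.sum_add_distrib]
    refine Finset.sum_le_sum fun x _ => ?_
    simp only [Pi.add_apply, Pi.sub_apply]
    nlinarith [hk x, sval_le_one (s x)]
  linarith

/-- In a uniform field, the total influence of a boundary field is bounded by its total strength. -/
theorem sum_exJ_sub_le (hJ : ∀ x y, 0 ≤ J x y) {k : V → ℝ} (hk : ∀ x, 0 ≤ k x) {H : ℝ} (hH : 0 < H) :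
    H * ∑ x, (exJ J (k + H • 1) (fun s => sval (s x)) - exJ J (-k + H • 1) fun s => sval (s x)) ≤ 2 * ∑ x, k x := by
  set T : ℝ → ℝ := fun t => Real.log (ZJ J (k + t • 1)) - Real.log (ZJ J (-k + t • 1)) with hT
  set D : ℝ → ℝ := fun t => ∑ x, (exJ J (k + t • 1) (fun s => sval (s x)) - exJ J (-k + t • 1) fun s => sval (s x))
    with hD
  have hTD : ∀ t, HasDerivAt T (D t) t := fun t => by
    refine ((hasDerivAt_log_ZJ k 1 t).sub (hasDerivAt_log_ZJ (-k) 1 t)).congr_deriv ?_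
    simp [hD, Finset.sum_sub_distrib]
  have hDD : ∀ t, HasDerivAt D (∑ x, ((∑ y, (1 : V → ℝ) y * covJ J (k + t • 1) x y) -
      ∑ y, (1 : V → ℝ) y * covJ J (-k + t • 1) x y)) t := fun t =>
    HasDerivAt.fun_sum fun x _ => (hasDerivAt_exJ k 1 x t).sub (hasDerivAt_exJ (-k) 1 x t)
  have hanti : AntitoneOn D (Set.Ici 0) := by
    refine antitoneOn_of_deriv_nonpos (convex_Ici 0) (fun t _ => (hDD t).continuousAt.continuousWithinAt)
      (fun t _ => (hDD t).differentiableAt.differentiableWithinAt) fun t ht => ?_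
    rw [interior_Ici] at ht
    have ht0 : 0 < t := ht
    rw [(hDD t).deriv]
    refine Finset.sum_nonpos fun x _ => ?_
    rw [sub_nonpos]
    refine Finset.sum_le_sum fun y _ => mul_le_mul_of_nonneg_left (covJ_anti hJ (fun z => ?_) x y) (by simp)
    simp only [Pi.add_apply, Pi.neg_apply, Pi.smul_apply, Pi.one_apply, smul_eq_mul, mul_one]
    rw [abs_le]
    constructor <;> linarith [hk z]
  obtain ⟨c, hc, hcT⟩ := exists_hasDerivAt_eq_slope T D hH
    (fun t _ => (hTD t).continuousAt.continuousWithinAt) fun t _ => hTD t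
  have h0 : T 0 = 0 := by simp [hT, ZJ_neg]
  have hle : T H ≤ 2 * ∑ x, k x := by
    have h1 := ZJ_le (J := J) (H • (1 : V → ℝ)) k hk
    have h2 : H • (1 : V → ℝ) + k = k + H • 1 := add_comm _ _
    have h3 : H • (1 : V → ℝ) - k = -k + H • 1 := by rw [sub_eq_add_neg, add_comm]
    rw [h2, h3] at h1
    have h4 := Real.log_le_log (ZJ_pos J _) h1
    rw [Real.log_mul (Real.exp_pos _).ne' (ZJ_pos J _).ne', Real.log_exp] at h4
    simp only [hT]
    linarith
  have hcH : D H ≤ D c := hanti hc.1.le (hc.1.le.trans hc.2.le) hc.2.le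
  rw [hcT, h0, sub_zero, sub_zero, le_div_iff₀ hH] at hcH
  linarith

/-- The magnetization is at most the free susceptibility weighted by the fields. -/
theorem exJ_le_sum (hJ : ∀ x y, 0 ≤ J x y) {k : V → ℝ} (hk : ∀ x, 0 ≤ k x) (x : V) :
    (exJ J k fun s => sval (s x)) ≤ ∑ y, k y * exJ J 0 fun s => sval (s x) * sval (s y) := by
  obtain ⟨c, hc, hcT⟩ := exists_hasDerivAt_eq_slope (fun t : ℝ => exJ J (0 + t • k) fun s => sval (s x))
    (fun t => ∑ y, k y * covJ J (0 + t • k) x y) one_pos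
    (fun t _ => (hasDerivAt_exJ 0 k x t).continuousAt.continuousWithinAt) fun t _ => hasDerivAt_exJ 0 k x t
  simp only [one_smul, zero_smul, add_zero, zero_add, exJ_zero, sub_zero, div_one] at hcT
  rw [← hcT]
  refine Finset.sum_le_sum fun y _ => mul_le_mul_of_nonneg_left ?_ (hk y)
  refine (covJ_anti hJ (b := 0) (fun z => ?_) x y).trans (le_of_eq ?_)
  · simp only [Pi.zero_apply, abs_zero, Pi.smul_apply, smul_eq_mul]
    exact mul_nonneg hc.1.le (hk z)
  · simp [covJ, exJ_zero]

end Fields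

section Bridge
variable {β h : ℝ} {U : Finset (ℤ × ℤ)}

/-- Nearest-neighbour couplings in a finite set of sites. -/
def Jb (β : ℝ) (U : Finset (ℤ × ℤ)) (x y : ↥U) : ℝ := if (y : ℤ × ℤ) ∈ nbrs x then β / 2 else 0

/-- Number of neighbours outside. -/
def bdeg (U : Finset (ℤ × ℤ)) (x : ℤ × ℤ) : ℕ := ((nbrs x).filter fun y => y ∉ U).card

lemma Jb_nonneg (hβ : 0 ≤ β) (x y : ↥U) : 0 ≤ Jb β U x y := by
  unfold Jb; split_ifs <;> linarith

lemma gw_fill (c : Bool) (τ : ↥U → Bool) :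
    gw β h U (fill U (fun _ => c) τ) = Real.exp (engJ (Jb β U) (fun x => β * bdeg U x * sval c - h) τ) := by
  have hf : ∀ x : ↥U, fill U (fun _ => c) τ x = τ x := fun x => by simp [fill]
  unfold gw engy engJ
  congr 1
  rw [Finset.mul_sum, Finset.mul_sum, ← Finset.sum_sub_distrib, ← Finset.sum_coe_sort U, ← Finset.sum_add_distrib]
  refine Finset.sum_congr rfl fun x _ => ?_
  have h1 : ∑ y ∈ nbrs x, (if y ∈ U then 1 / 2 else 1) * (sval (fill U (fun _ => c) τ x) * sval (fill U (fun _ => c) τ y))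
      = ∑ y ∈ (nbrs x).filter (fun y => y ∈ U), 1 / 2 * (sval (fill U (fun _ => c) τ x) * sval (fill U (fun _ => c) τ y))
        + ∑ y ∈ (nbrs x).filter (fun y => y ∉ U), sval (τ x) * sval c := by
    rw [← Finset.sum_filter_add_sum_filter_not (nbrs x) (fun y => y ∈ U)]
    congr 1
    · exact Finset.sum_congr rfl fun y hy => by rw [if_pos (Finset.mem_filter.1 hy).2]
    · refine Finset.sum_congr rfl fun y hy => ?_
      have := (Finset.mem_filter.1 hy).2
      rw [if_neg this, hf, one_mul]
      simp [fill, this]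
  have h2 : ∑ y ∈ (nbrs x).filter (fun y => y ∈ U), 1 / 2 * (sval (fill U (fun _ => c) τ x) * sval (fill U (fun _ => c) τ y))
      = ∑ y : ↥U, (if (y : ℤ × ℤ) ∈ nbrs x then 1 / 2 else 0) * (sval (τ x) * sval (τ y)) := by
    have : (nbrs x).filter (fun y => y ∈ U) = U.filter fun y => y ∈ nbrs x := by
      ext y; simp [and_comm]
    rw [this, Finset.sum_filter, ← Finset.sum_coe_sort U]
    refine Finset.sum_congr rfl fun y _ => ?_
    rw [hf, hf]
    split_ifs <;> ring
  rw [h1, h2, Finset.sum_const, nsmul_eq_mul, hf, mul_add, Finset.mul_sum]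
  simp only [Jb, bdeg]
  have h3 : ∀ y : ↥U, β * ((if (y : ℤ × ℤ) ∈ nbrs x then 1 / 2 else 0) * (sval (τ x) * sval (τ y))) =
      (if (y : ℤ × ℤ) ∈ nbrs x then β / 2 else 0) * (sval (τ x) * sval (τ y)) := fun y => by
    split_ifs <;> ring
  simp only [h3]
  ring

lemma ev_ind_eq (c : Bool) (x : ↥U) : ev β h U (ind x) (fun _ => c) =
    (1 + exJ (Jb β U) (fun x => β * bdeg U x * sval c - h) fun s => sval (s x)) / 2 := by
  have hz := (ZJ_pos (Jb β U) (fun x => β * bdeg U x * sval c - h)).ne'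
  have hpf : pf β h U (fun _ => c) = ZJ (Jb β U) (fun x => β * bdeg U x * sval c - h) := by
    rw [pf, sum_agr]
    exact Finset.sum_congr rfl fun τ _ => gw_fill c τ
  rw [ev, hpf, exJ, div_eq_iff hz, sum_agr]
  have h1 : ∀ τ : ↥U → Bool, gw β h U (fill U (fun _ => c) τ) * ind x (fill U (fun _ => c) τ) =
      (Real.exp (engJ (Jb β U) (fun x => β * bdeg U x * sval c - h) τ) + sval (τ x) *
        Real.exp (engJ (Jb β U) (fun x => β * bdeg U x * sval c - h) τ)) / 2 := fun τ => by
    have : fill U (fun _ => c) τ x = τ x := by simp [fill]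
    rw [gw_fill, ind, this]
    cases τ x <;> simp [sval]
  rw [Finset.sum_congr rfl fun τ _ => h1 τ, ← Finset.sum_div, Finset.sum_add_distrib]
  change (ZJ _ _ + _) / 2 = _
  generalize hB : (fun x : ↥U => β * bdeg U x * sval c - h) = B at *
  field_simp

lemma dd_empty_eq (ξ : Cfg2) (x : ↥U) : dd β h ∅ U (ind x) ξ =
    ((exJ (Jb β U) ((fun x : ↥U => β * (bdeg U x : ℝ)) + (-h) • 1) fun s => sval (s x)) -
      exJ (Jb β U) (-(fun x : ↥U => β * (bdeg U x : ℝ)) + (-h) • 1) fun s => sval (s x)) / 2 := by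
  rw [dd, topOn_empty, botOn_empty, ev_ind_eq, ev_ind_eq]
  have e1 : (fun x : ↥U => β * bdeg U x * sval true - h) = (fun x : ↥U => β * (bdeg U x : ℝ)) + (-h) • 1 := by
    funext x; simp [sval, sub_eq_add_neg]
  have e2 : (fun x : ↥U => β * bdeg U x * sval false - h) = -(fun x : ↥U => β * (bdeg U x : ℝ)) + (-h) • 1 := by
    funext x; simp [sval, sub_eq_add_neg]
  rw [e1, e2]
  ring

lemma dd_empty_abs (ξ : Cfg2) (x : ↥U) : dd β h ∅ U (ind x) ξ =
    ((exJ (Jb β U) ((fun x : ↥U => β * (bdeg U x : ℝ)) + |h| • 1) fun s => sval (s x)) -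
      exJ (Jb β U) (-(fun x : ↥U => β * (bdeg U x : ℝ)) + |h| • 1) fun s => sval (s x)) / 2 := by
  rw [dd_empty_eq]
  rcases abs_cases h with ⟨e, -⟩ | ⟨e, -⟩ <;> rw [e]
  have e1 : (fun x : ↥U => β * (bdeg U x : ℝ)) + (-h) • 1 = -(-(fun x : ↥U => β * (bdeg U x : ℝ)) + h • 1) := by
    simp [add_comm]
  have e2 : -(fun x : ↥U => β * (bdeg U x : ℝ)) + (-h) • 1 = -((fun x : ↥U => β * (bdeg U x : ℝ)) + h • 1) := by
    rw [neg_add]; simp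
  rw [e1, e2, exJ_neg, exJ_neg]
  ring

lemma bdeg_le (x : ℤ × ℤ) : (bdeg U x : ℝ) ≤ 4 := by
  exact_mod_cast (Finset.card_filter_le _ _).trans (card_nbrs_le x)

lemma bdeg_box_eq_zero {n : ℕ} {x : ℤ × ℤ} (hx : x ∈ box n) : bdeg (box (n + 1)) x = 0 := by
  rw [bdeg, Finset.card_eq_zero, Finset.filter_eq_empty_iff]
  exact fun y hy => not_not.2 (mem_box_succ_of_nbr hx hy)

lemma sum_dd_box_le (hβ : 0 ≤ β) (hh : h ≠ 0) (ξ : Cfg2) {N : ℕ} (hN : 1 ≤ N) :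
    ∑ x ∈ box N, dd β h ∅ (box N) (ind x) ξ ≤ 32 * β / |h| * N := by
  obtain ⟨n, rfl⟩ : ∃ n, N = n + 1 := ⟨N - 1, by omega⟩
  have hH := abs_pos.2 hh
  have h1 := sum_exJ_sub_le (Jb_nonneg (U := box (n + 1)) hβ)
    (k := fun x => β * bdeg (box (n + 1)) x) (fun x => by positivity) hH
  have h2 : ∑ x ∈ box (n + 1), (bdeg (box (n + 1)) x : ℝ) ≤ 4 * (8 * (n + 1)) := by
    rw [← card_shell n, ← Finset.sum_subset (Finset.sdiff_subset (s := box (n + 1)) (t := box n))]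
    · refine (Finset.sum_le_card_nsmul _ _ 4 fun x _ => bdeg_le x).trans (le_of_eq ?_)
      rw [nsmul_eq_mul, mul_comm]
    · intro x hx hx'
      have : x ∈ box n := by simpa [hx] using hx'
      rw [bdeg_box_eq_zero this, Nat.cast_zero]
  rw [← Finset.sum_coe_sort (box (n + 1)), Finset.sum_congr rfl fun x _ => dd_empty_abs ξ x, ← Finset.sum_div,
    div_le_iff₀ two_pos]
  have h3 : ∑ x : ↥(box (n + 1)), β * (bdeg (box (n + 1)) x : ℝ) ≤ β * (4 * (8 * (n + 1))) := by
    rw [← Finset.mul_sum, Finset.sum_coe_sort (box (n + 1)) fun x => (bdeg (box (n + 1)) x : ℝ)]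
    exact mul_le_mul_of_nonneg_left h2 hβ
  refine le_of_mul_le_mul_left ?_ hH
  refine h1.trans ?_
  have : |h| * (32 * β / |h| * ((n + 1 : ℕ) : ℝ) * 2) = 64 * β * (n + 1) := by
    push_cast; field_simp; ring
  rw [this]
  linarith

/-- In a nonzero field the influence of the boundary is summable. -/
theorem summable_Dr_of_field (hβ : 0 ≤ β) (hh : h ≠ 0) : Summable (Dr β h) := by
  have hb : ∀ n, boxOff ∅ n = box n := fun n => by ext x; simp [mem_boxOff]
  obtain ⟨C, -, hC⟩ := quadratic_decay h hβ (32 * β / |h|) (by positivity)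
  refine summable_of_quadratic (C := C) (Dr_nonneg hβ) fun n hn => ?_
  have := hC ∅ (fun _ => true) (by simp) (fun N hN => by rw [hb]; exact sum_dd_box_le hβ hh _ hN) n hn
  rwa [hb] at this

/-- Without field the influence of the boundary is controlled by free two-point functions. -/
lemma Dr_le_sum_free (hβ : 0 ≤ β) (n : ℕ) (h0 : (0, 0) ∈ box (n + 1)) :
    Dr β 0 (n + 1) ≤ 4 * β * ∑ y : ↥(box (n + 1)), if (y : ℤ × ℤ) ∈ box n then 0 else
      exJ (Jb β (box (n + 1))) 0 fun s => sval (s ⟨(0, 0), h0⟩) * sval (s y) := by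
  rw [Dr, show ind (0, 0) = ind ((⟨(0, 0), h0⟩ : ↥(box (n + 1))) : ℤ × ℤ) from rfl, dd_empty_eq]
  simp only [neg_zero, zero_smul, add_zero, exJ_neg]
  have h1 := exJ_le_sum (Jb_nonneg (U := box (n + 1)) hβ)
    (k := fun x => β * bdeg (box (n + 1)) x) (fun x => by positivity) ⟨(0, 0), h0⟩
  rw [sub_neg_eq_add, add_self_div_two]
  refine h1.trans ?_
  rw [Finset.mul_sum]
  refine Finset.sum_le_sum fun y _ => ?_
  split_ifs with hy
  · rw [bdeg_box_eq_zero hy]; simp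
  · exact mul_le_mul_of_nonneg_right (by nlinarith [bdeg_le (U := box (n + 1)) (y : ℤ × ℤ)])
      (exJ_pair_nonneg (Jb_nonneg hβ) _ _)

end Bridge

end

noncomputable section

section Fermions
variable {n : ℕ}

/-- Flip the spins at the sites below `k`. -/
def fl (k : ℕ) (s : Fin (n + 1) → Bool) : Fin (n + 1) → Bool := fun i => if i.val < k then !s i else s i

lemma fl_fl (k : ℕ) (s : Fin (n + 1) → Bool) : fl k (fl k s) = s := by
  funext i; unfold fl; split_ifs <;> simp

lemma fl_comm (k l : ℕ) (s : Fin (n + 1) → Bool) : fl k (fl l s) = fl l (fl k s) := by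
  funext i; unfold fl; split_ifs <;> simp

lemma fl_zero (s : Fin (n + 1) → Bool) : fl 0 s = s := by
  funext i; simp [fl]

lemma sval_fl (k : ℕ) (s : Fin (n + 1) → Bool) (i : Fin (n + 1)) :
    sval (fl k s i) = (if i.val < k then -1 else 1) * sval (s i) := by
  unfold fl; split_ifs <;> simp [sval_not]

/-- Flipping the spins at the sites below `k`, as a permutation. -/
def flEquiv (k : ℕ) : (Fin (n + 1) → Bool) ≃ (Fin (n + 1) → Bool) :=
  ⟨fl k, fl k, fl_fl k, fl_fl k⟩

/-- Site, cut and sign of a fermion operator. -/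
def fsite : Fin (n + 1) ⊕ Fin (n + 1) → Fin (n + 1) := Sum.elim id id
def fcut : Fin (n + 1) ⊕ Fin (n + 1) → ℕ := Sum.elim (fun j => j.val) (fun j => j.val + 1)
def fsgn : Fin (n + 1) ⊕ Fin (n + 1) → ℝ := Sum.elim (fun _ => 1) (fun _ => -1)

/-- The elementary fermion operators (Jordan–Wigner transformation). -/
def fop (x : Fin (n + 1) ⊕ Fin (n + 1)) (g : (Fin (n + 1) → Bool) → ℝ) (s : Fin (n + 1) → Bool) : ℝ :=
  fsgn x * sval (s (fsite x)) * g (fl (fcut x) s)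

lemma fop_anticomm (x y : Fin (n + 1) ⊕ Fin (n + 1)) : ∃ c : ℝ, ∀ (g : (Fin (n + 1) → Bool) → ℝ) (s),
    fop x (fop y g) s + fop y (fop x g) s = c * g s := by
  have key : ∀ (g : (Fin (n + 1) → Bool) → ℝ) (s : Fin (n + 1) → Bool),
      fop x (fop y g) s + fop y (fop x g) s = fsgn x * fsgn y * (sval (s (fsite x)) * sval (s (fsite y))) *
        ((if (fsite y).val < fcut x then -1 else 1) + (if (fsite x).val < fcut y then -1 else 1)) *
        g (fl (fcut x) (fl (fcut y) s)) := by
    intro g s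
    simp only [fop, sval_fl]
    rw [fl_comm (fcut y) (fcut x)]
    ring
  by_cases hxy : fcut x = fcut y ∧ fsite x = fsite y
  · refine ⟨fsgn x * fsgn y * ((if (fsite y).val < fcut x then -1 else 1) + (if (fsite x).val < fcut y then -1 else 1)),
      fun g s => ?_⟩
    rw [key, hxy.1, hxy.2, fl_fl, sval_mul_self]
    ring
  · refine ⟨0, fun g s => ?_⟩
    rw [key]
    have : ((if (fsite y).val < fcut x then -1 else 1) + (if (fsite x).val < fcut y then -1 else 1) : ℝ) = 0 := by
      have hiff : ¬ ((fsite y).val < fcut x ↔ (fsite x).val < fcut y) := by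
        rcases x with j | j <;> rcases y with k | k <;>
          simp only [fsite, fcut, Sum.elim_inl, Sum.elim_inr, id, Fin.ext_iff] at hxy ⊢ <;> omega
      by_cases h1 : (fsite y).val < fcut x <;> by_cases h2 : (fsite x).val < fcut y
      · exact absurd (iff_of_true h1 h2) hiff
      · rw [if_pos h1, if_neg h2]; norm_num
      · rw [if_neg h1, if_pos h2]; norm_num
      · exact absurd (iff_of_false h1 h2) hiff
    rw [this]
    ring

/-- Linear combinations of fermion operators. -/
def wop (v : Fin (n + 1) ⊕ Fin (n + 1) → ℝ) (g : (Fin (n + 1) → Bool) → ℝ) (s : Fin (n + 1) → Bool) : ℝ :=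
  ∑ i, v i * fop i g s

lemma wop_smul_left (c : ℝ) (v : Fin (n + 1) ⊕ Fin (n + 1) → ℝ) (g : (Fin (n + 1) → Bool) → ℝ) :
    wop (c • v) g = c • wop v g := by
  funext s; simp only [wop, Pi.smul_apply, smul_eq_mul, Finset.mul_sum, mul_assoc]

lemma wop_add (v : Fin (n + 1) ⊕ Fin (n + 1) → ℝ) (f g : (Fin (n + 1) → Bool) → ℝ) :
    wop v (f + g) = wop v f + wop v g := by
  funext s; simp [wop, fop, mul_add, Finset.sum_add_distrib]

lemma wop_smul (c : ℝ) (v : Fin (n + 1) ⊕ Fin (n + 1) → ℝ) (g : (Fin (n + 1) → Bool) → ℝ) :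
    wop v (c • g) = c • wop v g := by
  funext s
  simp only [wop, fop, Pi.smul_apply, smul_eq_mul, Finset.mul_sum]
  exact Finset.sum_congr rfl fun i _ => by ring

lemma wop_zero (v : Fin (n + 1) ⊕ Fin (n + 1) → ℝ) : wop v 0 = 0 := by
  have := wop_smul 0 v 0
  simpa using this

lemma wop_single (x : Fin (n + 1) ⊕ Fin (n + 1)) (g : (Fin (n + 1) → Bool) → ℝ) :
    wop (Pi.single x 1) g = fop x g := by
  funext s
  rw [wop, Finset.sum_eq_single x]
  · simp
  · intro y _ hy; simp [hy]
  · simp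

lemma fop_sum (x : Fin (n + 1) ⊕ Fin (n + 1)) {ι : Type*} (t : Finset ι) (c : ι → ℝ)
    (g : ι → (Fin (n + 1) → Bool) → ℝ) (s) :
    fop x (fun s => ∑ i ∈ t, c i * g i s) s = ∑ i ∈ t, c i * fop x (g i) s := by
  simp only [fop, Finset.mul_sum]
  exact Finset.sum_congr rfl fun i _ => by ring

lemma wop_anticomm (u v : Fin (n + 1) ⊕ Fin (n + 1) → ℝ) : ∃ c : ℝ, ∀ g : (Fin (n + 1) → Bool) → ℝ,
    wop u (wop v g) = c • g - wop v (wop u g) := by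
  choose c hc using fop_anticomm (n := n)
  refine ⟨∑ x, ∑ y, u x * v y * c x y, fun g => ?_⟩
  have h1 : ∀ (u v : Fin (n + 1) ⊕ Fin (n + 1) → ℝ) s, wop u (wop v g) s =
      ∑ x, ∑ y, u x * v y * fop x (fop y g) s := by
    intro u v s
    unfold wop
    refine Finset.sum_congr rfl fun x _ => ?_
    rw [fop_sum, Finset.mul_sum]
    exact Finset.sum_congr rfl fun y _ => by ring
  funext s
  rw [Pi.sub_apply, Pi.smul_apply, smul_eq_mul, h1, h1 v u, Finset.sum_comm (f := fun x y => v x * u y * _),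
    Finset.sum_mul, ← Finset.sum_sub_distrib]
  refine Finset.sum_congr rfl fun x _ => ?_
  rw [Finset.sum_mul, ← Finset.sum_sub_distrib]
  refine Finset.sum_congr rfl fun y _ => ?_
  have := hc x y g s
  linear_combination (u x * v y) * this

end Fermions

section Transfer
variable {n : ℕ} (K : ℝ)

/-- Square root of the Boltzmann weight of one row. -/
def rowW (s : Fin (n + 1) → Bool) : ℝ :=
  Real.exp (K / 2 * ∑ i : Fin n, sval (s i.castSucc) * sval (s i.succ))

/-- Boltzmann weight of the bonds between two consecutive rows. -/
def colW (s t : Fin (n + 1) → Bool) : ℝ := Real.exp (K * ∑ i, sval (s i) * sval (t i))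

/-- The symmetric transfer matrix. -/
def tmat (s t : Fin (n + 1) → Bool) : ℝ := rowW K s * colW K s t * rowW K t

/-- The transfer operator. -/
def trop (g : (Fin (n + 1) → Bool) → ℝ) (s : Fin (n + 1) → Bool) : ℝ := ∑ t, tmat K s t * g t

/-- Action of the row weight on fermions. -/
def rotR (v : Fin (n + 1) ⊕ Fin (n + 1) → ℝ) : Fin (n + 1) ⊕ Fin (n + 1) → ℝ :=
  Sum.elim (Fin.cons (v (Sum.inl 0)) fun j : Fin n =>
      Real.cosh K * v (Sum.inl j.succ) - Real.sinh K * v (Sum.inr j.castSucc))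
    (Fin.snoc (α := fun _ => ℝ) (fun j : Fin n =>
      Real.cosh K * v (Sum.inr j.castSucc) - Real.sinh K * v (Sum.inl j.succ)) (v (Sum.inr (Fin.last n))))

/-- Action of the column weight on fermions. -/
def rotC (v : Fin (n + 1) ⊕ Fin (n + 1) → ℝ) : Fin (n + 1) ⊕ Fin (n + 1) → ℝ :=
  Sum.elim (fun j => (Real.cosh (2 * K) * v (Sum.inl j) + v (Sum.inr j)) / Real.sinh (2 * K))
    (fun j => (v (Sum.inl j) + Real.cosh (2 * K) * v (Sum.inr j)) / Real.sinh (2 * K))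

lemma sum_fermion (f : Fin (n + 1) ⊕ Fin (n + 1) → ℝ) : ∑ i, f i =
    f (Sum.inl 0) + f (Sum.inr (Fin.last n)) + ∑ j : Fin n, (f (Sum.inl j.succ) + f (Sum.inr j.castSucc)) := by
  rw [Fintype.sum_sum_type, Fin.sum_univ_succ, Fin.sum_univ_castSucc (fun j => f (Sum.inr j)), Finset.sum_add_distrib]
  ring

lemma rowW_fl (j : Fin n) (s : Fin (n + 1) → Bool) :
    rowW K (fl (j.val + 1) s) = rowW K s * Real.exp (-(K * (sval (s j.castSucc) * sval (s j.succ)))) := by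
  unfold rowW
  rw [← Real.exp_add]
  congr 1
  have : ∀ i : Fin n, sval (fl (j.val + 1) s i.castSucc) * sval (fl (j.val + 1) s i.succ) =
      sval (s i.castSucc) * sval (s i.succ) - if i = j then 2 * (sval (s j.castSucc) * sval (s j.succ)) else 0 := by
    intro i
    simp only [sval_fl, Fin.val_castSucc, Fin.val_succ]
    rcases lt_trichotomy i.val j.val with hij | hij | hij
    · rw [if_pos (by omega), if_pos (by omega), if_neg (by intro e; rw [e] at hij; omega)]; ring
    · rw [if_pos (by omega), if_neg (by omega), if_pos (Fin.ext hij), Fin.ext hij]; ring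
    · rw [if_neg (by omega), if_neg (by omega), if_neg (by intro e; rw [e] at hij; omega)]; ring
  simp only [this, Finset.sum_sub_distrib, Finset.sum_ite_eq', Finset.mem_univ, if_true]
  ring

lemma rowW_fl_all (s : Fin (n + 1) → Bool) : rowW K (fl (n + 1) s) = rowW K s := by
  unfold rowW
  congr 2
  refine Finset.sum_congr rfl fun i _ => ?_
  simp only [sval_fl, Fin.val_castSucc, Fin.val_succ]
  rw [if_pos (by omega), if_pos (by omega)]
  ring

lemma rowW_wop (v : Fin (n + 1) ⊕ Fin (n + 1) → ℝ) (g : (Fin (n + 1) → Bool) → ℝ) (s) :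
    rowW K s * wop v g s = wop (rotR K v) (fun s => rowW K s * g s) s := by
  unfold wop
  rw [sum_fermion, sum_fermion, mul_add, mul_add, Finset.mul_sum]
  refine congrArg₂ (fun a b : ℝ => a + b) (congrArg₂ (fun a b : ℝ => a + b) ?_ ?_)
    (Finset.sum_congr rfl fun j _ => ?_)
  · simp only [rotR, fop, fsgn, fsite, fcut, Sum.elim_inl, Fin.cons_zero, Fin.val_zero, fl_zero, id]
    ring
  · simp only [rotR, fop, fsgn, fsite, fcut, Sum.elim_inr, Fin.snoc_last, Fin.val_last, id, rowW_fl_all]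
    ring
  · simp only [rotR, fop, fsgn, fsite, fcut, Sum.elim_inl, Sum.elim_inr, Fin.cons_succ, Fin.snoc_castSucc, id,
      Fin.val_succ, Fin.val_castSucc, rowW_fl]
    have hE : Real.exp K * Real.exp (-K) = 1 := by rw [← Real.exp_add]; simp
    rcases Bool.eq_false_or_eq_true (s j.castSucc) with h1 | h1 <;>
      rcases Bool.eq_false_or_eq_true (s j.succ) with h2 | h2 <;>
      simp only [h1, h2, sval_true, sval_false, Real.cosh_eq, Real.sinh_eq] <;> norm_num
    · linear_combination (-rowW K s * g (fl (j.val + 1) s) * (v (Sum.inl j.succ) - v (Sum.inr j.castSucc))) * hE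
    · linear_combination (rowW K s * g (fl (j.val + 1) s) * (v (Sum.inl j.succ) + v (Sum.inr j.castSucc))) * hE
    · linear_combination (-rowW K s * g (fl (j.val + 1) s) * (v (Sum.inl j.succ) + v (Sum.inr j.castSucc))) * hE
    · linear_combination (rowW K s * g (fl (j.val + 1) s) * (v (Sum.inl j.succ) - v (Sum.inr j.castSucc))) * hE

lemma colW_fl (k : ℕ) (s t : Fin (n + 1) → Bool) : colW K s (fl k t) = colW K (fl k s) t := by
  unfold colW
  congr 2
  refine Finset.sum_congr rfl fun i _ => ?_
  rw [sval_fl, sval_fl]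
  ring

lemma colW_fl_succ (j : Fin (n + 1)) (s t : Fin (n + 1) → Bool) :
    colW K (fl (j.val + 1) s) t = colW K (fl j.val s) t * Real.exp (-(2 * K * (sval (s j) * sval (t j)))) := by
  unfold colW
  rw [← Real.exp_add]
  congr 1
  have : ∀ i, sval (fl (j.val + 1) s i) * sval (t i) =
      sval (fl j.val s i) * sval (t i) - if i = j then 2 * (sval (s j) * sval (t j)) else 0 := by
    intro i
    simp only [sval_fl]
    rcases lt_trichotomy i.val j.val with hij | hij | hij
    · rw [if_pos (by omega), if_pos (by omega), if_neg (by intro e; rw [e] at hij; omega)]; ring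
    · rw [if_pos (by omega), if_neg (by omega), if_pos (Fin.ext hij), Fin.ext hij]; ring
    · rw [if_neg (by omega), if_neg (by omega), if_neg (by intro e; rw [e] at hij; omega)]; ring
  simp only [this, Finset.sum_sub_distrib, Finset.sum_ite_eq', Finset.mem_univ, if_true]
  ring

lemma colW_wop (hK : 0 < K) (v : Fin (n + 1) ⊕ Fin (n + 1) → ℝ) (g : (Fin (n + 1) → Bool) → ℝ) (s) :
    ∑ t, colW K s t * wop v g t = wop (rotC K v) (fun s => ∑ t, colW K s t * g t) s := by
  have hE : Real.exp (2 * K) * Real.exp (-(2 * K)) = 1 := by rw [← Real.exp_add]; simp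
  have hS : 0 < Real.sinh (2 * K) := Real.sinh_pos_iff.2 (by linarith)
  have h1 : ∀ x : Fin (n + 1) ⊕ Fin (n + 1), ∑ t, colW K s t * fop x g t =
      ∑ t, fsgn x * (colW K (fl (fcut x) s) t * sval (fl (fcut x) t (fsite x))) * g t := by
    intro x
    rw [← Equiv.sum_comp (flEquiv (fcut x))]
    refine Finset.sum_congr rfl fun t _ => ?_
    simp only [flEquiv, Equiv.coe_fn_mk, fop, fl_fl, colW_fl]
    ring
  have h2 : ∑ t, colW K s t * wop v g t = ∑ x, v x * ∑ t, colW K s t * fop x g t := by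
    simp only [wop, Finset.mul_sum]
    rw [Finset.sum_comm]
    exact Finset.sum_congr rfl fun x _ => Finset.sum_congr rfl fun t _ => by ring
  rw [h2]
  simp only [h1]
  unfold wop
  rw [Fintype.sum_sum_type, Fintype.sum_sum_type, ← Finset.sum_add_distrib, ← Finset.sum_add_distrib]
  refine Finset.sum_congr rfl fun j _ => ?_
  simp only [rotC, fop, fsgn, fsite, fcut, Sum.elim_inl, Sum.elim_inr, id, Finset.mul_sum, ← Finset.sum_add_distrib]
  refine Finset.sum_congr rfl fun t _ => ?_
  rw [colW_fl_succ, sval_fl, sval_fl, if_neg (lt_irrefl _), if_pos (Nat.lt_succ_self _)]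
  have e1 : sval (t j) * Real.sinh (2 * K) = Real.cosh (2 * K) * sval (s j) -
      sval (s j) * Real.exp (-(2 * K * (sval (s j) * sval (t j)))) := by
    rcases Bool.eq_false_or_eq_true (s j) with h1 | h1 <;>
      rcases Bool.eq_false_or_eq_true (t j) with h2 | h2 <;>
      simp only [h1, h2, sval_true, sval_false, Real.cosh_eq, Real.sinh_eq] <;> norm_num <;> ring
  have e2 : Real.exp (-(2 * K * (sval (s j) * sval (t j)))) * sval (t j) * Real.sinh (2 * K) = sval (s j) -
      Real.cosh (2 * K) * sval (s j) * Real.exp (-(2 * K * (sval (s j) * sval (t j)))) := by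
    rcases Bool.eq_false_or_eq_true (s j) with h1 | h1 <;>
      rcases Bool.eq_false_or_eq_true (t j) with h2 | h2 <;>
      simp only [h1, h2, sval_true, sval_false, Real.cosh_eq, Real.sinh_eq] <;> norm_num
    all_goals first | linear_combination hE / 2 | linear_combination -hE / 2 | linear_combination hE | linear_combination -hE
  rw [← eq_div_iff hS.ne'] at e1 e2
  linear_combination (v (Sum.inl j) * colW K (fl j.val s) t * g t) * e1 +
    (v (Sum.inr j) * colW K (fl j.val s) t * g t) * e2

/-- Action of the transfer operator on fermions. -/
def rotA (v : Fin (n + 1) ⊕ Fin (n + 1) → ℝ) : Fin (n + 1) ⊕ Fin (n + 1) → ℝ := rotR K (rotC K (rotR K v))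

lemma trop_eq (g : (Fin (n + 1) → Bool) → ℝ) (s) :
    trop K g s = rowW K s * ∑ t, colW K s t * (rowW K t * g t) := by
  unfold trop tmat
  rw [Finset.mul_sum]
  exact Finset.sum_congr rfl fun t _ => by ring

lemma trop_wop (hK : 0 < K) (v : Fin (n + 1) ⊕ Fin (n + 1) → ℝ) (g : (Fin (n + 1) → Bool) → ℝ) :
    trop K (wop v g) = wop (rotA K v) (trop K g) := by
  funext s
  rw [trop_eq]
  simp only [rowW_wop]
  rw [colW_wop K hK, rowW_wop]
  refine congrFun (congrArg _ ?_) s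
  funext s
  rw [trop_eq]

end Transfer

end

noncomputable section

section Spectral
variable {ι : Type*} [Fintype ι]

/-- Orthonormal eigenbasis of a symmetric linear map. -/
lemma exists_eigenbasis [DecidableEq ι] (T : (ι → ℝ) →ₗ[ℝ] (ι → ℝ)) (hT : ∀ u v, dotProduct u (T v) = dotProduct (T u) v) :
    ∃ (b : ι → ι → ℝ) (μ : ι → ℝ), (∀ i, T (b i) = μ i • b i) ∧
      (∀ i j, dotProduct (b i) (b j) = if i = j then 1 else 0) ∧ ∀ v, v = ∑ i, dotProduct (b i) v • b i := by
  have hH : (LinearMap.toMatrix' T).IsHermitian := by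
    ext i j
    rw [Matrix.conjTranspose_apply, star_trivial, LinearMap.toMatrix'_apply, LinearMap.toMatrix'_apply]
    have := hT (Pi.single i 1) (Pi.single j 1)
    rw [single_one_dotProduct, dotProduct_single_one] at this
    have h2 : ∀ k : ι, (fun j' => if j' = k then (1 : ℝ) else 0) = Pi.single k 1 := fun k => by
      funext l; simp [Pi.single_apply]
    simpa [h2] using this.symm
  refine ⟨fun i => (hH.eigenvectorBasis i).ofLp, hH.eigenvalues, fun i => ?_, fun i j => ?_, fun v => ?_⟩
  · have := hH.mulVec_eigenvectorBasis i
    rwa [LinearMap.toMatrix'_mulVec] at this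
  · have := orthonormal_iff_ite.1 hH.eigenvectorBasis.orthonormal i j
    rw [EuclideanSpace.inner_eq_star_dotProduct, star_trivial] at this
    rw [dotProduct_comm]
    exact this
  · have := hH.eigenvectorBasis.sum_repr' (WithLp.toLp 2 v)
    have h2 := congrArg (WithLp.ofLp) this
    simp only [WithLp.ofLp_sum, WithLp.ofLp_smul, EuclideanSpace.inner_eq_star_dotProduct, star_trivial] at h2
    refine h2.symm.trans (Finset.sum_congr rfl fun i _ => ?_)
    rw [dotProduct_comm]

variable {b : ι → ι → ℝ} {μ : ι → ℝ} {T : (ι → ℝ) →ₗ[ℝ] (ι → ℝ)}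

lemma map_eigenbasis (h1 : ∀ i, T (b i) = μ i • b i) (h3 : ∀ v, v = ∑ i, dotProduct (b i) v • b i) (v) :
    T v = ∑ i, (μ i * dotProduct (b i) v) • b i := by
  conv_lhs => rw [h3 v]
  rw [map_sum]
  refine Finset.sum_congr rfl fun i _ => ?_
  rw [map_smul, h1, smul_smul, mul_comm]

lemma dot_eigenbasis [DecidableEq ι] (h2 : ∀ i j, dotProduct (b i) (b j) = if i = j then 1 else 0) (c d : ι → ℝ) :
    dotProduct (∑ i, c i • b i) (∑ i, d i • b i) = ∑ i, c i * d i := by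
  simp only [sum_dotProduct, dotProduct_sum, smul_dotProduct, dotProduct_smul, h2, smul_eq_mul]
  refine Finset.sum_congr rfl fun i _ => ?_
  simp [mul_comm]

/-- A symmetric map whose eigenvalues are bounded by `c` has norm at most `c`. -/
lemma dot_map_le [DecidableEq ι] (hT : ∀ u v, dotProduct u (T v) = dotProduct (T u) v) {c : ℝ}
    (h : ∀ (m : ℝ) v, v ≠ 0 → T v = m • v → |m| ≤ c) (v : ι → ℝ) :
    dotProduct (T v) (T v) ≤ c ^ 2 * dotProduct v v := by
  obtain ⟨b, μ, h1, h2, h3⟩ := exists_eigenbasis T hT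
  have hμ : ∀ i, |μ i| ≤ c := fun i => h _ (b i) (fun h0 => by have := h2 i i; simp [h0] at this) (h1 i)
  have e : dotProduct v v = ∑ i, dotProduct (b i) v * dotProduct (b i) v := by
    conv_lhs => rw [h3 v]
    rw [dot_eigenbasis h2]
  rw [map_eigenbasis h1 h3, dot_eigenbasis h2, e, Finset.mul_sum]
  refine Finset.sum_le_sum fun i _ => ?_
  have := sq_le_sq.2 ((hμ i).trans (le_abs_self c))
  nlinarith [mul_self_nonneg (dotProduct (b i) v)]

end Spectral

section Gap
variable {n : ℕ}

lemma rotR_rotR (a b : ℝ) (v : Fin (n + 1) ⊕ Fin (n + 1) → ℝ) : rotR a (rotR b v) = rotR (a + b) v := by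
  funext x
  rcases x with j | j
  · refine Fin.cases ?_ (fun j => ?_) j
    · simp [rotR]
    · simp only [rotR, Sum.elim_inl, Sum.elim_inr, Fin.cons_succ, Fin.snoc_castSucc, Real.cosh_add, Real.sinh_add]
      ring
  · refine Fin.lastCases ?_ (fun j => ?_) j
    · simp [rotR]
    · simp only [rotR, Sum.elim_inl, Sum.elim_inr, Fin.cons_succ, Fin.snoc_castSucc, Real.cosh_add, Real.sinh_add]
      ring

lemma rotR_zero (v : Fin (n + 1) ⊕ Fin (n + 1) → ℝ) : rotR 0 v = v := by
  funext x
  rcases x with j | j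
  · refine Fin.cases ?_ (fun j => ?_) j <;> simp [rotR]
  · refine Fin.lastCases ?_ (fun j => ?_) j <;> simp [rotR]

lemma rotR_smul (K c : ℝ) (v : Fin (n + 1) ⊕ Fin (n + 1) → ℝ) : rotR K (c • v) = c • rotR K v := by
  funext x
  rcases x with j | j
  · refine Fin.cases ?_ (fun j => ?_) j
    · simp [rotR]
    · simp [rotR]; ring
  · refine Fin.lastCases ?_ (fun j => ?_) j
    · simp [rotR]
    · simp [rotR]; ring

lemma rotR_add (K : ℝ) (u v : Fin (n + 1) ⊕ Fin (n + 1) → ℝ) : rotR K (u + v) = rotR K u + rotR K v := by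
  funext x
  rcases x with j | j
  · refine Fin.cases ?_ (fun j => ?_) j
    · simp [rotR]
    · simp [rotR]; ring
  · refine Fin.lastCases ?_ (fun j => ?_) j
    · simp [rotR]
    · simp [rotR]; ring

lemma rotC_smul (K c : ℝ) (v : Fin (n + 1) ⊕ Fin (n + 1) → ℝ) : rotC K (c • v) = c • rotC K v := by
  funext x
  rcases x with j | j <;> simp only [rotC, Sum.elim_inl, Sum.elim_inr, Pi.smul_apply, smul_eq_mul] <;> ring

lemma rotC_add (K : ℝ) (u v : Fin (n + 1) ⊕ Fin (n + 1) → ℝ) : rotC K (u + v) = rotC K u + rotC K v := by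
  funext x
  rcases x with j | j <;> simp only [rotC, Sum.elim_inl, Sum.elim_inr, Pi.add_apply] <;> ring

lemma dot_rotR (K : ℝ) (u v : Fin (n + 1) ⊕ Fin (n + 1) → ℝ) : dotProduct u (rotR K v) =
    u (Sum.inl 0) * v (Sum.inl 0) + u (Sum.inr (Fin.last n)) * v (Sum.inr (Fin.last n)) +
    ∑ j : Fin n, (Real.cosh K * (u (Sum.inl j.succ) * v (Sum.inl j.succ) + u (Sum.inr j.castSucc) * v (Sum.inr j.castSucc))
      - Real.sinh K * (u (Sum.inl j.succ) * v (Sum.inr j.castSucc) + u (Sum.inr j.castSucc) * v (Sum.inl j.succ))) := by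
  unfold dotProduct
  rw [sum_fermion]
  refine congrArg₂ (fun a b : ℝ => a + b) ?_ (Finset.sum_congr rfl fun j _ => ?_)
  · simp [rotR]
  · simp only [rotR, Sum.elim_inl, Sum.elim_inr, Fin.cons_succ, Fin.snoc_castSucc]
    ring

lemma rotR_symm (K : ℝ) (u v : Fin (n + 1) ⊕ Fin (n + 1) → ℝ) :
    dotProduct u (rotR K v) = dotProduct (rotR K u) v := by
  rw [dotProduct_comm (rotR K u), dot_rotR, dot_rotR]
  refine congrArg₂ (fun a b : ℝ => a + b) (by ring) (Finset.sum_congr rfl fun j _ => by ring)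

lemma rotR_quad (K : ℝ) (hK : 0 ≤ K) (v : Fin (n + 1) ⊕ Fin (n + 1) → ℝ) :
    Real.exp (-K) * dotProduct v v ≤ dotProduct v (rotR (-K) v) ∧
    dotProduct v (rotR (-K) v) ≤ Real.exp K * dotProduct v v := by
  have e1 : 1 ≤ Real.exp K := Real.one_le_exp hK
  have e2 : Real.exp (-K) ≤ 1 := Real.exp_le_one_iff.2 (by linarith)
  have hs : 0 ≤ Real.sinh K := Real.sinh_nonneg_iff.2 hK
  have e3 : Real.exp (-K) = Real.cosh K - Real.sinh K := (Real.cosh_sub_sinh K).symm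
  have e4 : Real.exp K = Real.cosh K + Real.sinh K := (Real.cosh_add_sinh K).symm
  have h0 : dotProduct v v = dotProduct v (rotR 0 v) := by rw [rotR_zero]
  rw [h0, dot_rotR, dot_rotR, Real.cosh_neg, Real.sinh_neg, Real.cosh_zero, Real.sinh_zero]
  simp only [mul_add (Real.exp _), Finset.mul_sum]
  have a1 := mul_self_nonneg (v (Sum.inl 0))
  have a2 := mul_self_nonneg (v (Sum.inr (Fin.last n)))
  constructor
  · refine add_le_add (by nlinarith) (Finset.sum_le_sum fun j _ => ?_)
    rw [e3]
    nlinarith [mul_nonneg hs (sq_nonneg (v (Sum.inl j.succ) + v (Sum.inr j.castSucc)))]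
  · refine add_le_add (by nlinarith) (Finset.sum_le_sum fun j _ => ?_)
    rw [e4]
    nlinarith [mul_nonneg hs (sq_nonneg (v (Sum.inl j.succ) - v (Sum.inr j.castSucc)))]

lemma dot_rotC (K : ℝ) (u v : Fin (n + 1) ⊕ Fin (n + 1) → ℝ) : dotProduct u (rotC K v) =
    ∑ j, (Real.cosh (2 * K) * (u (Sum.inl j) * v (Sum.inl j) + u (Sum.inr j) * v (Sum.inr j)) +
      (u (Sum.inl j) * v (Sum.inr j) + u (Sum.inr j) * v (Sum.inl j))) / Real.sinh (2 * K) := by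
  unfold dotProduct
  rw [Fintype.sum_sum_type, ← Finset.sum_add_distrib]
  refine Finset.sum_congr rfl fun j _ => ?_
  simp only [rotC, Sum.elim_inl, Sum.elim_inr]
  ring

lemma rotC_symm (K : ℝ) (u v : Fin (n + 1) ⊕ Fin (n + 1) → ℝ) :
    dotProduct u (rotC K v) = dotProduct (rotC K u) v := by
  rw [dotProduct_comm (rotC K u), dot_rotC, dot_rotC]
  exact Finset.sum_congr rfl fun j _ => by ring

/-- The action of the transfer operator on fermions, as a linear map. -/
def rotL (K : ℝ) : (Fin (n + 1) ⊕ Fin (n + 1) → ℝ) →ₗ[ℝ] (Fin (n + 1) ⊕ Fin (n + 1) → ℝ) where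
  toFun := rotA K
  map_add' u v := by simp only [rotA, rotR_add, rotC_add]
  map_smul' c v := by simp only [rotA, rotR_smul, rotC_smul, RingHom.id_apply]

lemma rotL_symm (K : ℝ) (u v : Fin (n + 1) ⊕ Fin (n + 1) → ℝ) :
    dotProduct u (rotL K v) = dotProduct (rotL K u) v := by
  change dotProduct u (rotR K (rotC K (rotR K v))) = dotProduct (rotR K (rotC K (rotR K u))) v
  rw [rotR_symm, rotC_symm, rotR_symm]

/-- The decay rate per column. -/
def decayRate (K : ℝ) : ℝ := Real.exp (2 * K) * Real.tanh K

lemma tanh_eq_sinh_two {K : ℝ} (hK : 0 < K) :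
    (Real.cosh (2 * K) - 1) / Real.sinh (2 * K) = Real.tanh K := by
  have h1 : 0 < Real.sinh K := Real.sinh_pos_iff.2 hK
  have h2 := Real.cosh_pos K
  rw [Real.tanh_eq_sinh_div_cosh, Real.sinh_two_mul, Real.cosh_two_mul, Real.cosh_sq]
  field_simp
  ring

lemma tanh_pos_of_pos {K : ℝ} (hK : 0 < K) : 0 < Real.tanh K := by
  rw [Real.tanh_eq_sinh_div_cosh]
  exact div_pos (Real.sinh_pos_iff.2 hK) (Real.cosh_pos K)

lemma decayRate_pos {K : ℝ} (hK : 0 < K) : 0 < decayRate K :=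
  mul_pos (Real.exp_pos _) (tanh_pos_of_pos hK)

lemma decayRate_lt_one {K : ℝ} (hK : K < betaCrit) : decayRate K < 1 := by
  have h1 : Real.exp (2 * K) < 1 + Real.sqrt 2 := by
    rw [← Real.lt_log_iff_exp_lt (by positivity)]
    unfold betaCrit at hK
    linarith
  have h2 : Real.sqrt 2 * Real.sqrt 2 = 2 := Real.mul_self_sqrt (by norm_num)
  have h3 := Real.exp_pos (2 * K)
  have h4 : Real.tanh K = (Real.exp (2 * K) - 1) / (Real.exp (2 * K) + 1) := by
    have : Real.exp (2 * K) = Real.exp K * Real.exp K := by rw [← Real.exp_add]; ring_nf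
    have hE : Real.exp K * Real.exp (-K) = 1 := by rw [← Real.exp_add]; simp
    have hp := Real.exp_pos K
    have hp' := Real.exp_pos (-K)
    rw [Real.tanh_eq_sinh_div_cosh, Real.sinh_eq, Real.cosh_eq, div_div_div_cancel_right₀ (by norm_num), this,
      div_eq_div_iff (by positivity) (by positivity)]
    linear_combination (-2 * Real.exp K) * hE
  rw [decayRate, h4, ← mul_div_assoc, div_lt_one (by linarith)]
  have h5 : 1 < Real.sqrt 2 := by rw [Real.lt_sqrt] <;> norm_num
  nlinarith [mul_pos (sub_pos.2 h1) (show 0 < Real.exp (2 * K) - 1 + Real.sqrt 2 by linarith)]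

/-- The one-particle spectrum has a gap around `1`. -/
lemma rotL_gap {K : ℝ} (hK : 0 < K) {r : ℝ} {v : Fin (n + 1) ⊕ Fin (n + 1) → ℝ} (hv : v ≠ 0)
    (h : rotL K v = r • v) : 0 < r ∧ (r ≤ decayRate K ∨ 1 ≤ r * decayRate K) := by
  have hS : 0 < Real.sinh (2 * K) := Real.sinh_pos_iff.2 (by linarith)
  have hC : 1 < Real.cosh (2 * K) := Real.one_lt_cosh.2 (by linarith)
  have hT := tanh_eq_sinh_two hK
  have hTp : 0 < Real.tanh K := tanh_pos_of_pos hK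
  have hT' : (Real.cosh (2 * K) + 1) / Real.sinh (2 * K) = (Real.tanh K)⁻¹ := by
    rw [← hT, inv_div, div_eq_div_iff hS.ne' (by linarith)]
    linear_combination -(Real.cosh_sq (2 * K)).symm
  obtain ⟨y, hy⟩ : ∃ y, y = rotR K v := ⟨_, rfl⟩
  have hvy : v = rotR (-K) y := by rw [hy, rotR_rotR]; simp [rotR_zero]
  have hy0 : y ≠ 0 := by
    rintro rfl
    apply hv
    have := rotR_smul (-K) 0 (0 : Fin (n + 1) ⊕ Fin (n + 1) → ℝ)
    simp only [zero_smul] at this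
    rw [hvy, this]
  have hmain : rotC K y = r • rotR (-(2 * K)) y := by
    have : rotR (-K) (rotL K v) = rotC K y := by
      change rotR (-K) (rotR K (rotC K (rotR K v))) = _
      rw [rotR_rotR, neg_add_cancel, rotR_zero, hy]
    rw [← this, h, rotR_smul, hvy, rotR_rotR]
    congr 2; ring
  have hyy : 0 < dotProduct y y := by
    refine lt_of_le_of_ne (Finset.sum_nonneg fun i _ => mul_self_nonneg _) fun h0 => hy0 ?_
    exact dotProduct_self_eq_zero.1 h0.symm
  have hr : 0 < r := by
    have h1 : 0 < dotProduct y (rotC K y) := by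
      refine lt_of_lt_of_le (mul_pos hTp hyy) ?_
      rw [dot_rotC, dotProduct, Fintype.sum_sum_type, ← Finset.sum_add_distrib, Finset.mul_sum]
      refine Finset.sum_le_sum fun j _ => ?_
      rw [← hT, div_mul_eq_mul_div]
      refine div_le_div_of_nonneg_right ?_ hS.le
      nlinarith [sq_nonneg (y (Sum.inl j) + y (Sum.inr j))]
    rw [hmain, dotProduct_smul, smul_eq_mul] at h1
    have h2 := (rotR_quad (2 * K) (by linarith) y).1
    exact pos_of_mul_pos_left h1 (le_trans (by positivity) h2)
  refine ⟨hr, ?_⟩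
  by_contra! hcon
  obtain ⟨hc1, hc2⟩ := hcon
  obtain ⟨p, hp⟩ : ∃ p : Fin (n + 1) ⊕ Fin (n + 1) → ℝ, p = (1 / 2 : ℝ) • (y + y ∘ Sum.swap) := ⟨_, rfl⟩
  obtain ⟨q, hq⟩ : ∃ q : Fin (n + 1) ⊕ Fin (n + 1) → ℝ, q = (1 / 2 : ℝ) • (y - y ∘ Sum.swap) := ⟨_, rfl⟩
  have hpq : y = p + q := by
    rw [hp, hq]; funext i; simp; ring
  have e1 : dotProduct (p - q) (rotC K y) = (Real.tanh K)⁻¹ * dotProduct p p - Real.tanh K * dotProduct q q := by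
    rw [dot_rotC, ← hT', ← hT, dotProduct, dotProduct, Fintype.sum_sum_type, Fintype.sum_sum_type,
      ← Finset.sum_add_distrib, ← Finset.sum_add_distrib, Finset.mul_sum, Finset.mul_sum, ← Finset.sum_sub_distrib]
    refine Finset.sum_congr rfl fun j _ => ?_
    simp only [hp, hq, Pi.smul_apply, Pi.add_apply, Pi.sub_apply, Function.comp_apply, Sum.swap_inl, Sum.swap_inr,
      smul_eq_mul]
    ring
  have e2 : dotProduct (p - q) (rotR (-(2 * K)) y) =
      dotProduct p (rotR (-(2 * K)) p) - dotProduct q (rotR (-(2 * K)) q) := by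
    rw [hpq, rotR_add, sub_dotProduct, dotProduct_add, dotProduct_add, rotR_symm _ p q,
      dotProduct_comm (rotR (-(2 * K)) p) q]
    ring
  have q1 := (rotR_quad (2 * K) (by linarith) p).2
  have q2 := (rotR_quad (2 * K) (by linarith) q).1
  rw [hmain, dotProduct_smul, e2, smul_eq_mul] at e1
  have hpp : 0 ≤ dotProduct p p := Finset.sum_nonneg fun i _ => mul_self_nonneg _
  have hqq : 0 ≤ dotProduct q q := Finset.sum_nonneg fun i _ => mul_self_nonneg _
  have hE : Real.exp (2 * K) * Real.exp (-(2 * K)) = 1 := by rw [← Real.exp_add]; simp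
  have c1 : 0 < (Real.tanh K)⁻¹ - r * Real.exp (2 * K) := by
    rw [sub_pos, lt_inv_comm₀ (by positivity) hTp, lt_inv_comm₀ hTp (by positivity), lt_inv_comm₀ (by positivity) hTp,
      ← one_div, lt_div_iff₀ (by positivity)]
    unfold decayRate at hc2
    linarith
  have c2 : 0 < r * Real.exp (-(2 * K)) - Real.tanh K := by
    unfold decayRate at hc1
    have := mul_lt_mul_of_pos_right hc1 (Real.exp_pos (-(2 * K)))
    have h3 : Real.exp (2 * K) * Real.tanh K * Real.exp (-(2 * K)) = Real.tanh K := by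
      linear_combination Real.tanh K * hE
    linarith
  have f1 : r * dotProduct p (rotR (-(2 * K)) p) ≤ r * (Real.exp (2 * K) * dotProduct p p) :=
    mul_le_mul_of_nonneg_left q1 hr.le
  have f2 : r * (Real.exp (-(2 * K)) * dotProduct q q) ≤ r * dotProduct q (rotR (-(2 * K)) q) :=
    mul_le_mul_of_nonneg_left q2 hr.le
  have f3 := mul_nonneg c1.le hpp
  have f4 := mul_nonneg c2.le hqq
  have hp0 : ((Real.tanh K)⁻¹ - r * Real.exp (2 * K)) * dotProduct p p = 0 := by linarith
  have hq0 : (r * Real.exp (-(2 * K)) - Real.tanh K) * dotProduct q q = 0 := by linarith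
  have hp1 := dotProduct_self_eq_zero.1 ((mul_eq_zero.1 hp0).resolve_left c1.ne')
  have hq1 := dotProduct_self_eq_zero.1 ((mul_eq_zero.1 hq0).resolve_left c2.ne')
  apply hy0
  rw [hpq, hp1, hq1, add_zero]

end Gap

end

noncomputable section

section Perron
variable {ι : Type*} [Fintype ι]

/-- The linear map with kernel `M`. -/
def kerL (M : ι → ι → ℝ) : (ι → ℝ) →ₗ[ℝ] (ι → ℝ) where
  toFun g i := ∑ j, M i j * g j
  map_add' f g := by funext i; simp [mul_add, Finset.sum_add_distrib]
  map_smul' c g := by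
    funext i
    simp only [Pi.smul_apply, smul_eq_mul, RingHom.id_apply, Finset.mul_sum]
    exact Finset.sum_congr rfl fun j _ => by ring

lemma kerL_symm {M : ι → ι → ℝ} (hM : ∀ i j, M i j = M j i) (u v : ι → ℝ) :
    dotProduct u (kerL M v) = dotProduct (kerL M u) v := by
  simp only [dotProduct, kerL, LinearMap.coe_mk, AddHom.coe_mk, Finset.mul_sum, Finset.sum_mul]
  rw [Finset.sum_comm]
  exact Finset.sum_congr rfl fun i _ => Finset.sum_congr rfl fun j _ => by rw [hM]; ring

variable {M : ι → ι → ℝ} (hpos : ∀ i j, 0 < M i j) (hM : ∀ i j, M i j = M j i)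
include hpos hM

/-- Perron's theorem for symmetric positive kernels. -/
lemma exists_perron [DecidableEq ι] [Nonempty ι] :
    ∃ l : ℝ, 0 < l ∧ ∃ φ : ι → ℝ, (∀ i, 0 < φ i) ∧ kerL M φ = l • φ := by
  obtain ⟨b, μ, h1, h2, h3⟩ := exists_eigenbasis (kerL M) (kerL_symm hM)
  obtain ⟨i₀, hi₀⟩ := Finite.exists_max μ
  have hq : ∀ v, dotProduct v (kerL M v) = ∑ i, dotProduct (b i) v * (μ i * dotProduct (b i) v) := fun v => by
    conv_lhs => rw [map_eigenbasis h1 h3 v]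
    nth_rw 1 [h3 v]
    rw [dot_eigenbasis h2]
  have hn : ∀ v, dotProduct v v = ∑ i, dotProduct (b i) v * dotProduct (b i) v := fun v => by
    conv_lhs => rw [h3 v]
    rw [dot_eigenbasis h2]
  have hle : ∀ v, dotProduct v (kerL M v) ≤ μ i₀ * dotProduct v v := fun v => by
    rw [hq, hn, Finset.mul_sum]
    exact Finset.sum_le_sum fun i _ => by nlinarith [hi₀ i, mul_self_nonneg (dotProduct (b i) v)]
  have hl : 0 < μ i₀ := by
    have e1 : 0 < dotProduct (fun _ => (1 : ℝ)) (kerL M fun _ => 1) := by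
      refine Finset.sum_pos (fun i _ => ?_) Finset.univ_nonempty
      rw [one_mul]
      exact Finset.sum_pos (fun j _ => by rw [mul_one]; exact hpos i j) Finset.univ_nonempty
    have e2 : 0 ≤ dotProduct (fun _ : ι => (1 : ℝ)) (fun _ => 1) := Finset.sum_nonneg fun i _ => mul_self_nonneg _
    exact pos_of_mul_pos_left (e1.trans_le (hle _)) e2
  obtain ⟨f, hf⟩ : ∃ f : ι → ℝ, f = fun i => |b i₀ i| := ⟨_, rfl⟩
  have hff : dotProduct f f = 1 := by
    have := h2 i₀ i₀
    rw [if_pos rfl] at this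
    rw [← this, hf]
    exact Finset.sum_congr rfl fun i _ => abs_mul_abs_self _
  have hge : μ i₀ ≤ dotProduct f (kerL M f) := by
    have e : dotProduct (b i₀) (kerL M (b i₀)) = μ i₀ := by
      rw [h1, dotProduct_smul, h2, if_pos rfl, smul_eq_mul, mul_one]
    rw [← e]
    simp only [dotProduct, kerL, LinearMap.coe_mk, AddHom.coe_mk, Finset.mul_sum]
    refine Finset.sum_le_sum fun i _ => Finset.sum_le_sum fun j _ => ?_
    have := le_abs_self (b i₀ i * b i₀ j)
    rw [abs_mul] at this
    have := mul_le_mul_of_nonneg_left this (hpos i j).le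
    simp only [hf]
    linarith
  have hz : ∑ i, (μ i₀ - μ i) * (dotProduct (b i) f * dotProduct (b i) f) = 0 := by
    have e : ∑ i, (μ i₀ - μ i) * (dotProduct (b i) f * dotProduct (b i) f) =
        μ i₀ * dotProduct f f - dotProduct f (kerL M f) := by
      rw [hq, hn, Finset.mul_sum, ← Finset.sum_sub_distrib]
      exact Finset.sum_congr rfl fun i _ => by ring
    refine le_antisymm ?_ (Finset.sum_nonneg fun i _ => mul_nonneg (sub_nonneg.2 (hi₀ i)) (mul_self_nonneg _))
    rw [e, hff]; linarith
  have hker : kerL M f = μ i₀ • f := by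
    rw [map_eigenbasis h1 h3 f]
    conv_rhs => rw [h3 f]
    rw [Finset.smul_sum]
    refine Finset.sum_congr rfl fun i _ => ?_
    have := (Finset.sum_eq_zero_iff_of_nonneg fun i _ => mul_nonneg (sub_nonneg.2 (hi₀ i))
      (mul_self_nonneg (dotProduct (b i) f))).1 hz i (Finset.mem_univ _)
    rw [smul_smul]
    congr 1
    rcases mul_eq_zero.1 this with h | h
    · rw [sub_eq_zero.1 h]
    · rw [mul_self_eq_zero.1 h]; simp
  refine ⟨μ i₀, hl, f, fun i => ?_, hker⟩
  have e : μ i₀ * f i = ∑ j, M i j * f j := (congrFun hker i).symm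
  have hf0 : ∀ j, 0 ≤ f j := fun j => by rw [hf]; exact abs_nonneg _
  obtain ⟨j, hj⟩ : ∃ j, f j ≠ 0 := by
    by_contra! hcon
    have : f = 0 := funext hcon
    rw [this] at hff; simp at hff
  have : 0 < ∑ j, M i j * f j := Finset.sum_pos' (fun k _ => mul_nonneg (hpos i k).le (hf0 k))
    ⟨j, Finset.mem_univ _, mul_pos (hpos i j) (lt_of_le_of_ne (hf0 j) hj.symm)⟩
  rw [← e] at this
  exact pos_of_mul_pos_right this hl.le

/-- A positive eigenvector has the largest eigenvalue. -/
lemma perron_max {l : ℝ} {φ : ι → ℝ} (hφ : ∀ i, 0 < φ i) (hl : kerL M φ = l • φ) {m : ℝ} {χ : ι → ℝ} (hχ : χ ≠ 0)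
    (hm : kerL M χ = m • χ) : |m| ≤ l := by
  obtain ⟨f, hf⟩ : ∃ f : ι → ℝ, f = fun i => |χ i| := ⟨_, rfl⟩
  have h1 : |m| * dotProduct φ f ≤ dotProduct φ (kerL M f) := by
    rw [← smul_eq_mul, ← dotProduct_smul]
    refine Finset.sum_le_sum fun i _ => mul_le_mul_of_nonneg_left ?_ (hφ i).le
    have e : m * χ i = ∑ j, M i j * χ j := (congrFun hm i).symm
    simp only [hf, Pi.smul_apply, smul_eq_mul, kerL, LinearMap.coe_mk, AddHom.coe_mk]
    rw [← abs_mul, e]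
    refine (Finset.abs_sum_le_sum_abs _ _).trans (Finset.sum_le_sum fun j _ => ?_)
    rw [abs_mul, abs_of_pos (hpos i j)]
  rw [kerL_symm hM, hl, smul_dotProduct, smul_eq_mul] at h1
  have h2 : 0 < dotProduct φ f := by
    obtain ⟨j, hj⟩ : ∃ j, χ j ≠ 0 := Function.ne_iff.1 hχ
    refine Finset.sum_pos' (fun k _ => mul_nonneg (hφ k).le (by rw [hf]; exact abs_nonneg _)) ⟨j, Finset.mem_univ _, ?_⟩
    rw [hf]
    exact mul_pos (hφ j) (abs_pos.2 hj)
  exact le_of_mul_le_mul_right h1 h2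

end Perron

section TransferSpectrum
variable {n : ℕ} {K : ℝ}

lemma rowW_pos (s : Fin (n + 1) → Bool) : 0 < rowW K s := Real.exp_pos _

lemma tmat_pos (s t : Fin (n + 1) → Bool) : 0 < tmat K s t :=
  mul_pos (mul_pos (rowW_pos s) (Real.exp_pos _)) (rowW_pos t)

lemma colW_symm (s t : Fin (n + 1) → Bool) : colW K s t = colW K t s := by
  unfold colW
  congr 2
  exact Finset.sum_congr rfl fun i _ => mul_comm _ _

lemma tmat_symm (s t : Fin (n + 1) → Bool) : tmat K s t = tmat K t s := by
  unfold tmat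
  rw [colW_symm]; ring

lemma tmat_fl (s t : Fin (n + 1) → Bool) : tmat K (fl (n + 1) s) (fl (n + 1) t) = tmat K s t := by
  unfold tmat
  rw [colW_fl, fl_fl, rowW_fl_all, rowW_fl_all]

lemma kerL_tmat (g : (Fin (n + 1) → Bool) → ℝ) : kerL (tmat K) g = trop K g := rfl

lemma trop_fl (g : (Fin (n + 1) → Bool) → ℝ) : trop K (g ∘ fl (n + 1)) = trop K g ∘ fl (n + 1) := by
  funext s
  simp only [trop, Function.comp_apply]
  rw [← Equiv.sum_comp (flEquiv (n + 1))]
  refine Finset.sum_congr rfl fun t _ => ?_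
  simp only [flEquiv, Equiv.coe_fn_mk, fl_fl]
  conv_lhs => rw [← fl_fl (n + 1) s]
  rw [tmat_fl]

lemma dot_fl (f g : (Fin (n + 1) → Bool) → ℝ) (k : ℕ) : dotProduct (f ∘ fl k) g = dotProduct f (g ∘ fl k) := by
  unfold dotProduct
  rw [← Equiv.sum_comp (flEquiv k)]
  refine Finset.sum_congr rfl fun t _ => ?_
  simp [flEquiv, fl_fl]

/-- The flip-invariant positive eigenvector of the transfer operator. -/
lemma exists_ground (n : ℕ) (K : ℝ) : ∃ l : ℝ, 0 < l ∧ ∃ φ : (Fin (n + 1) → Bool) → ℝ, (∀ s, 0 < φ s) ∧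
    trop K φ = l • φ ∧ φ ∘ fl (n + 1) = φ := by
  obtain ⟨l, hl, φ, hφ, he⟩ := exists_perron (M := tmat (n := n) K) tmat_pos tmat_symm
  refine ⟨l, hl, φ + φ ∘ fl (n + 1), fun s => add_pos (hφ _) (hφ _), ?_, ?_⟩
  · rw [← kerL_tmat, map_add, kerL_tmat, kerL_tmat, trop_fl, ← kerL_tmat, he, smul_add]
    rfl
  · funext s
    simp [fl_fl, add_comm]

/-- The space spanned by products of `k` fermions applied to `φ`. -/
inductive FSp (φ : (Fin (n + 1) → Bool) → ℝ) : ℕ → ((Fin (n + 1) → Bool) → ℝ) → Prop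
  | base (c : ℝ) : FSp φ 0 (c • φ)
  | step {k : ℕ} (x : Fin (n + 1) ⊕ Fin (n + 1) → ℝ) {g} : FSp φ k g → FSp φ (k + 1) (wop x g)
  | add {k : ℕ} {f g} : FSp φ k f → FSp φ k g → FSp φ k (f + g)
  | smul {k : ℕ} (c : ℝ) {g} : FSp φ k g → FSp φ k (c • g)

lemma FSp.annihilate {φ : (Fin (n + 1) → Bool) → ℝ} {u : Fin (n + 1) ⊕ Fin (n + 1) → ℝ} (hu : wop u φ = 0)
    {k : ℕ} {f : (Fin (n + 1) → Bool) → ℝ} (hf : FSp φ k f) :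
    (k = 0 → wop u f = 0) ∧ ∀ j, k = j + 1 → FSp φ j (wop u f) := by
  induction hf with
  | base c => exact ⟨fun _ => by rw [wop_smul, hu, smul_zero], fun j hj => by omega⟩
  | add _ _ ih1 ih2 =>
    refine ⟨fun h => by rw [wop_add, ih1.1 h, ih2.1 h, add_zero], fun j hj => ?_⟩
    rw [wop_add]
    exact (ih1.2 j hj).add (ih2.2 j hj)
  | smul c _ ih =>
    refine ⟨fun h => by rw [wop_smul, ih.1 h, smul_zero], fun j hj => ?_⟩
    rw [wop_smul]
    exact (ih.2 j hj).smul c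
  | @step k x g hg ih =>
    refine ⟨fun h => by omega, fun j hj => ?_⟩
    obtain rfl : j = k := by omega
    obtain ⟨c, hc⟩ := wop_anticomm u x
    rw [hc, sub_eq_add_neg, ← neg_one_smul ℝ]
    refine (hg.smul c).add (FSp.smul _ ?_)
    rcases Nat.eq_zero_or_pos j with h0 | h0
    · subst h0
      rw [ih.1 rfl, wop_zero]
      have := hg.smul 0
      rwa [zero_smul] at this
    · obtain ⟨i, rfl⟩ : ∃ i, j = i + 1 := ⟨j - 1, by omega⟩
      exact (ih.2 i rfl).step x

lemma FSp.single {φ : (Fin (n + 1) → Bool) → ℝ} {k : ℕ} (x : Fin (n + 1) ⊕ Fin (n + 1))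
    {f : (Fin (n + 1) → Bool) → ℝ} (hf : FSp φ k f) : FSp φ (k + 1) (fop x f) := by
  have := hf.step (Pi.single x 1)
  rwa [wop_single] at this

lemma FSp.flip {φ : (Fin (n + 1) → Bool) → ℝ} {m : ℕ} {f : (Fin (n + 1) → Bool) → ℝ} (hf : FSp φ m f) (k : ℕ)
    (hk : k ≤ n + 1) : FSp φ (m + 2 * k) (f ∘ fl k) := by
  induction k with
  | zero =>
    have : f ∘ fl 0 = f := funext fun s => by simp [fl_zero]
    rw [this]; exact hf
  | succ k ih =>
    have h1 := ((ih (by omega)).single (Sum.inl ⟨k, by omega⟩)).single (Sum.inr ⟨k, by omega⟩)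
    change FSp φ (m + 2 * k + 1 + 1) _
    convert h1 using 1
    funext s
    simp only [fop, fsgn, fsite, fcut, Sum.elim_inl, Sum.elim_inr, id, Function.comp_apply, fl_fl, sval_fl]
    rw [if_pos (Nat.lt_succ_self _)]
    linear_combination (-f (fl (k + 1) s)) * sval_mul_self (s ⟨k, by omega⟩)

lemma FSp.spin {φ : (Fin (n + 1) → Bool) → ℝ} {m : ℕ} {f : (Fin (n + 1) → Bool) → ℝ} (hf : FSp φ m f)
    (k : Fin (n + 1)) : FSp φ (m + 2 * k.val + 1) (fun s => sval (s k) * f s) := by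
  have h1 := (hf.flip k.val (by omega)).single (Sum.inl k)
  convert h1 using 1
  funext s
  simp [fop, fsgn, fsite, fcut, fl_fl]

lemma FSp.prod (φ : (Fin (n + 1) → Bool) → ℝ) (A : Finset (Fin (n + 1))) :
    ∃ m, m % 2 = A.card % 2 ∧ FSp φ m (fun s => (∏ i ∈ A, sval (s i)) * φ s) := by
  induction A using Finset.induction_on with
  | empty => exact ⟨0, rfl, by simpa using FSp.base (φ := φ) 1⟩
  | insert a A ha ih =>
    obtain ⟨m, hm, hf⟩ := ih
    refine ⟨m + 2 * a.val + 1, ?_, ?_⟩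
    · rw [Finset.card_insert_of_notMem ha]; omega
    · have := hf.spin a
      convert this using 1
      funext s
      rw [Finset.prod_insert ha, mul_assoc]

/-- A function orthogonal to all `s_A φ` vanishes. -/
lemma eq_zero_of_prod_orthogonal {φ ψ : (Fin (n + 1) → Bool) → ℝ} (hφ : ∀ s, 0 < φ s)
    (h : ∀ A : Finset (Fin (n + 1)), dotProduct (fun s => (∏ i ∈ A, sval (s i)) * φ s) ψ = 0) : ψ = 0 := by
  funext t
  have h1 : ∑ s, (∏ i, (1 + sval (t i) * sval (s i))) * (φ s * ψ s) = 0 := by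
    simp only [Finset.prod_one_add, Finset.sum_mul]
    rw [Finset.sum_comm]
    refine Finset.sum_eq_zero fun A _ => ?_
    have := h A
    simp only [dotProduct] at this
    rw [← mul_zero (∏ i ∈ A, sval (t i)), ← this, Finset.mul_sum]
    refine Finset.sum_congr rfl fun s _ => ?_
    rw [Finset.prod_mul_distrib]; ring
  rw [Finset.sum_eq_single t] at h1
  · have h2 : (∏ i, (1 + sval (t i) * sval (t i))) ≠ 0 := by
      refine Finset.prod_ne_zero_iff.2 fun i _ => ?_
      rw [sval_mul_self]; norm_num
    exact ((mul_eq_zero.1 ((mul_eq_zero.1 h1).resolve_left h2)).resolve_left (hφ t).ne')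
  · intro s _ hs
    obtain ⟨i, hi⟩ : ∃ i, s i ≠ t i := Function.ne_iff.1 hs
    rw [Finset.prod_eq_zero (Finset.mem_univ i), zero_mul]
    rcases Bool.eq_false_or_eq_true (s i) with h1 | h1 <;> rcases Bool.eq_false_or_eq_true (t i) with h2 | h2 <;>
      simp_all [sval]
  · simp

/-- Odd eigenvalues are separated from the largest eigenvalue. -/
lemma odd_eigenvalue_le (hK : 0 < K) {l : ℝ} (hl : 0 < l) {φ : (Fin (n + 1) → Bool) → ℝ} (hρ : decayRate K < 1)
    (hφ : ∀ s, 0 < φ s) (he : trop K φ = l • φ) (hev : φ ∘ fl (n + 1) = φ) {m : ℝ} {ψ : (Fin (n + 1) → Bool) → ℝ}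
    (hψ : ψ ≠ 0) (hodd : ψ ∘ fl (n + 1) = -ψ) (hm : trop K ψ = m • ψ) : |m| ≤ decayRate K * l := by
  by_contra! hlt
  apply hψ
  have hρ0 := decayRate_pos hK
  obtain ⟨b, μ, h1, h2, h3⟩ := exists_eigenbasis (rotL (n := n) K) (rotL_symm K)
  have hcre : ∀ (r : ℝ) (v : Fin (n + 1) ⊕ Fin (n + 1) → ℝ), rotL K v = r • v → 1 ≤ r * decayRate K →
      wop v φ = 0 := by
    intro r v hv hr
    by_contra h0
    have hr1 : 1 < r := by
      by_contra! hcon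
      nlinarith
    have e := trop_wop K hK v φ
    rw [he, wop_smul] at e
    change _ = l • wop (rotL K v) φ at e
    rw [hv, wop_smul_left, smul_smul] at e
    have := perron_max (M := tmat (n := n) K) tmat_pos tmat_symm hφ he h0 e
    rw [abs_of_pos (by positivity)] at this
    nlinarith
  have hann : ∀ (r : ℝ) (v : Fin (n + 1) ⊕ Fin (n + 1) → ℝ), rotL K v = r • v → 0 < r → r ≤ decayRate K →
      ∀ f, dotProduct (wop v f) ψ = 0 := by
    intro r v hv hr0 hr
    obtain ⟨χ, hχ⟩ : ∃ χ : (Fin (n + 1) → Bool) → ℝ, χ = fun s => dotProduct (wop v (Pi.single s 1)) ψ := ⟨_, rfl⟩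
    have hlin : ∀ f, dotProduct (wop v f) ψ = dotProduct χ f := by
      intro f
      have e : f = ∑ s, f s • Pi.single s (1 : ℝ) := by
        funext t
        simp [Finset.sum_apply, Pi.single_apply]
      have hs : ∀ (S : Finset (Fin (n + 1) → Bool)), wop v (∑ s ∈ S, f s • Pi.single s (1 : ℝ)) =
          ∑ s ∈ S, f s • wop v (Pi.single s 1) := by
        intro S
        induction S using Finset.induction_on with
        | empty => simp [wop_zero]
        | insert a S ha ih => rw [Finset.sum_insert ha, Finset.sum_insert ha, wop_add, wop_smul, ih]
      conv_lhs => rw [e]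
      rw [hs, sum_dotProduct]
      simp only [smul_dotProduct, smul_eq_mul]
      rw [dotProduct_comm]
      simp only [hχ, dotProduct]
    have hA : kerL (tmat K) χ = (m / r) • χ := by
      have key : ∀ f, dotProduct (kerL (tmat K) χ) f = dotProduct ((m / r) • χ) f := by
        intro f
        rw [← kerL_symm tmat_symm, kerL_tmat, ← hlin, smul_dotProduct, ← hlin, smul_eq_mul]
        have e1 : dotProduct (wop v f) (kerL (tmat K) ψ) = m * dotProduct (wop v f) ψ := by
          rw [kerL_tmat, hm, dotProduct_smul, smul_eq_mul]
        rw [kerL_symm tmat_symm, kerL_tmat, trop_wop K hK] at e1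
        change dotProduct (wop (rotL K v) _) ψ = _ at e1
        rw [hv, wop_smul_left, smul_dotProduct, smul_eq_mul] at e1
        field_simp
        linarith
      funext s
      have := key (Pi.single s 1)
      simpa using this
    have hχ0 : χ = 0 := by
      by_contra h0
      have := perron_max (M := tmat (n := n) K) tmat_pos tmat_symm hφ he h0 hA
      rw [abs_div, abs_of_pos hr0, div_le_iff₀ hr0] at this
      nlinarith
    intro f
    rw [hlin, hχ0, zero_dotProduct]
  have hwsum : ∀ x g, dotProduct (wop x g) ψ = ∑ i, dotProduct (b i) x * dotProduct (wop (b i) g) ψ := by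
    intro x g
    have e : wop x g = ∑ i, dotProduct (b i) x • wop (b i) g := by
      funext s
      have hx : ∀ j, x j = ∑ i, dotProduct (b i) x * b i j := fun j => by
        have := congrFun (h3 x) j
        simpa only [Finset.sum_apply, Pi.smul_apply, smul_eq_mul] using this
      simp only [Finset.sum_apply, Pi.smul_apply, smul_eq_mul, wop]
      simp only [Finset.mul_sum]
      rw [Finset.sum_comm]
      refine Finset.sum_congr rfl fun j _ => ?_
      conv_lhs => rw [hx j]
      rw [Finset.sum_mul]
      exact Finset.sum_congr rfl fun i _ => by ring
    rw [e, sum_dotProduct]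
    simp only [smul_dotProduct, smul_eq_mul]
  have hortho : ∀ k j f, j = 2 * k + 1 → FSp φ j f → dotProduct f ψ = 0 := by
    intro k
    induction k using Nat.strong_induction_on with
    | _ k ihk =>
    intro j f hj hf
    induction hf with
    | base c => omega
    | add _ _ ih1 ih2 => rw [add_dotProduct, ih1 hj, ih2 hj, add_zero]
    | smul c _ ih => rw [smul_dotProduct, ih hj, smul_zero]
    | @step j x g hg _ =>
      rw [hwsum]
      refine Finset.sum_eq_zero fun i _ => ?_
      have hb : b i ≠ 0 := fun h0 => by have := h2 i i; simp [h0] at this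
      obtain ⟨hr0, hr | hr⟩ := rotL_gap hK hb (h1 i)
      · rw [hann _ _ (h1 i) hr0 hr, mul_zero]
      · have ha := hg.annihilate (hcre _ _ (h1 i) hr)
        rcases Nat.eq_zero_or_pos k with hk | hk
        · rw [ha.1 (by omega), zero_dotProduct, mul_zero]
        · rw [ihk (k - 1) (by omega) (2 * (k - 1) + 1) _ rfl (ha.2 _ (by omega)), mul_zero]
  refine eq_zero_of_prod_orthogonal hφ fun A => ?_
  obtain ⟨j, hj, hf⟩ := FSp.prod φ A
  rcases Nat.even_or_odd A.card with hA | hA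
  · have e := dot_fl (fun s => (∏ i ∈ A, sval (s i)) * φ s) ψ (n + 1)
    have e2 : (fun s => (∏ i ∈ A, sval (s i)) * φ s) ∘ fl (n + 1) = fun s => (∏ i ∈ A, sval (s i)) * φ s := by
      funext s
      have e3 : φ (fl (n + 1) s) = φ s := congrFun hev s
      simp only [Function.comp_apply, e3, sval_fl]
      congr 1
      have : ∀ i : Fin (n + 1), (if i.val < n + 1 then (-1 : ℝ) else 1) = -1 := fun i => if_pos i.isLt
      simp only [this, Finset.prod_mul_distrib, Finset.prod_const, hA.neg_one_pow, one_mul]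
    rw [e2, hodd, dotProduct_neg] at e
    linarith
  · have := Nat.odd_iff.1 hA
    obtain ⟨k, rfl⟩ : ∃ k, j = 2 * k + 1 := ⟨j / 2, by omega⟩
    exact hortho k _ _ rfl hf

/-- Decay of the transfer operator on odd functions. -/
lemma odd_contraction (hK : 0 < K) (hρ : decayRate K < 1) {l : ℝ} (hl : 0 < l) {φ : (Fin (n + 1) → Bool) → ℝ}
    (hφ : ∀ s, 0 < φ s) (he : trop K φ = l • φ) (hev : φ ∘ fl (n + 1) = φ) {v : (Fin (n + 1) → Bool) → ℝ}
    (hv : v ∘ fl (n + 1) = -v) :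
    dotProduct (trop K v) (trop K v) ≤ (decayRate K * l) ^ 2 * dotProduct v v := by
  obtain ⟨T, hT⟩ : ∃ T : ((Fin (n + 1) → Bool) → ℝ) →ₗ[ℝ] ((Fin (n + 1) → Bool) → ℝ),
      T = (1 / 2 : ℝ) • (kerL (tmat K) - kerL (tmat K) ∘ₗ LinearMap.funLeft ℝ ℝ (fl (n + 1))) := ⟨_, rfl⟩
  have hTa : ∀ u, T u = (1 / 2 : ℝ) • (trop K u - trop K (u ∘ fl (n + 1))) := fun u => by rw [hT]; rfl
  have hTv : T v = trop K v := by
    rw [hTa, hv, ← kerL_tmat, ← kerL_tmat, map_neg, sub_neg_eq_add, ← two_smul ℝ, smul_smul]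
    norm_num
  have hff : ∀ u : (Fin (n + 1) → Bool) → ℝ, (u ∘ fl (n + 1)) ∘ fl (n + 1) = u := fun u => by
    funext s; simp [fl_fl]
  have hsymm : ∀ u w, dotProduct u (T w) = dotProduct (T u) w := by
    intro u w
    rw [hTa, hTa, dotProduct_smul, smul_dotProduct, dotProduct_sub, sub_dotProduct, ← kerL_tmat, ← kerL_tmat,
      ← kerL_tmat, ← kerL_tmat, kerL_symm tmat_symm u w, kerL_symm tmat_symm u, ← dot_fl, kerL_tmat, kerL_tmat, trop_fl]
  rw [← hTv]
  refine dot_map_le hsymm (fun m χ hχ hm => ?_) v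
  by_cases h0 : m = 0
  · rw [h0, abs_zero]
    exact mul_nonneg (decayRate_pos hK).le hl.le
  · have hodd : χ ∘ fl (n + 1) = -χ := by
      have e1 : (T χ) ∘ fl (n + 1) = -T χ := by
        rw [hTa]
        have e2 := trop_fl (K := K) χ
        have e3 := trop_fl (K := K) (χ ∘ fl (n + 1))
        rw [hff] at e3
        change (1 / 2 : ℝ) • (trop K χ ∘ fl (n + 1) - trop K (χ ∘ fl (n + 1)) ∘ fl (n + 1)) = _
        rw [← e2, ← e3, ← smul_neg, neg_sub]
      rw [hm] at e1
      change m • (χ ∘ fl (n + 1)) = -(m • χ) at e1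
      rw [← smul_neg] at e1
      exact smul_right_injective _ h0 e1
    refine odd_eigenvalue_le hK hl hρ hφ he hev hχ hodd ?_
    rw [← hm, hTa, hodd, ← kerL_tmat, ← kerL_tmat, map_neg, sub_neg_eq_add, ← two_smul ℝ, smul_smul]
    norm_num

end TransferSpectrum

end

noncomputable section

section PathSum
variable {S : Type*} [Fintype S]

/-- Iterated weighted sums along a path. -/
def pathG (T : (S → ℝ) →ₗ[ℝ] (S → ℝ)) : ℕ → (ℕ → S → ℝ) → S → ℝ
  | 0, d => d 0
  | k + 1, d => d 0 * T (pathG T k fun r => d (r + 1))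

lemma sum_cons {k : ℕ} (h : (Fin (k + 1) → S) → ℝ) :
    ∑ s : Fin (k + 1) → S, h s = ∑ x, ∑ s : Fin k → S, h (Fin.cons x s) := by
  rw [← Fintype.sum_prod_type', ← Equiv.sum_comp (Fin.consEquiv fun _ => S)]
  rfl

lemma kerL_apply (M : S → S → ℝ) (g : S → ℝ) (x : S) : kerL M g x = ∑ y, M x y * g y := rfl

lemma pathG_eq (M : S → S → ℝ) (k : ℕ) (d : ℕ → S → ℝ) (x : S) : pathG (kerL M) k d x =
    ∑ s : Fin k → S, (∏ r : Fin (k + 1), d r.val ((Fin.cons x s : Fin (k + 1) → S) r)) *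
      ∏ r : Fin k, M ((Fin.cons x s : Fin (k + 1) → S) r.castSucc) ((Fin.cons x s : Fin (k + 1) → S) r.succ) := by
  induction k generalizing d x with
  | zero => simp [pathG]
  | succ k ih =>
    rw [sum_cons]
    change d 0 x * (kerL M (pathG (kerL M) k fun r => d (r + 1))) x = _
    rw [kerL_apply, Finset.mul_sum]
    refine Finset.sum_congr rfl fun y _ => ?_
    rw [ih (fun r => d (r + 1)) y, Finset.mul_sum, Finset.mul_sum]
    refine Finset.sum_congr rfl fun s _ => ?_
    rw [Fin.prod_univ_succ (fun r : Fin (k + 1 + 1) => _), Fin.prod_univ_succ (fun r : Fin (k + 1) => M _ _)]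
    simp only [Fin.cons_zero, Fin.cons_succ, Fin.val_zero, Fin.val_succ, Fin.castSucc_zero, ← Fin.succ_castSucc]
    ring

lemma sum_pathG (M : S → S → ℝ) (k : ℕ) (d : ℕ → S → ℝ) : ∑ x, pathG (kerL M) k d x =
    ∑ s : Fin (k + 1) → S, (∏ r : Fin (k + 1), d r.val (s r)) * ∏ r : Fin k, M (s r.castSucc) (s r.succ) := by
  rw [sum_cons]
  exact Finset.sum_congr rfl fun x _ => pathG_eq M k d x

omit [Fintype S] in
lemma pathG_skip (T : (S → ℝ) →ₗ[ℝ] (S → ℝ)) (a : ℕ) (j : ℕ) (d : ℕ → S → ℝ) (hd : ∀ r, 0 < r → r ≤ a → d r = 1) :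
    pathG T (a + 1 + j) d = d 0 * (T ^ (a + 1)) (pathG T j fun r => d (a + 1 + r)) := by
  induction a generalizing d with
  | zero =>
    rw [show 0 + 1 + j = j + 1 by ring, pathG, zero_add, pow_one]
    congr 3
    funext r; rw [add_comm]
  | succ a ih =>
    rw [show a + 1 + 1 + j = (a + 1 + j) + 1 by ring, pathG, ih _ fun r h0 h1 => hd _ (by omega) (by omega)]
    rw [zero_add, hd 1 one_pos (by omega), one_mul, pow_succ' T (a + 1), Module.End.mul_apply]
    congr 5
    funext r; congr 1; ring

omit [Fintype S] in
lemma prod_marker {k i : ℕ} (hi : i < k + 1) (w : S → ℝ) (s : Fin (k + 1) → S) :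
    ∏ r : Fin (k + 1), (if r.val = i then w else 1) (s r) = w (s ⟨i, hi⟩) := by
  rw [Finset.prod_eq_single (⟨i, hi⟩ : Fin (k + 1))]
  · rw [if_pos rfl]
  · intro r _ hr
    rw [if_neg fun h => hr (Fin.ext h)]; rfl
  · intro h; exact absurd (Finset.mem_univ _) h

/-- A two-point function along a path as a matrix element. -/
lemma path_two_point (M : S → S → ℝ) (a q c k : ℕ) (hk : k = a + 1 + (q + 1 + (c + 1))) (w f g : S → ℝ) :
    ∑ s : Fin (k + 1) → S, w (s 0) * w (s (Fin.last _)) *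
        (f (s ⟨a + 1, by omega⟩) * g (s ⟨a + 1 + (q + 1), by omega⟩)) *
        ∏ r : Fin k, M (s r.castSucc) (s r.succ) =
      dotProduct w ((kerL M ^ (a + 1)) (f * (kerL M ^ (q + 1)) (g * (kerL M ^ (c + 1)) w))) := by
  obtain ⟨d, hd⟩ : ∃ d : ℕ → S → ℝ, ∀ r, d r = (if r = 0 then w else 1) * (if r = k then w else 1) *
    ((if r = a + 1 then f else 1) * (if r = a + 1 + (q + 1) then g else 1)) := ⟨_, fun _ => rfl⟩
  have e1 : dotProduct w ((kerL M ^ (a + 1)) (f * (kerL M ^ (q + 1)) (g * (kerL M ^ (c + 1)) w))) =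
      ∑ x, pathG (kerL M) k d x := by
    rw [hk, pathG_skip _ _ _ d, pathG_skip, pathG_skip _ c 0]
    · simp only [pathG, hd]
      rw [hk]
      simp only [if_true, add_zero]
      have n1 : ∀ r, ¬ (0 = r + 1) := fun r => by omega
      simp only [dotProduct, Pi.mul_apply]
      refine Finset.sum_congr rfl fun x _ => ?_
      have i1 : ¬ (0 = a + 1 + (q + 1 + (c + 1))) := by omega
      have i2 : ¬ (0 = a + 1) := by omega
      have i3 : ¬ (0 = a + 1 + (q + 1)) := by omega
      have i4 : ¬ (a + 1 = 0) := by omega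
      have i5 : ¬ (a + 1 = a + 1 + (q + 1 + (c + 1))) := by omega
      have i6 : ¬ (a + 1 = a + 1 + (q + 1)) := by omega
      have i7 : ¬ (a + 1 + (q + 1) = 0) := by omega
      have i8 : ¬ (a + 1 + (q + 1) = a + 1) := by omega
      have i9 : ¬ (a + 1 + (q + 1) = a + 1 + (q + 1 + (c + 1))) := by omega
      have i10 : ¬ (a + 1 + (q + 1 + (c + 1)) = 0) := by omega
      have i11 : ¬ (a + 1 + (q + 1 + (c + 1)) = a + 1) := by omega
      have i12 : ¬ (a + 1 + (q + 1 + (c + 1)) = a + 1 + (q + 1)) := by omega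
      simp only [if_neg i1, if_neg i2, if_neg i3, if_neg i4, if_neg i5, if_neg i6, if_neg i7, if_neg i8, if_neg i9,
        if_neg i10, if_neg i11, if_neg i12, mul_one, one_mul, Pi.one_apply]
    · intro r h0 h1
      rw [hd, if_neg (by omega), if_neg (by omega), if_neg (by omega), if_neg (by omega)]; simp
    · intro r h0 h1
      rw [hd, if_neg (by omega), if_neg (by omega), if_neg (by omega), if_neg (by omega)]; simp
    · intro r h0 h1
      rw [hd, if_neg (by omega), if_neg (by omega), if_neg (by omega), if_neg (by omega)]; simp
  rw [e1, sum_pathG]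
  refine Finset.sum_congr rfl fun s _ => ?_
  congr 1
  simp only [hd, Pi.mul_apply, Finset.prod_mul_distrib]
  rw [prod_marker (Nat.succ_pos k), prod_marker (Nat.lt_succ_self k), prod_marker (show a + 1 < k + 1 by omega),
    prod_marker (show a + 1 + (q + 1) < k + 1 by omega)]
  rfl

end PathSum

section Correlation
variable {n : ℕ} {K : ℝ}

lemma pow_symm {ι : Type*} [Fintype ι] {T : (ι → ℝ) →ₗ[ℝ] (ι → ℝ)}
    (hT : ∀ u v, dotProduct u (T v) = dotProduct (T u) v) (k : ℕ) (u v : ι → ℝ) :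
    dotProduct u ((T ^ k) v) = dotProduct ((T ^ k) u) v := by
  induction k generalizing u with
  | zero => simp
  | succ k ih => rw [pow_succ', Module.End.mul_apply, hT, ih, ← Module.End.mul_apply, ← pow_succ, ← pow_succ']

lemma dot_cauchy {ι : Type*} [Fintype ι] (u v : ι → ℝ) :
    dotProduct u v ^ 2 ≤ dotProduct u u * dotProduct v v := by
  have := Finset.sum_mul_sq_le_sq_mul_sq Finset.univ u v
  simpa [dotProduct, sq] using this

/-- Ratio bound for the diagonal matrix elements of even powers. -/
lemma exists_ratio (n : ℕ) (K : ℝ) {l : ℝ} (hl : 0 < l) {φ : (Fin (n + 1) → Bool) → ℝ} (hφ : ∀ s, 0 < φ s)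
    (he : trop K φ = l • φ) {u : (Fin (n + 1) → Bool) → ℝ} (hu : ∀ s, 0 < u s) (m p : ℕ) :
    ∃ b, m ≤ b ∧ l ^ (2 * p) * dotProduct (((kerL (tmat K)) ^ b) u) (((kerL (tmat K)) ^ b) u) ≤
      2 * dotProduct (((kerL (tmat K)) ^ (b + p)) u) (((kerL (tmat K)) ^ (b + p)) u) := by
  obtain ⟨a, ha⟩ : ∃ a : ℕ → ℝ, ∀ b, a b = dotProduct (((kerL (tmat K)) ^ b) u) (((kerL (tmat K)) ^ b) u) :=
    ⟨_, fun _ => rfl⟩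
  simp only [← ha]
  by_contra! hcon
  have hφφ : 0 < dotProduct φ φ := Finset.sum_pos (fun s _ => mul_pos (hφ s) (hφ s)) Finset.univ_nonempty
  have hφu : 0 < dotProduct φ u := Finset.sum_pos (fun s _ => mul_pos (hφ s) (hu s)) Finset.univ_nonempty
  have hpow : ∀ k, ((kerL (tmat K)) ^ k) φ = l ^ k • φ := by
    intro k
    induction k with
    | zero => simp
    | succ k ih => rw [pow_succ', Module.End.mul_apply, ih, map_smul, kerL_tmat, he, smul_smul, pow_succ]
  obtain ⟨c, hc⟩ : ∃ c, c = dotProduct φ u ^ 2 / dotProduct φ φ := ⟨_, rfl⟩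
  have hc0 : 0 < c := by rw [hc]; positivity
  have hlow : ∀ k, c * l ^ (2 * k) ≤ a k := by
    intro k
    have := dot_cauchy φ (((kerL (tmat K)) ^ k) u)
    rw [pow_symm (kerL_symm tmat_symm), hpow, smul_dotProduct, smul_eq_mul, ← ha] at this
    rw [hc, div_mul_eq_mul_div, div_le_iff₀ hφφ]
    calc _ = (l ^ k * dotProduct φ u) ^ 2 := by ring
      _ ≤ _ := by linarith
  have hup : ∀ j, a (m + j * p) ≤ (l ^ (2 * p) / 2) ^ j * a m := by
    intro j
    induction j with
    | zero => simp
    | succ j ih =>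
      have h1 := hcon (m + j * p) (by omega)
      rw [show m + (j + 1) * p = m + j * p + p by ring, pow_succ]
      have h2 := mul_le_mul_of_nonneg_left ih (show 0 ≤ l ^ (2 * p) / 2 by positivity)
      linarith
  have hfin : ∀ j : ℕ, c * l ^ (2 * m) * 2 ^ j ≤ a m := by
    intro j
    have h1 := (hlow (m + j * p)).trans (hup j)
    have hp' : 0 < (l ^ (2 * p)) ^ j := by positivity
    rw [div_pow, show 2 * (m + j * p) = 2 * m + 2 * p * j by ring, pow_add, pow_mul l (2 * p) j, div_mul_eq_mul_div,
      le_div_iff₀ (by positivity)] at h1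
    refine le_of_mul_le_mul_right ?_ hp'
    linarith
  obtain ⟨j, hj⟩ := pow_unbounded_of_one_lt (a m / (c * l ^ (2 * m))) (show (1 : ℝ) < 2 by norm_num)
  rw [div_lt_iff₀ (by positivity)] at hj
  linarith [hfin j]

lemma odd_pow_contraction (hK : 0 < K) (hρ : decayRate K < 1) {l : ℝ} (hl : 0 < l) {φ : (Fin (n + 1) → Bool) → ℝ}
    (hφ : ∀ s, 0 < φ s) (he : trop K φ = l • φ) (hev : φ ∘ fl (n + 1) = φ) {v : (Fin (n + 1) → Bool) → ℝ}
    (hv : v ∘ fl (n + 1) = -v) (k : ℕ) :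
    (((kerL (tmat K)) ^ k) v) ∘ fl (n + 1) = -((kerL (tmat K)) ^ k) v ∧
    dotProduct (((kerL (tmat K)) ^ k) v) (((kerL (tmat K)) ^ k) v) ≤ (decayRate K * l) ^ (2 * k) * dotProduct v v := by
  induction k with
  | zero => simpa using hv
  | succ k ih =>
    rw [pow_succ', Module.End.mul_apply, kerL_tmat, ← trop_fl, ih.1, ← kerL_tmat, map_neg]
    refine ⟨rfl, ?_⟩
    have h1 := odd_contraction hK hρ hl hφ he hev ih.1
    have h2 := mul_le_mul_of_nonneg_left ih.2 (sq_nonneg (decayRate K * l))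
    refine h1.trans (h2.trans (le_of_eq ?_))
    ring

/-- Decay of correlations in a strip. -/
theorem strip_decay (n : ℕ) (hK : 0 < K) (hρ : decayRate K < 1) (j j' : Fin (n + 1)) (p : ℕ) (hp : 0 < p) (m : ℕ) :
    ∃ b, m ≤ b ∧
      ∑ s : Fin (b + b + 2 * p + 1) → Fin (n + 1) → Bool, rowW K (s 0) * rowW K (s (Fin.last _)) *
        (sval (s ⟨b, by omega⟩ j) * sval (s ⟨b + 2 * p, by omega⟩ j')) *
        ∏ r : Fin (b + b + 2 * p), tmat K (s r.castSucc) (s r.succ) ≤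
      2 * decayRate K ^ (2 * p) *
      ∑ s : Fin (b + b + 2 * p + 1) → Fin (n + 1) → Bool, rowW K (s 0) * rowW K (s (Fin.last _)) *
        ∏ r : Fin (b + b + 2 * p), tmat K (s r.castSucc) (s r.succ) := by
  obtain ⟨l, hl, φ, hφ, he, hev⟩ := exists_ground n K
  obtain ⟨b, hb, hrat⟩ := exists_ratio n K hl hφ he (u := rowW K) rowW_pos (m + 1) p
  refine ⟨b, by omega, ?_⟩
  obtain ⟨T, hT⟩ : ∃ T, T = kerL (tmat (n := n) K) := ⟨_, rfl⟩
  have hTs : ∀ u v, dotProduct u (T v) = dotProduct (T u) v := by rw [hT]; exact kerL_symm tmat_symm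
  rw [← hT] at hrat
  obtain ⟨c, rfl⟩ : ∃ c, b = c + 1 := ⟨b - 1, by omega⟩
  obtain ⟨σ, hσ⟩ : ∃ σ : Fin (n + 1) → (Fin (n + 1) → Bool) → ℝ, ∀ j, σ j = fun s => sval (s j) := ⟨_, fun _ => rfl⟩
  have hk : c + 1 + (c + 1) + 2 * p = c + 1 + (2 * p - 1 + 1 + (c + 1)) := by omega
  have hq : 2 * p - 1 + 1 = p + p := by omega
  have hsplit : ∀ u v, dotProduct u ((T ^ (p + p)) v) = dotProduct ((T ^ p) u) ((T ^ p) v) := fun u v => by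
    rw [pow_add, Module.End.mul_apply, pow_symm hTs]
  have hself : ∀ f u v : (Fin (n + 1) → Bool) → ℝ, dotProduct u (f * v) = dotProduct (f * u) v := fun f u v =>
    Finset.sum_congr rfl fun s _ => by simp only [Pi.mul_apply]; ring
  have hZ : ∑ s : Fin (c + 1 + (c + 1) + 2 * p + 1) → Fin (n + 1) → Bool, rowW K (s 0) * rowW K (s (Fin.last _)) *
        ∏ r : Fin (c + 1 + (c + 1) + 2 * p), tmat K (s r.castSucc) (s r.succ) =
      dotProduct ((T ^ (c + 1 + p)) (rowW K)) ((T ^ (c + 1 + p)) (rowW K)) := by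
    have e := path_two_point (tmat (n := n) K) c (2 * p - 1) c _ hk (rowW K) 1 1
    simp only [Pi.one_apply, mul_one, one_mul, hq] at e
    rw [e, ← hT, pow_symm hTs, hsplit, ← Module.End.mul_apply, ← pow_add, add_comm p]
  have hN : ∑ s : Fin (c + 1 + (c + 1) + 2 * p + 1) → Fin (n + 1) → Bool, rowW K (s 0) * rowW K (s (Fin.last _)) *
        (sval (s ⟨c + 1, by omega⟩ j) * sval (s ⟨c + 1 + 2 * p, by omega⟩ j')) *
        ∏ r : Fin (c + 1 + (c + 1) + 2 * p), tmat K (s r.castSucc) (s r.succ) =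
      dotProduct ((T ^ p) (σ j * (T ^ (c + 1)) (rowW K))) ((T ^ p) (σ j' * (T ^ (c + 1)) (rowW K))) := by
    have e := path_two_point (tmat (n := n) K) c (2 * p - 1) c _ hk (rowW K) (σ j) (σ j')
    refine Eq.trans ?_ (e.trans ?_)
    · have e2 : c + 1 + (2 * p - 1 + 1) = c + 1 + 2 * p := by omega
      simp only [hσ, e2]
    · rw [hq, ← hT, pow_symm hTs, hself, hsplit]
  have hrow : (rowW K) ∘ fl (n + 1) = rowW (n := n) K := funext fun s => rowW_fl_all K s
  have hw : ∀ k, ((T ^ k) (rowW K)) ∘ fl (n + 1) = (T ^ k) (rowW K) := by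
    intro k
    induction k with
    | zero => exact hrow
    | succ k ih => rw [pow_succ', Module.End.mul_apply, hT, kerL_tmat, ← trop_fl, ← hT, ih]
  have hodd : ∀ j, (σ j * (T ^ (c + 1)) (rowW K)) ∘ fl (n + 1) = -(σ j * (T ^ (c + 1)) (rowW K)) := by
    intro j
    funext s
    have e := congrFun (hw (c + 1)) s
    simp only [Function.comp_apply, Pi.mul_apply, Pi.neg_apply] at e ⊢
    rw [e, hσ]
    simp only [sval_fl]
    rw [if_pos j.isLt]; ring
  have hsq : ∀ j, dotProduct (σ j * (T ^ (c + 1)) (rowW K)) (σ j * (T ^ (c + 1)) (rowW K)) =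
      dotProduct ((T ^ (c + 1)) (rowW K)) ((T ^ (c + 1)) (rowW K)) := by
    intro j
    refine Finset.sum_congr rfl fun s _ => ?_
    simp only [Pi.mul_apply, hσ]
    linear_combination ((T ^ (c + 1)) (rowW K) s * (T ^ (c + 1)) (rowW K) s) * sval_mul_self (s j)
  have hcon := fun j => (odd_pow_contraction hK hρ hl hφ he hev (hodd j) p).2
  simp only [← hT, hsq, mul_pow] at hcon
  have hamgm : ∀ u v : (Fin (n + 1) → Bool) → ℝ, 2 * dotProduct u v ≤ dotProduct u u + dotProduct v v := fun u v => by
    simp only [dotProduct, Finset.mul_sum, ← Finset.sum_add_distrib]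
    exact Finset.sum_le_sum fun s _ => by nlinarith [sq_nonneg (u s - v s)]
  rw [hN, hZ]
  have h3 := mul_le_mul_of_nonneg_left hrat (pow_nonneg (decayRate_pos hK).le (2 * p))
  linarith [hamgm ((T ^ p) (σ j * (T ^ (c + 1)) (rowW K))) ((T ^ p) (σ j' * (T ^ (c + 1)) (rowW K))), hcon j, hcon j']

end Correlation

end

noncomputable section

section Rectangle
variable {n k : ℕ} {K : ℝ}

lemma sum_adjacent (L : ℕ) (F : Fin (L + 1) → Fin (L + 1) → ℝ) :
    ∑ r, ∑ r', (if r'.val = r.val + 1 then F r r' else 0) = ∑ i : Fin L, F i.castSucc i.succ := by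
  rw [Fin.sum_univ_castSucc, Finset.sum_eq_zero (s := Finset.univ) (f := fun r' : Fin (L + 1) =>
    if r'.val = (Fin.last L).val + 1 then F (Fin.last L) r' else 0), add_zero]
  · refine Finset.sum_congr rfl fun i _ => ?_
    rw [Finset.sum_eq_single i.succ]
    · rw [if_pos (by simp)]
    · intro r' _ hr
      rw [if_neg fun h => hr (Fin.ext (by simpa using h))]
    · intro h; exact absurd (Finset.mem_univ _) h
  · intro r' _
    rw [if_neg (by have := r'.isLt; rw [Fin.val_last]; omega)]

/-- Oriented adjacency in a rectangle. -/
def rectE (p q : Fin (k + 1) × Fin (n + 1)) : ℝ :=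
  (if p.1 = q.1 then (if q.2.val = p.2.val + 1 then 1 else 0) else 0) +
    (if q.1.val = p.1.val + 1 then (if p.2 = q.2 then 1 else 0) else 0)

lemma rectE_nonneg (p q : Fin (k + 1) × Fin (n + 1)) : 0 ≤ rectE p q := by
  unfold rectE; positivity

/-- Ising couplings in a rectangle. -/
def rectJ (K : ℝ) (p q : Fin (k + 1) × Fin (n + 1)) : ℝ := K / 2 * (rectE p q + rectE q p)

lemma sum_rectE (s : Fin (k + 1) × Fin (n + 1) → Bool) :
    ∑ p, ∑ q, rectE p q * (sval (s p) * sval (s q)) =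
      ∑ r, ∑ i : Fin n, sval (s (r, i.castSucc)) * sval (s (r, i.succ)) +
        ∑ r : Fin k, ∑ i, sval (s (r.castSucc, i)) * sval (s (r.succ, i)) := by
  have h1 : ∀ (r : Fin (k + 1)) (i : Fin (n + 1)), ∑ q : Fin (k + 1) × Fin (n + 1),
      (if r = q.1 then (if q.2.val = i.val + 1 then 1 else 0) else 0) * (sval (s (r, i)) * sval (s q)) =
      ∑ i' : Fin (n + 1), if i'.val = i.val + 1 then sval (s (r, i)) * sval (s (r, i')) else 0 := by
    intro r i
    rw [Fintype.sum_prod_type]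
    simp only [ite_mul, one_mul, zero_mul]
    rw [Finset.sum_eq_single r]
    · simp
    · intro r' _ hr
      exact Finset.sum_eq_zero fun i' _ => if_neg hr.symm
    · intro h; exact absurd (Finset.mem_univ _) h
  have h2 : ∀ (r : Fin (k + 1)) (i : Fin (n + 1)), ∑ q : Fin (k + 1) × Fin (n + 1),
      (if q.1.val = r.val + 1 then (if i = q.2 then 1 else 0) else 0) * (sval (s (r, i)) * sval (s q)) =
      ∑ r' : Fin (k + 1), if r'.val = r.val + 1 then sval (s (r, i)) * sval (s (r', i)) else 0 := by
    intro r i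
    rw [Fintype.sum_prod_type]
    refine Finset.sum_congr rfl fun r' _ => ?_
    by_cases h : r'.val = r.val + 1
    · simp only [if_pos h]
      rw [Finset.sum_eq_single i]
      · simp
      · intro i' _ hi
        rw [if_neg hi.symm, zero_mul]
      · intro h; exact absurd (Finset.mem_univ _) h
    · simp only [if_neg h, zero_mul, Finset.sum_const_zero]
  simp only [rectE, add_mul, Finset.sum_add_distrib]
  refine congrArg₂ (fun a b : ℝ => a + b) ?_ ?_
  · rw [Fintype.sum_prod_type]
    refine Finset.sum_congr rfl fun r _ => ?_
    simp only [h1]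
    exact sum_adjacent n fun i i' => sval (s (r, i)) * sval (s (r, i'))
  · rw [Fintype.sum_prod_type, Finset.sum_comm]
    simp only [h2]
    rw [Finset.sum_comm (s := (Finset.univ : Finset (Fin k)))]
    refine Finset.sum_congr rfl fun i _ => ?_
    exact sum_adjacent k fun r r' => sval (s (r, i)) * sval (s (r', i))

lemma exp_rectJ (K : ℝ) (s : Fin (k + 1) → Fin (n + 1) → Bool) :
    Real.exp (engJ (rectJ K) 0 fun p => s p.1 p.2) =
      rowW K (s 0) * rowW K (s (Fin.last _)) * ∏ r : Fin k, tmat K (s r.castSucc) (s r.succ) := by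
  have h1 : engJ (rectJ K) 0 (fun p : Fin (k + 1) × Fin (n + 1) => s p.1 p.2) =
      K * (∑ r, ∑ i : Fin n, sval (s r i.castSucc) * sval (s r i.succ)) +
        K * ∑ r : Fin k, ∑ i, sval (s r.castSucc i) * sval (s r.succ i) := by
    have e := sum_rectE fun p : Fin (k + 1) × Fin (n + 1) => s p.1 p.2
    rw [← mul_add, ← e]
    simp only [engJ, rectJ, Pi.zero_apply, zero_mul, Finset.sum_const_zero, add_zero, mul_assoc, add_mul, mul_add,
      Finset.sum_add_distrib, ← Finset.mul_sum]
    have e2 : ∑ p : Fin (k + 1) × Fin (n + 1), ∑ q, rectE q p * (sval (s p.1 p.2) * sval (s q.1 q.2)) =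
        ∑ p : Fin (k + 1) × Fin (n + 1), ∑ q, rectE p q * (sval (s p.1 p.2) * sval (s q.1 q.2)) := by
      rw [Finset.sum_comm]
      exact Finset.sum_congr rfl fun p _ => Finset.sum_congr rfl fun q _ => by ring
    rw [e2]; ring
  have h2 : ∏ r : Fin (k + 1), rowW K (s r) = (∏ r : Fin k, rowW K (s r.castSucc)) * rowW K (s (Fin.last _)) :=
    Fin.prod_univ_castSucc _
  have h3 : ∏ r : Fin (k + 1), rowW K (s r) = rowW K (s 0) * ∏ r : Fin k, rowW K (s r.succ) :=
    Fin.prod_univ_succ _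
  have h4 : (∏ r : Fin (k + 1), rowW K (s r)) * ∏ r : Fin (k + 1), rowW K (s r) =
      Real.exp (K * (∑ r, ∑ i : Fin n, sval (s r i.castSucc) * sval (s r i.succ))) := by
    rw [← Finset.prod_mul_distrib, Finset.mul_sum, Real.exp_sum]
    refine Finset.prod_congr rfl fun r _ => ?_
    rw [rowW, ← Real.exp_add]
    congr 1; ring
  have h5 : ∏ r : Fin k, colW K (s r.castSucc) (s r.succ) =
      Real.exp (K * ∑ r : Fin k, ∑ i, sval (s r.castSucc i) * sval (s r.succ i)) := by
    rw [Finset.mul_sum, Real.exp_sum]; rfl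
  rw [h1, Real.exp_add, ← h4, ← h5]
  simp only [tmat, Finset.prod_mul_distrib]
  nth_rw 1 [h2]
  rw [h3]
  ring

/-- Decay of the two-point function in a long rectangle. -/
lemma rect_decay (n : ℕ) (hK : 0 < K) (hρ : decayRate K < 1) (j j' : Fin (n + 1)) (p : ℕ) (hp : 0 < p) (m : ℕ) :
    ∃ b, m ≤ b ∧ exJ (rectJ (k := b + b + 2 * p) K) 0 (fun s => sval (s (⟨b, by omega⟩, j)) *
      sval (s (⟨b + 2 * p, by omega⟩, j'))) ≤ 2 * decayRate K ^ (2 * p) := by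
  obtain ⟨b, hb, h⟩ := strip_decay n hK hρ j j' p hp m
  refine ⟨b, hb, ?_⟩
  rw [exJ, div_le_iff₀ (ZJ_pos _ _), ZJ, ← Equiv.sum_comp (Equiv.curry _ _ _).symm,
    ← Equiv.sum_comp (Equiv.curry _ _ _).symm (fun s => Real.exp (engJ (rectJ K) 0 s))]
  refine (le_of_eq ?_).trans (h.trans (le_of_eq ?_))
  · refine Finset.sum_congr rfl fun s _ => ?_
    refine (congrArg (_ * ·) (exp_rectJ K s)).trans ?_
    simp only [Equiv.curry_symm_apply, Function.uncurry_apply_pair]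
    ring
  · congr 1
    exact Finset.sum_congr rfl fun s _ => (exp_rectJ K s).symm

/-- Decay of the free two-point function in a box, along a lattice direction. -/
lemma box_decay (hK : 0 < K) (hρ : decayRate K < 1) (p : ℕ) (hp : 0 < p) (L L' : ℤ × ℤ → ℤ)
    (hb : ∀ x ∈ box (2 * p), |L x| ≤ (2 * p : ℕ) ∧ |L' x| ≤ (2 * p : ℕ))
    (hinj : ∀ x y, L x = L y → L' x = L' y → x = y)
    (hn : ∀ x y, y ∈ nbrs x → (L x = L y ∧ (L' y = L' x + 1 ∨ L' x = L' y + 1)) ∨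
      (L' x = L' y ∧ (L y = L x + 1 ∨ L x = L y + 1)))
    (x y : ↥(box (2 * p))) (hx : L x = 0) (hy : L y = (2 * p : ℕ)) :
    exJ (Jb K (box (2 * p))) 0 (fun s => sval (s x) * sval (s y)) ≤ 2 * decayRate K ^ (2 * p) := by
  have hL : ∀ x : ↥(box (2 * p)), -((2 * p : ℕ) : ℤ) ≤ L x ∧ L x ≤ (2 * p : ℕ) := fun x => abs_le.1 (hb x x.2).1
  have hL' : ∀ x : ↥(box (2 * p)), -((2 * p : ℕ) : ℤ) ≤ L' x ∧ L' x ≤ (2 * p : ℕ) := fun x => abs_le.1 (hb x x.2).2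
  obtain ⟨t, ht⟩ : ∃ t : ↥(box (2 * p)) → Fin (2 * (2 * p) + 1), ∀ x, (t x).val = (L' x + (2 * p : ℕ)).toNat :=
    ⟨fun x => ⟨(L' x + (2 * p : ℕ)).toNat, by have := hL' x; omega⟩, fun _ => rfl⟩
  obtain ⟨b, hb, h⟩ := rect_decay (2 * (2 * p)) hK hρ (t x) (t y) p hp (2 * p)
  obtain ⟨u, hu⟩ : ∃ u : ↥(box (2 * p)) → Fin (b + b + 2 * p + 1), ∀ x, (u x).val = (L x + b).toNat :=
    ⟨fun x => ⟨(L x + b).toNat, by have := hL x; omega⟩, fun _ => rfl⟩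
  refine (exJ_pair_embed (e := fun x => (u x, t x)) (J' := rectJ K) ?_ (Jb_nonneg hK.le) ?_ ?_ x y).trans
    (le_trans (le_of_eq ?_) h)
  · intro x y hxy
    have e1 := congrArg (fun q => q.1.val) hxy
    have e2 := congrArg (fun q => q.2.val) hxy
    simp only [hu, ht] at e1 e2
    have := hL x; have := hL y; have := hL' x; have := hL' y
    exact Subtype.ext (hinj _ _ (by omega) (by omega))
  · intro q r
    exact mul_nonneg (by linarith) (add_nonneg (rectE_nonneg _ _) (rectE_nonneg _ _))
  · intro x y
    have a1 := rectE_nonneg (u x, t x) (u y, t y)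
    have a2 := rectE_nonneg (u y, t y) (u x, t x)
    unfold Jb rectJ
    split_ifs with hxy
    · have hE : 1 ≤ rectE (u x, t x) (u y, t y) + rectE (u y, t y) (u x, t x) := by
        have hx1 := hL x
        have hy1 := hL y
        have hx2 := hL' x
        have hy2 := hL' y
        have key : ∀ x y : ↥(box (2 * p)),
            ((u x).val = (u y).val ∧ (t y).val = (t x).val + 1 ∨ (t x).val = (t y).val ∧ (u y).val = (u x).val + 1) →
            1 ≤ rectE (u x, t x) (u y, t y) := by
          intro x y hc
          unfold rectE
          rcases hc with ⟨c1, c2⟩ | ⟨c1, c2⟩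
          · rw [if_pos (Fin.ext c1), if_pos c2]
            have : (0 : ℝ) ≤ if (u y, t y).1.val = (u x, t x).1.val + 1 then
              (if (u x, t x).2 = (u y, t y).2 then (1 : ℝ) else 0) else 0 := by positivity
            linarith
          · rw [if_pos (show (u y, t y).1.val = (u x, t x).1.val + 1 from c2),
              if_pos (show (u x, t x).2 = (u y, t y).2 from Fin.ext c1)]
            have : (0 : ℝ) ≤ if (u x, t x).1 = (u y, t y).1 then
              (if (u y, t y).2.val = (u x, t x).2.val + 1 then (1 : ℝ) else 0) else 0 := by positivity
            linarith
        rcases hn _ _ hxy with ⟨c1, c2 | c2⟩ | ⟨c1, c2 | c2⟩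
        · linarith [key x y (Or.inl ⟨by rw [hu, hu, c1], by rw [ht, ht]; omega⟩)]
        · linarith [key y x (Or.inl ⟨by rw [hu, hu, c1], by rw [ht, ht]; omega⟩)]
        · linarith [key x y (Or.inr ⟨by rw [ht, ht, c1], by rw [hu, hu]; omega⟩)]
        · linarith [key y x (Or.inr ⟨by rw [ht, ht, c1], by rw [hu, hu]; omega⟩)]
      nlinarith
    · exact mul_nonneg (by linarith) (add_nonneg a1 a2)
  · have e1 : u x = ⟨b, by omega⟩ := Fin.ext (by rw [hu, hx]; simp)
    have e2 : u y = ⟨b + 2 * p, by omega⟩ := Fin.ext (by rw [hu, hy]; change _ = b + 2 * p; omega)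
    rw [e1, e2]

/-- Exponential decay of the free two-point function in a box. -/
lemma box_decay_shell (hK : 0 < K) (hρ : decayRate K < 1) (p : ℕ) (hp : 0 < p) (x y : ↥(box (2 * p)))
    (hx : (x : ℤ × ℤ) = (0, 0)) (hy : (y : ℤ × ℤ) ∉ box (2 * p - 1)) :
    exJ (Jb K (box (2 * p))) 0 (fun s => sval (s x) * sval (s y)) ≤ 2 * decayRate K ^ (2 * p) := by
  have hy1 := y.2
  rw [mem_box, abs_le, abs_le] at hy hy1
  have hcases : (y : ℤ × ℤ).1 = (2 * p : ℕ) ∨ -(y : ℤ × ℤ).1 = (2 * p : ℕ) ∨ (y : ℤ × ℤ).2 = (2 * p : ℕ) ∨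
      -(y : ℤ × ℤ).2 = (2 * p : ℕ) := by omega
  rcases hcases with hc | hc | hc | hc
  · refine box_decay hK hρ p hp (fun z => z.1) (fun z => z.2) ?_ ?_ ?_ x y (by rw [hx]) hc
    · exact fun z hz => mem_box.1 hz
    · exact fun z w h1 h2 => Prod.ext h1 h2
    · rintro ⟨a, b⟩ ⟨c, d⟩ h
      simp only [nbrs, Finset.mem_insert, Finset.mem_singleton, Prod.mk.injEq] at h ⊢
      omega
  · refine box_decay hK hρ p hp (fun z => -z.1) (fun z => z.2) ?_ ?_ ?_ x y (by rw [hx]; rfl) hc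
    · exact fun z hz => by rw [abs_neg]; exact mem_box.1 hz
    · exact fun z w h1 h2 => Prod.ext (neg_injective h1) h2
    · rintro ⟨a, b⟩ ⟨c, d⟩ h
      simp only [nbrs, Finset.mem_insert, Finset.mem_singleton, Prod.mk.injEq] at h ⊢
      omega
  · refine box_decay hK hρ p hp (fun z => z.2) (fun z => z.1) ?_ ?_ ?_ x y (by rw [hx]) hc
    · exact fun z hz => (mem_box.1 hz).symm
    · exact fun z w h1 h2 => Prod.ext h2 h1
    · rintro ⟨a, b⟩ ⟨c, d⟩ h
      simp only [nbrs, Finset.mem_insert, Finset.mem_singleton, Prod.mk.injEq] at h ⊢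
      omega
  · refine box_decay hK hρ p hp (fun z => -z.2) (fun z => z.1) ?_ ?_ ?_ x y (by rw [hx]; rfl) hc
    · exact fun z hz => by rw [abs_neg]; exact (mem_box.1 hz).symm
    · exact fun z w h1 h2 => Prod.ext h2 (neg_injective h1)
    · rintro ⟨a, b⟩ ⟨c, d⟩ h
      simp only [nbrs, Finset.mem_insert, Finset.mem_singleton, Prod.mk.injEq] at h ⊢
      omega

lemma Dr_even_le (hK : 0 < K) (hρ : decayRate K < 1) (p : ℕ) (hp : 0 < p) :
    Dr K 0 (2 * p) ≤ 64 * K * (2 * p : ℕ) * decayRate K ^ (2 * p) := by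
  obtain ⟨q, hq⟩ : ∃ q, 2 * p = q + 1 := ⟨2 * p - 1, by omega⟩
  have hd := box_decay_shell hK hρ p hp
  rw [show 2 * p - 1 = q by omega] at hd
  rw [hq] at hd ⊢
  have h0 : ((0, 0) : ℤ × ℤ) ∈ box (q + 1) := mem_box.2 (by simp; positivity)
  refine (Dr_le_sum_free hK.le q h0).trans ?_
  have h1 : ∑ y : ↥(box (q + 1)), (if (y : ℤ × ℤ) ∈ box q then 0 else
      exJ (Jb K (box (q + 1))) 0 fun s => sval (s ⟨(0, 0), h0⟩) * sval (s y)) ≤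
      ∑ y : ↥(box (q + 1)), if (y : ℤ × ℤ) ∈ box q then 0 else 2 * decayRate K ^ (q + 1) := by
    refine Finset.sum_le_sum fun y _ => ?_
    split_ifs with h
    · exact le_rfl
    · exact hd _ y rfl h
  have h2 : ∑ y : ↥(box (q + 1)), (if (y : ℤ × ℤ) ∈ box q then 0 else 2 * decayRate K ^ (q + 1)) =
      8 * (q + 1) * (2 * decayRate K ^ (q + 1)) := by
    rw [Finset.sum_coe_sort (box (q + 1)) fun y => if y ∈ box q then (0 : ℝ) else 2 * decayRate K ^ (q + 1),
      Finset.sum_ite, Finset.sum_const_zero, zero_add, Finset.sum_const, nsmul_eq_mul, ← card_shell,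
      Finset.sdiff_eq_filter]
  rw [h2] at h1
  refine (mul_le_mul_of_nonneg_left h1 (by positivity)).trans (le_of_eq ?_)
  push_cast; ring

lemma summable_linear_mul_geometric {x : ℝ} (c : ℝ) (hx : x < 1) (hx0 : 0 < x) :
    Summable fun r : ℕ => c * ((r : ℝ) ^ 1 * x ^ r) := by
  have h : ‖x‖ < 1 := by rwa [Real.norm_of_nonneg hx0.le]
  have h2 : Summable fun r : ℕ => (r : ℝ) ^ 1 * x ^ r := summable_pow_mul_geometric_of_norm_lt_one 1 h
  exact h2.mul_left c

/-- The influence of the boundary is summable below the critical inverse temperature. -/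
theorem summable_Dr_of_subcritical (hK : 0 < K) (hc : K < betaCrit) : Summable (Dr K 0) := by
  have hρ := decayRate_lt_one hc
  have hρ0 := decayRate_pos hK
  have hs : Summable fun r : ℕ => 64 * K / decayRate K * ((r : ℝ) ^ 1 * decayRate K ^ r) :=
    summable_linear_mul_geometric _ hρ hρ0
  have hle : ∀ r, 2 ≤ r → Dr K 0 r ≤ 64 * K / decayRate K * ((r : ℝ) ^ 1 * decayRate K ^ r) := by
    intro r hr
    obtain ⟨p, hp, hp2⟩ : ∃ p, 0 < p ∧ (r = 2 * p ∨ r = 2 * p + 1) := ⟨r / 2, by omega, by omega⟩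
    have h0 := (Dr_antitone hK.le (show 2 * p ≤ r by omega)).trans (Dr_even_le hK hρ p hp)
    have h1 : ((2 * p : ℕ) : ℝ) ≤ (r : ℝ) := Nat.cast_le.2 (by omega)
    have h2 : decayRate K ^ (2 * p + 1) ≤ decayRate K ^ r := pow_le_pow_of_le_one hρ0.le hρ.le (by omega)
    rw [pow_succ, ← le_div_iff₀ hρ0] at h2
    refine h0.trans ((mul_le_mul (mul_le_mul_of_nonneg_left h1 (by positivity)) h2 (by positivity)
      (by positivity)).trans (le_of_eq ?_))
    rw [pow_one]; ring
  exact (summable_nat_add_iff 2).1 (Summable.of_nonneg_of_le (fun r => Dr_nonneg hK.le (r + 2))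
    (fun r => hle (r + 2) (by omega)) ((summable_nat_add_iff 2).2 hs))

end Rectangle

end

/-- In the uniqueness regime (`h ≠ 0`, or `h = 0` and `β < β_c`) the Schonmann
projection `ν_{β,h}^+` is a regular g-measure: there is a continuous `(0,1)`-valued g-function
`P` with which it is consistent, the variations of `P` are summable, and `ν_{β,h}^+` is the
unique g-measure consistent with `P`. -/
theorem schonmann_regular_g_in_uniqueness_regime
    (β h : ℝ) (hβ : 0 < β) (huniq : h ≠ 0 ∨ (h = 0 ∧ β < betaCrit))
    (μp : Measure Cfg2) (hμp : IsPlusPhase β h μp) :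
    ∃ P : Bool → Past Bool → ℝ,
      IsGFunction P ∧ (∀ a, Continuous (P a)) ∧ (∀ a ω, P a ω ∈ Set.Ioo (0 : ℝ) 1) ∧
      IsGMeasure (schonmann μp) P ∧
      Summable (fun k : ℕ => varG P (k + 1)) ∧
      ∀ ν : Measure (ZSeq Bool), IsGMeasure ν P → ν = schonmann μp := by
  rcases huniq with hh | ⟨rfl, hc⟩
  · exact regular_of_summable_influence hβ.le (summable_Dr_of_field hβ.le hh) μp hμp
  · exact regular_of_summable_influence hβ.le (summable_Dr_of_subcritical hβ hc) μp hμp
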